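/- For every integer d ≥ 2 there exists a properly convex domain Ω ⊆ ℝP^d that is strictly convex, divisible, and not projectively equivalent to an ellipsoid (i.e., no element of SL^±_{d+1}(ℝ) maps Ω onto the image of the cone {x ∈ ℝ^{d+1} : x_{d+1} > (x₁² + ⋯ + x_d²)^{1/2}}); equivalently, Ω is a non-symmetric divisible strictly convex domain. -/

import Mathlib

open Matrix

noncomputable section

/-- `ℝ^{d+1}`. -/
abbrev Vec (d : ℕ) := Fin (d + 1) → ℝ

/-- The real projective space `ℝP^d`. -/
abbrev RP (d : ℕ) := Projectivization ℝ (Vec d)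

instance (d : ℕ) : TopologicalSpace (RP d) :=
  inferInstanceAs (TopologicalSpace (Quotient (projectivizationSetoid ℝ (Vec d))))

/-- The projective transformation of `ℝP^d` induced by an invertible matrix. -/
def projMap {d : ℕ} (g : GL (Fin (d + 1)) ℝ) : RP d → RP d :=
  Projectivization.map (Matrix.mulVecLin (g : Matrix (Fin (d + 1)) (Fin (d + 1)) ℝ))
    (by
      intro x y hxy
      have hdet : IsUnit (g : Matrix (Fin (d + 1)) (Fin (d + 1)) ℝ).det :=
        (Matrix.isUnit_iff_isUnit_det _).mp g.isUnit
      have h := congrArg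
        (Matrix.mulVec ((g : Matrix (Fin (d + 1)) (Fin (d + 1)) ℝ))⁻¹) hxy
      simpa [Matrix.mulVecLin_apply, Matrix.mulVec_mulVec,
        Matrix.nonsing_inv_mul _ hdet] using h)

/-- A sharp convex open cone in `ℝ^{d+1}`: nonempty, open, convex, stable under positive
scalars, containing no affine line. -/
def IsProperCone {d : ℕ} (C : Set (Vec d)) : Prop :=
  C.Nonempty ∧ IsOpen C ∧ Convex ℝ C ∧
    (∀ x ∈ C, ∀ t : ℝ, 0 < t → t • x ∈ C) ∧
    ¬ ∃ x v : Vec d, v ≠ 0 ∧ ∀ t : ℝ, x + t • v ∈ C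

/-- The projectivization of a cone: a subset of `ℝP^d`. -/
def projOfCone {d : ℕ} (C : Set (Vec d)) : Set (RP d) :=
  {P | ∃ (v : Vec d) (hv : v ≠ 0), v ∈ C ∧ P = Projectivization.mk ℝ v hv}

/-- `Ω` is a properly convex domain if it is the projectivization of a sharp convex open
cone. -/
def IsProperlyConvexDomain {d : ℕ} (Ω : Set (RP d)) : Prop :=
  ∃ C : Set (Vec d), IsProperCone C ∧ Ω = projOfCone C

/-- Membership in `SL^±_{d+1}(ℝ)`: determinant `±1`. -/
def detPM1 {d : ℕ} (g : GL (Fin (d + 1)) ℝ) : Prop :=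
  (g : Matrix (Fin (d + 1)) (Fin (d + 1)) ℝ).det = 1 ∨
  (g : Matrix (Fin (d + 1)) (Fin (d + 1)) ℝ).det = -1

/-- `Γ` preserves `Ω` (projectively). -/
def PreservesDomain {d : ℕ} (Γ : Subgroup (GL (Fin (d + 1)) ℝ)) (Ω : Set (RP d)) : Prop :=
  ∀ γ ∈ Γ, projMap γ '' Ω = Ω

/-- The action of `Γ` on `Ω` is properly discontinuous. -/
def ProperlyDiscontinuousOn {d : ℕ} (Γ : Subgroup (GL (Fin (d + 1)) ℝ))
    (Ω : Set (RP d)) : Prop :=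
  ∀ K : Set (RP d), K ⊆ Ω → IsCompact K →
    {γ : Γ | (projMap (γ : GL (Fin (d + 1)) ℝ) '' K ∩ K).Nonempty}.Finite

/-- The action of `Γ` on `Ω` is cocompact: `Ω/Γ` is compact. -/
def CocompactOn {d : ℕ} (Γ : Subgroup (GL (Fin (d + 1)) ℝ)) (Ω : Set (RP d)) : Prop :=
  ∃ K : Set (RP d), IsCompact K ∧ K ⊆ Ω ∧
    (⋃ γ ∈ Γ, projMap γ '' K) = Ω

/-- `Ω` is divided by `Γ`: `Γ` consists of determinant-`±1` matrices, is discrete,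
preserves `Ω`, and acts properly discontinuously and cocompactly on `Ω`. -/
def Divides {d : ℕ} (Γ : Subgroup (GL (Fin (d + 1)) ℝ)) (Ω : Set (RP d)) : Prop :=
  (∀ γ ∈ Γ, detPM1 γ) ∧ DiscreteTopology Γ ∧ PreservesDomain Γ Ω ∧
    ProperlyDiscontinuousOn Γ Ω ∧ CocompactOn Γ Ω

/-- `Ω` is strictly convex: its boundary contains no nondegenerate projective line
segment. -/
def IsStrictlyConvexDomain {d : ℕ} (Ω : Set (RP d)) : Prop :=
  ∀ v w : Vec d, LinearIndependent ℝ ![v, w] →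
    ¬ ∀ t ∈ Set.Icc (0 : ℝ) 1, ∀ h : t • v + (1 - t) • w ≠ 0,
        Projectivization.mk ℝ (t • v + (1 - t) • w) h ∈ frontier Ω

/-- Every finite-index subgroup of `Γ` acts irreducibly on `ℝ^{d+1}`. -/
def StronglyIrreducible {d : ℕ} (Γ : Subgroup (GL (Fin (d + 1)) ℝ)) : Prop :=
  ∀ Δ : Subgroup (GL (Fin (d + 1)) ℝ), Δ ≤ Γ → (Δ.subgroupOf Γ).FiniteIndex →
    ∀ W : Submodule ℝ (Vec d),
      (∀ γ ∈ Δ, ∀ x ∈ W,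
        Matrix.mulVec ((γ : GL (Fin (d + 1)) ℝ) : Matrix (Fin (d + 1)) (Fin (d + 1)) ℝ) x ∈ W) →
      W = ⊥ ∨ W = ⊤

/-- The `k`-simplex spanned by `v : Fin (k+1) → ℝ^{d+1}` in `ℝP^d`. -/
def simplexSet {d k : ℕ} (v : Fin (k + 1) → Vec d) : Set (RP d) :=
  {P | ∃ t : Fin (k + 1) → ℝ, (∀ i, 0 ≤ t i) ∧ t ≠ 0 ∧
    ∃ h : (∑ i, t i • v i) ≠ 0, P = Projectivization.mk ℝ (∑ i, t i • v i) h}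

/-- The relative interior of the `k`-simplex spanned by `v`. -/
def simplexInterior {d k : ℕ} (v : Fin (k + 1) → Vec d) : Set (RP d) :=
  {P | ∃ t : Fin (k + 1) → ℝ, (∀ i, 0 < t i) ∧
    ∃ h : (∑ i, t i • v i) ≠ 0, P = Projectivization.mk ℝ (∑ i, t i • v i) h}

/-- A properly embedded `k`-simplex in `Ω`: relative interior inside `Ω` and boundary
inside `∂Ω`. -/
def ProperlyEmbeddedSimplex {d k : ℕ} (Ω : Set (RP d)) (v : Fin (k + 1) → Vec d) : Prop :=
  LinearIndependent ℝ v ∧ simplexInterior v ⊆ Ω ∧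
    simplexSet v \ simplexInterior v ⊆ frontier Ω

/-- `φ` cuts out a supporting hyperplane of `Ω` at `x`. -/
def IsSupportingAt {d : ℕ} (Ω : Set (RP d)) (φ : Module.Dual ℝ (Vec d)) (x : RP d) : Prop :=
  φ ≠ 0 ∧ φ x.rep = 0 ∧ ∀ P ∈ Ω, φ (Projectivization.rep P) ≠ 0

end

/-- The open round cone `{x : x_{d+1} > sqrt(x₁² + ⋯ + x_d²)}` whose projectivization is
an ellipsoid. -/
def roundCone (d : ℕ) : Set (Vec d) :=
  {x | Real.sqrt (∑ i : Fin d, x i.castSucc ^ 2) < x (Fin.last d)}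

namespace BentDomain

/-- The Lorentzian form `x₁y₁ + ⋯ + x_dy_d - √2 x_{d+1}y_{d+1}`. -/
noncomputable def lor {d : ℕ} : Vec d →ₗ[ℝ] Vec d →ₗ[ℝ] ℝ :=
  LinearMap.mk₂ ℝ
    (fun x y => ∑ i : Fin d, x i.castSucc * y i.castSucc
      - √2 * (x (Fin.last d) * y (Fin.last d)))
    (by intro x y z; simp [add_mul, Finset.sum_add_distrib]; ring)
    (by intro c x y; simp [mul_sub, Finset.mul_sum, mul_assoc]; ring)
    (by intro x y z; simp [mul_add, Finset.sum_add_distrib]; ring)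
    (by intro c x y; simp [mul_sub, Finset.mul_sum, mul_left_comm])

variable {d : ℕ}

lemma lor_apply (x y : Vec d) : lor x y = ∑ i : Fin d, x i.castSucc * y i.castSucc
      - √2 * (x (Fin.last d) * y (Fin.last d)) := rfl

lemma lor_comm (x y : Vec d) : lor x y = lor y x := by
  simp [lor_apply, mul_comm]

lemma lor_add_left (x y z : Vec d) : lor (x + y) z = lor x z + lor y z := by simp
lemma lor_smul_left (c : ℝ) (x z : Vec d) : lor (c • x) z = c * lor x z := by simp
lemma lor_sub_left (x y z : Vec d) : lor (x - y) z = lor x z - lor y z := by simp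
lemma lor_neg_left (x z : Vec d) : lor (-x) z = - lor x z := by simp
lemma lor_add_right (x y z : Vec d) : lor z (x + y) = lor z x + lor z y := by simp
lemma lor_smul_right (c : ℝ) (x z : Vec d) : lor z (c • x) = c * lor z x := by simp
lemma lor_sub_right (x y z : Vec d) : lor z (x - y) = lor z x - lor z y := by simp
lemma lor_neg_right (x z : Vec d) : lor z (-x) = - lor z x := by simp

lemma continuous_lor : Continuous fun p : Vec d × Vec d => lor p.1 p.2 := by
  simp only [lor_apply]; fun_prop

@[fun_prop]
lemma continuous_lor_comp {X : Type*} [TopologicalSpace X] {f g : X → Vec d} (hf : Continuous f)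
    (hg : Continuous g) : Continuous fun x => lor (f x) (g x) :=
  continuous_lor.comp (hf.prodMk hg)

/-- The open future cone. -/
def fut (d : ℕ) : Set (Vec d) := {x | lor x x < 0 ∧ 0 < x (Fin.last d)}

lemma isOpen_fut : IsOpen (fut d) := by
  have h1 : IsOpen {x : Vec d | lor x x < 0} := isOpen_lt (by fun_prop) continuous_const
  have h2 : IsOpen {x : Vec d | 0 < x (Fin.last d)} :=
    isOpen_lt continuous_const (continuous_apply _)
  exact h1.inter h2

lemma sqrt2_pos : (0 : ℝ) < √2 := by positivity

lemma sum_mul_sq_le (x y : Vec d) : (∑ i : Fin d, x i.castSucc * y i.castSucc) ^ 2 ≤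
    (∑ i : Fin d, x i.castSucc * x i.castSucc) * ∑ i : Fin d, y i.castSucc * y i.castSucc := by
  simpa [pow_two] using Finset.sum_mul_sq_le_sq_mul_sq Finset.univ
    (fun i : Fin d => x i.castSucc) (fun i => y i.castSucc)

lemma lor_neg_of_mem_fut_of_le {x y : Vec d} (hx : x ∈ fut d) (hy : lor y y ≤ 0)
    (hy' : 0 < y (Fin.last d)) : lor x y < 0 := by
  obtain ⟨h1, h2⟩ := hx
  rw [lor_apply] at *
  have h3 := sum_mul_sq_le x y
  set A := ∑ i : Fin d, x i.castSucc * x i.castSucc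
  set B := ∑ i : Fin d, y i.castSucc * y i.castSucc
  set C := ∑ i : Fin d, x i.castSucc * y i.castSucc
  have hA : 0 ≤ A := Finset.sum_nonneg fun i _ => mul_self_nonneg _
  have hB : 0 ≤ B := Finset.sum_nonneg fun i _ => mul_self_nonneg _
  have s := sqrt2_pos
  set a := x (Fin.last d)
  set b := y (Fin.last d)
  have : C ^ 2 < (√2 * (a * b)) ^ 2 := by
    have e : (√2 * (a * b)) ^ 2 = (√2 * (a * a)) * (√2 * (b * b)) := by ring
    rw [e]
    refine h3.trans_lt ?_
    have h5 : 0 < √2 * (b * b) := by positivity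
    nlinarith
  have h6 := abs_lt_of_sq_lt_sq this (by positivity)
  linarith [(abs_lt.mp h6).2]

lemma lor_neg_of_mem_fut {x y : Vec d} (hx : x ∈ fut d) (hy : y ∈ fut d) : lor x y < 0 :=
  lor_neg_of_mem_fut_of_le hx hy.1.le hy.2

lemma ne_zero_of_mem_fut {x : Vec d} (hx : x ∈ fut d) : x ≠ 0 := by
  rintro rfl; simpa using hx.2

lemma lor_pos_of_orthogonal {x v : Vec d} (hx : x ∈ fut d) (h : lor x v = 0) (hv : v ≠ 0) :
    0 < lor v v := by
  by_contra! hc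
  rcases lt_trichotomy (v (Fin.last d)) 0 with h0 | h0 | h0
  · have := lor_neg_of_mem_fut_of_le hx (y := -v) (by simpa using hc) (by simpa using h0)
    simp [h] at this
  · apply hv
    rw [lor_apply, h0] at hc
    have h1 : ∑ i : Fin d, v i.castSucc * v i.castSucc = 0 :=
      le_antisymm (by simpa using hc) (Finset.sum_nonneg fun i _ => mul_self_nonneg _)
    rw [Finset.sum_eq_zero_iff_of_nonneg (fun i _ => mul_self_nonneg _)] at h1
    ext i
    refine Fin.lastCases ?_ (fun j => ?_) i
    · simpa using h0
    · simpa using h1 j (Finset.mem_univ _)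
  · have := lor_neg_of_mem_fut_of_le hx hc h0
    linarith

lemma lor_nonneg_of_orthogonal {x v : Vec d} (hx : x ∈ fut d) (h : lor x v = 0) :
    0 ≤ lor v v := by
  by_cases hv : v = 0
  · simp [hv]
  · exact (lor_pos_of_orthogonal hx h hv).le

lemma mem_fut_or_neg_mem {u : Vec d} (hu : lor u u < 0) : u ∈ fut d ∨ -u ∈ fut d := by
  rcases lt_trichotomy (u (Fin.last d)) 0 with h0 | h0 | h0
  · right; exact ⟨by simpa using hu, by simpa using h0⟩
  · rw [lor_apply, h0] at hu
    have : 0 ≤ ∑ i : Fin d, u i.castSucc * u i.castSucc :=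
      Finset.sum_nonneg fun i _ => mul_self_nonneg _
    simp at hu; linarith
  · left; exact ⟨hu, h0⟩

lemma mem_fut_of_lor_nonpos {u x : Vec d} (hu : lor u u < 0) (hx : x ∈ fut d)
    (h : lor u x ≤ 0) : u ∈ fut d := by
  rcases mem_fut_or_neg_mem hu with h1 | h1
  · exact h1
  · have := lor_neg_of_mem_fut h1 hx
    simp at this; linarith

lemma smul_mem_fut {x : Vec d} (hx : x ∈ fut d) {t : ℝ} (ht : 0 < t) : t • x ∈ fut d := by
  refine ⟨?_, ?_⟩
  · have := hx.1
    simp only [lor_smul_left, lor_smul_right]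
    have : 0 < t * (t * -lor x x) := by
      have := neg_pos.mpr hx.1
      positivity
    linarith
  · have := hx.2
    simp only [Pi.smul_apply, smul_eq_mul]; positivity

lemma add_mem_fut {x y : Vec d} (hx : x ∈ fut d) (hy : y ∈ fut d) : x + y ∈ fut d := by
  refine ⟨?_, ?_⟩
  · have := lor_neg_of_mem_fut hx hy
    have h' := lor_comm x y
    have h1 := hx.1
    have h2 := hy.1
    simp only [lor_add_left, lor_add_right]
    linarith
  · have h1 := hx.2
    have h2 := hy.2
    simp only [Pi.add_apply]; linarith

lemma convex_fut : Convex ℝ (fut d) := by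
  intro x hx y hy a b ha hb hab
  rcases ha.eq_or_lt with rfl | ha
  · have : b = 1 := by linarith
    simpa [this] using hy
  rcases hb.eq_or_lt with rfl | hb
  · have : a = 1 := by linarith
    simpa [this] using hx
  exact add_mem_fut (smul_mem_fut hx ha) (smul_mem_fut hy hb)

/-- Reversed Cauchy–Schwarz. -/
lemma lor_mul_lor_le {x : Vec d} (hx : x ∈ fut d) (v : Vec d) :
    lor x x * lor v v ≤ lor x v ^ 2 := by
  have h1 := hx.1
  have h2 : lor x (lor x x • v - lor x v • x) = 0 := by
    simp only [lor_sub_right, lor_smul_right]; ring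
  have h3 := lor_nonneg_of_orthogonal hx h2
  simp only [lor_sub_right, lor_smul_right, lor_sub_left, lor_smul_left, lor_comm v x] at h3
  have h4 : lor x x * (lor x x * lor v v - lor x v ^ 2) ≥ 0 := by nlinarith
  nlinarith

/-- The orthogonal projection onto the hyperplane of the unit vector `n`. -/
noncomputable def proj (n : Vec d) : Vec d →ₗ[ℝ] Vec d :=
  LinearMap.id - (lor n).smulRight n

lemma proj_apply (n z : Vec d) : proj n z = z - lor n z • n := by simp [proj]

lemma lor_proj {n : Vec d} (hn : lor n n = 1) (z : Vec d) : lor n (proj n z) = 0 := by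
  simp [proj_apply, hn]

lemma proj_eq_self {n z : Vec d} (h : lor n z = 0) : proj n z = z := by
  simp [proj_apply, h]

lemma lor_proj_proj {n : Vec d} (hn : lor n n = 1) (z w : Vec d) :
    lor (proj n z) (proj n w) = lor z w - lor n z * lor n w := by
  simp only [proj_apply, lor_sub_right, lor_smul_right, lor_sub_left, lor_smul_left, hn,
    lor_comm z n]
  ring

lemma proj_mem_fut {n z : Vec d} (hn : lor n n = 1) (hz : z ∈ fut d) : proj n z ∈ fut d := by
  have h := hz.1
  refine mem_fut_of_lor_nonpos (x := z) ?_ hz ?_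
  · rw [lor_proj_proj hn]; nlinarith [sq_nonneg (lor n z)]
  · simp only [proj_apply, lor_sub_left, lor_smul_left]; nlinarith [sq_nonneg (lor n z)]

end BentDomain

namespace BentDomain
variable {d : ℕ}

/-! ### Bends -/

/-- The scaling by `2` along a unit vector `n`, fixing its orthogonal. -/
noncomputable def bendEquiv (n : Vec d) (hn : lor n n = 1) : Vec d ≃ₗ[ℝ] Vec d :=
  LinearEquiv.ofLinearMap (LinearMap.id + (lor n).smulRight n)
    (LinearMap.id - (1 / 2 : ℝ) • (lor n).smulRight n)
    (by refine LinearMap.ext fun x => ?_; simp [hn]; module)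
    (by refine LinearMap.ext fun x => ?_; simp [hn]; module)

open Classical in
/-- The bend along `n` (the identity unless `n` is a unit vector). -/
noncomputable def bend (n : Vec d) : Vec d ≃ₗ[ℝ] Vec d :=
  if hn : lor n n = 1 then bendEquiv n hn else 1

lemma bend_apply {n : Vec d} (hn : lor n n = 1) (z : Vec d) : bend n z = z + lor n z • n := by
  simp [bend, hn, bendEquiv]

lemma bend_inv_apply {n : Vec d} (hn : lor n n = 1) (z : Vec d) :
    (bend n)⁻¹ z = z - ((1 / 2 : ℝ) * lor n z) • n := by
  simp [bend, hn, bendEquiv, LinearEquiv.coe_inv, mul_smul]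

/-- The real number attached to a sign. -/
def sg (s : ℤˣ) : ℝ := ((s : ℤ) : ℝ)

@[simp] lemma sg_one : sg 1 = 1 := by simp [sg]
@[simp] lemma sg_neg (s : ℤˣ) : sg (-s) = -sg s := by simp [sg]
lemma sg_mul_self (s : ℤˣ) : sg s * sg s = 1 := by
  rcases Int.units_eq_one_or s with rfl | rfl <;> simp

lemma eq_neg_of_ne {s t : ℤˣ} (h : s ≠ t) : s = -t := by
  rcases Int.units_eq_one_or s with rfl | rfl <;> rcases Int.units_eq_one_or t with rfl | rfl <;>
    simp_all

/-- The bend along `n` with exponent `s`. -/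
noncomputable def bends (s : ℤˣ) (n : Vec d) : Vec d ≃ₗ[ℝ] Vec d := bend n ^ (s : ℤ)

@[simp] lemma bends_neg (s : ℤˣ) (n : Vec d) : bends (-s) n = (bends s n)⁻¹ := by simp [bends]

lemma exists_bends {n : Vec d} (hn : lor n n = 1) (s : ℤˣ) :
    ∃ c : ℝ, 0 < c ∧ ∀ z, bends s n z = z + ((c - 1) * lor n z) • n := by
  rcases Int.units_eq_one_or s with rfl | rfl
  · exact ⟨2, by norm_num, fun z => by norm_num [bends, bend_apply hn]⟩
  · refine ⟨1 / 2, by norm_num, fun z => ?_⟩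
    simp only [bends, Units.val_neg, Units.val_one, _root_.zpow_neg, zpow_one, bend_inv_apply hn]
    module

lemma bends_apply_eq_self {n : Vec d} (hn : lor n n = 1) (s : ℤˣ) {z : Vec d}
    (hz : lor n z = 0) : bends s n z = z := by
  obtain ⟨c, -, h⟩ := exists_bends hn s
  simp [h, hz]

lemma proj_bends {n : Vec d} (hn : lor n n = 1) (s : ℤˣ) (z : Vec d) :
    proj n (bends s n z) = proj n z := by
  obtain ⟨c, -, h⟩ := exists_bends hn s
  simp only [h, proj_apply, lor_add_right, lor_smul_right, hn]; module

lemma exists_lor_bends {n : Vec d} (hn : lor n n = 1) (s : ℤˣ) :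
    ∃ c : ℝ, 0 < c ∧ ∀ z, lor n (bends s n z) = c * lor n z := by
  obtain ⟨c, hc, h⟩ := exists_bends hn s
  exact ⟨c, hc, fun z => by simp only [h, lor_add_right, lor_smul_right, hn]; ring⟩

/-! ### Nesting of half-spaces -/

/-- The half-space of `m'` is contained in the half-space of `m`. -/
def Inside (m m' : Vec d) : Prop := 1 < lor m m' ∧ m' - lor m m' • m ∈ fut d

lemma Inside.lor_lt {m m' p : Vec d} (h : Inside m m') (hp : p ∈ fut d) :
    lor m' p < lor m m' * lor m p := by
  have := lor_neg_of_mem_fut h.2 hp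
  simp only [lor_sub_left, lor_smul_left] at this; linarith

lemma lor_self_aux {m m' : Vec d} (hm : lor m m = 1) (hm' : lor m' m' = 1) :
    lor (m' - lor m m' • m) (m' - lor m m' • m) = 1 - lor m m' ^ 2 := by
  simp only [lor_sub_left, lor_smul_left, lor_sub_right, lor_smul_right, hm, hm', lor_comm m' m]
  ring

lemma lor_cross_aux {m m' : Vec d} (hm : lor m m = 1) (hm' : lor m' m' = 1) :
    lor (m' - lor m m' • m) (m - lor m m' • m') = lor m m' * (lor m m' ^ 2 - 1) := by
  simp only [lor_sub_left, lor_smul_left, lor_sub_right, lor_smul_right, hm, hm', lor_comm m' m]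
  ring

lemma Inside.neg {m m' : Vec d} (hm : lor m m = 1) (hm' : lor m' m' = 1) (h : Inside m m') :
    Inside (-m') (-m) := by
  have h1 : 1 < lor m m' := h.1
  have e : lor (-m') (-m) = lor m m' := by simp [lor_comm m' m]
  refine ⟨by rw [e]; exact h.1, ?_⟩
  rw [e]
  have e2 : -m - lor m m' • -m' = -(m - lor m m' • m') := by module
  rw [e2]
  have h2 : lor (m - lor m m' • m') (m - lor m m' • m') < 0 := by
    have := lor_self_aux hm' hm
    rw [lor_comm m' m] at this
    rw [this]; nlinarith
  refine (mem_fut_or_neg_mem h2).resolve_left fun h3 => ?_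
  have h4 := lor_neg_of_mem_fut h.2 h3
  rw [lor_cross_aux hm hm'] at h4
  have : 0 < lor m m' * (lor m m' ^ 2 - 1) := by
    apply mul_pos <;> nlinarith
  linarith

lemma inside_or_inside {m m' x y : Vec d} (hm : lor m m = 1) (hm' : lor m' m' = 1)
    (ha : 1 < |lor m m'|) (hx : x ∈ fut d) (hy : y ∈ fut d) (h1 : lor m x ≤ 0)
    (h2 : lor m' x ≤ 0) (h3 : 0 ≤ lor m y) (h4 : 0 ≤ lor m' y) :
    Inside m m' ∨ Inside m' m := by
  have ha2 : 1 < lor m m' ^ 2 := (one_lt_sq_iff_one_lt_abs _).mpr ha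
  have e1 := lor_self_aux hm hm'
  have e2 := lor_self_aux hm' hm
  have e3 := lor_cross_aux hm hm'
  rw [lor_comm m' m] at e2
  unfold Inside
  rw [lor_comm m' m]
  set a := lor m m'
  have hu := mem_fut_or_neg_mem (u := m' - a • m) (by rw [e1]; linarith)
  have hv := mem_fut_or_neg_mem (u := m - a • m') (by rw [e2]; linarith)
  rcases lt_abs.mp ha with hpos | hneg
  · rcases hu with hu | hu
    · exact Or.inl ⟨hpos, hu⟩
    rcases hv with hv | hv
    · exact Or.inr ⟨hpos, hv⟩
    exfalso
    have := lor_neg_of_mem_fut hu hv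
    rw [lor_neg_left, lor_neg_right, neg_neg, e3] at this
    nlinarith
  · exfalso
    rcases hu with hu | hu
    · have := lor_neg_of_mem_fut hu hy
      simp only [lor_sub_left, lor_smul_left] at this
      nlinarith
    · have := lor_neg_of_mem_fut hu hx
      simp only [lor_sub_left, lor_smul_left, lor_neg_left] at this
      nlinarith

/-! ### Wall systems and flags -/

variable (d) in
/-- A locally finite system of pairwise ultraparallel hyperplanes, given by unit normals. -/
structure WallSystem where
  S : Set (Vec d)
  unit : ∀ n ∈ S, lor n n = 1
  sep : ∀ n ∈ S, ∀ n' ∈ S, n ≠ n' → 1 < |lor n n'|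
  fin : ∀ K ⊆ fut d, IsCompact K → {n ∈ S | ∃ x ∈ K, lor n x = 0}.Finite

/-- A point of the future cone together with a chamber containing it. -/
structure Flag (W : WallSystem d) where
  pt : Vec d
  side : Vec d → ℤˣ
  mem : pt ∈ fut d
  le : ∀ n ∈ W.S, 0 ≤ sg (side n) * lor n pt

variable {W : WallSystem d}

namespace Flag

/-- The walls separating two flags. -/
def Sep (X Y : Flag W) : Set (Vec d) := {n ∈ W.S | X.side n ≠ Y.side n}

lemma sep_comm (X Y : Flag W) : X.Sep Y = Y.Sep X := by
  ext n; simp [Sep, ne_comm]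

@[simp] lemma sep_self (X : Flag W) : X.Sep X = ∅ := by ext; simp [Sep]

/-- The normal `n` oriented so that the flag lies on its positive side. -/
def or (X : Flag W) (n : Vec d) : Vec d := sg (X.side n) • n

lemma lor_or (X : Flag W) (n z : Vec d) : lor (X.or n) z = sg (X.side n) * lor n z := by
  simp [or]

lemma or_unit (X : Flag W) {n : Vec d} (hn : n ∈ W.S) : lor (X.or n) (X.or n) = 1 := by
  have := sg_mul_self (X.side n)
  simp only [or, lor_smul_left, lor_smul_right, W.unit n hn, mul_one]; exact this

lemma or_neg_of_ne {X Y : Flag W} {n : Vec d} (h : X.side n ≠ Y.side n) : X.or n = -Y.or n := by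
  simp [or, eq_neg_of_ne h]

lemma lor_or_nonneg (X : Flag W) {n : Vec d} (hn : n ∈ W.S) : 0 ≤ lor (X.or n) X.pt := by
  rw [lor_or]; exact X.le n hn

lemma lor_or_nonpos {X Y : Flag W} {n : Vec d} (hn : n ∈ X.Sep Y) : lor (Y.or n) X.pt ≤ 0 := by
  have := X.lor_or_nonneg hn.1
  rw [or_neg_of_ne hn.2] at this
  simpa using this

lemma abs_lor_or_or (X Y : Flag W) (n n' : Vec d) : |lor (X.or n) (Y.or n')| = |lor n n'| := by
  simp only [or, lor_smul_left, lor_smul_right]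
  rcases Int.units_eq_one_or (X.side n) with h | h <;>
    rcases Int.units_eq_one_or (Y.side n') with h' | h' <;> simp [h, h']

lemma finite_sep (X Y : Flag W) : (X.Sep Y).Finite := by
  refine (W.fin (segment ℝ X.pt Y.pt) (convex_fut.segment_subset X.mem Y.mem) ?_).subset ?_
  · rw [segment_eq_image]
    exact isCompact_Icc.image (by fun_prop)
  · intro n hn
    refine ⟨hn.1, ?_⟩
    have h1 := lor_or_nonpos hn
    have h2 := Y.lor_or_nonneg hn.1
    have h3 : (0 : ℝ) ∈ (fun t : ℝ => lor (Y.or n) ((1 - t) • X.pt + t • Y.pt)) '' Set.Icc 0 1 := by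
      apply intermediate_value_Icc zero_le_one
      · apply Continuous.continuousOn
        fun_prop
      · simpa using ⟨h1, h2⟩
    obtain ⟨t, ht, h0⟩ := h3
    refine ⟨_, ⟨1 - t, t, by linarith [ht.2], ht.1, by ring, rfl⟩, ?_⟩
    simp only [lor_or] at h0
    have hs := sg_mul_self (Y.side n)
    rcases mul_eq_zero.mp h0 with h | h
    · rw [h] at hs; simp at hs
    · exact h

/-- The distance of a flag to a wall, up to a monotone reparametrisation. -/
noncomputable def key (X : Flag W) (n : Vec d) : ℝ := |lor n X.pt|

lemma key_eq (X Y : Flag W) (n : Vec d) : X.key n = |lor (Y.or n) X.pt| := by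
  rw [key, lor_or, abs_mul]
  rcases Int.units_eq_one_or (Y.side n) with h | h <;> simp [h]

lemma inside_or_inside_of_sep {X Y : Flag W} {n n' : Vec d} (hn : n ∈ X.Sep Y)
    (hn' : n' ∈ X.Sep Y) (hne : n ≠ n') :
    Inside (Y.or n) (Y.or n') ∨ Inside (Y.or n') (Y.or n) :=
  inside_or_inside (Y.or_unit hn.1) (Y.or_unit hn'.1)
    (by rw [abs_lor_or_or]; exact W.sep n hn.1 n' hn'.1 hne) X.mem Y.mem (lor_or_nonpos hn)
    (lor_or_nonpos hn') (Y.lor_or_nonneg hn.1) (Y.lor_or_nonneg hn'.1)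

lemma key_lt_of_inside {X Y : Flag W} {n n' : Vec d} (hn : n ∈ X.Sep Y)
    (hn' : n' ∈ X.Sep Y) (h : Inside (Y.or n) (Y.or n')) : X.key n < X.key n' := by
  rw [X.key_eq Y, X.key_eq Y, abs_of_nonpos (lor_or_nonpos hn), abs_of_nonpos (lor_or_nonpos hn')]
  have h1 := h.lor_lt X.mem
  have h2 := lor_or_nonpos hn
  have := h.1
  nlinarith

lemma key_lt_of_inside' {X Y : Flag W} {n n' : Vec d} (hn : n ∈ X.Sep Y)
    (hn' : n' ∈ X.Sep Y) (h : Inside (Y.or n) (Y.or n')) : Y.key n' < Y.key n := by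
  have h' := h.neg (Y.or_unit hn.1) (Y.or_unit hn'.1)
  rw [← or_neg_of_ne hn.2, ← or_neg_of_ne hn'.2] at h'
  exact key_lt_of_inside (sep_comm X Y ▸ hn') (sep_comm X Y ▸ hn) h'

lemma inside_iff_key_lt {X Y : Flag W} {n n' : Vec d} (hn : n ∈ X.Sep Y)
    (hn' : n' ∈ X.Sep Y) : Inside (Y.or n) (Y.or n') ↔ X.key n < X.key n' := by
  refine ⟨key_lt_of_inside hn hn', fun h => ?_⟩
  have hne : n ≠ n' := by rintro rfl; exact lt_irrefl _ h
  exact (inside_or_inside_of_sep hn hn' hne).resolve_right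
    fun h' => lt_asymm h (key_lt_of_inside hn' hn h')

lemma key_lt_iff {X Y : Flag W} {n n' : Vec d} (hn : n ∈ X.Sep Y)
    (hn' : n' ∈ X.Sep Y) : X.key n < X.key n' ↔ Y.key n' < Y.key n := by
  rw [← inside_iff_key_lt hn hn']
  refine ⟨key_lt_of_inside' hn hn', fun h => ?_⟩
  have hne : n ≠ n' := by rintro rfl; exact lt_irrefl _ h
  exact (inside_or_inside_of_sep hn hn' hne).resolve_right
    fun h' => lt_asymm h (key_lt_of_inside' hn' hn h')

lemma key_ne {X Y : Flag W} {n n' : Vec d} (hn : n ∈ X.Sep Y)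
    (hn' : n' ∈ X.Sep Y) (hne : n ≠ n') : X.key n ≠ X.key n' := by
  rcases inside_or_inside_of_sep hn hn' hne with h | h
  · exact (key_lt_of_inside hn hn' h).ne
  · exact (key_lt_of_inside hn' hn h).ne'

/-- `l` lists the elements of `A` by increasing distance to `X`. -/
def Sorted (X : Flag W) (A : Set (Vec d)) (l : List (Vec d)) : Prop :=
  l.Pairwise (fun n n' => X.key n < X.key n') ∧ ∀ n, n ∈ l ↔ n ∈ A

lemma Sorted.unique {X : Flag W} {A : Set (Vec d)} {l l' : List (Vec d)} (h : X.Sorted A l)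
    (h' : X.Sorted A l') : l = l' := by
  have nd : ∀ {l : List (Vec d)}, l.Pairwise (fun n n' => X.key n < X.key n') → l.Nodup :=
    fun hl => hl.imp fun {a b} hab => by rintro rfl; exact lt_irrefl _ hab
  refine List.Perm.eq_of_pairwise (fun a b _ _ h1 h2 => absurd h1 (lt_asymm h2)) h.1 h'.1 ?_
  exact (List.perm_ext_iff_of_nodup (nd h.1) (nd h'.1)).mpr fun a => (h.2 a).trans (h'.2 a).symm

lemma exists_sorted (X Y : Flag W) {A : Set (Vec d)} (hA : A ⊆ X.Sep Y) :
    ∃ l, X.Sorted A l := by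
  classical
  have hf : A.Finite := (finite_sep X Y).subset hA
  let r : Vec d → Vec d → Prop := fun n n' => X.key n ≤ X.key n'
  have : Std.Total r := ⟨fun a b => le_total _ _⟩
  have : IsTrans (Vec d) r := ⟨fun a b c => le_trans⟩
  let l := hf.toFinset.toList.insertionSort r
  have hmem : ∀ n, n ∈ l ↔ n ∈ A := by simp [l]
  have hnd : l.Nodup := (List.perm_insertionSort r _).nodup_iff.mpr (Finset.nodup_toList _)
  refine ⟨l, ?_, hmem⟩
  have := (List.pairwise_insertionSort r hf.toFinset.toList).and hnd
  refine this.imp_of_mem fun {a b} ha hb hab => ?_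
  exact lt_of_le_of_ne hab.1 (key_ne (hA ((hmem a).1 ha)) (hA ((hmem b).1 hb)) hab.2)

/-- The holonomy between two flags. -/
noncomputable def B (X Y : Flag W) : Vec d ≃ₗ[ℝ] Vec d :=
  ((exists_sorted X Y subset_rfl).choose.map fun n => bends (Y.side n) n).prod

lemma B_eq {X Y : Flag W} {l : List (Vec d)} (h : X.Sorted (X.Sep Y) l) :
    B X Y = (l.map fun n => bends (Y.side n) n).prod := by
  rw [B, (exists_sorted X Y subset_rfl).choose_spec.unique h]

lemma B_eq_one {X Y : Flag W} (h : X.Sep Y = ∅) : B X Y = 1 := by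
  rw [B_eq (l := []) ⟨by simp, by simp [h]⟩]; simp

@[simp] lemma B_self (X : Flag W) : B X X = 1 := B_eq_one (sep_self X)

/-- The walls separating `X` from both `Y` and `Z`. -/
def Cut (X Y Z : Flag W) : Set (Vec d) := X.Sep Y ∩ X.Sep Z

lemma cut_comm (X Y Z : Flag W) : X.Cut Y Z = X.Cut Z Y := Set.inter_comm _ _

lemma sep_eq_cut_union (X Y Z : Flag W) : X.Sep Y = X.Cut Y Z ∪ Y.Cut X Z := by
  ext n
  simp only [Cut, Sep, Set.mem_union, Set.mem_inter_iff, Set.mem_ofPred_eq]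
  rcases Int.units_eq_one_or (X.side n) with h | h <;>
    rcases Int.units_eq_one_or (Y.side n) with h' | h' <;>
    rcases Int.units_eq_one_or (Z.side n) with h'' | h'' <;> simp [h, h', h'']

lemma key_lt_of_cut {X Y Z : Flag W} {n n' : Vec d} (hn : n ∈ X.Cut Y Z)
    (hn' : n' ∈ Y.Cut X Z) : X.key n < X.key n' := by
  have h1 : n ∈ X.Sep Y := hn.1
  have h2 : n' ∈ X.Sep Y := sep_comm X Y ▸ hn'.1
  have h3 : n' ∈ Z.Sep Y := sep_comm Y Z ▸ hn'.2
  have hYZ : Y.side n = Z.side n := by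
    have a := eq_neg_of_ne h1.2
    have b := eq_neg_of_ne hn.2.2
    exact neg_injective (a.symm.trans b)
  have h4 : 0 ≤ lor (Y.or n) Z.pt := by
    have := Z.lor_or_nonneg h1.1
    rwa [lor_or, ← hYZ, ← lor_or] at this
  have hne : n ≠ n' := by
    rintro rfl
    exact h3.2 hYZ.symm
  refine key_lt_of_inside h1 h2 ((inside_or_inside_of_sep h1 h2 hne).resolve_right fun h => ?_)
  have h5 := h.lor_lt Z.mem
  have h6 := lor_or_nonpos h3
  have := h.1
  nlinarith

lemma B_eq_mul_inv {X Y Z : Flag W} {l l' : List (Vec d)} (h : X.Sorted (X.Cut Y Z) l)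
    (h' : Y.Sorted (Y.Cut X Z) l') :
    B X Y = (l.map fun n => bends (-X.side n) n).prod *
      ((l'.map fun n => bends (-Y.side n) n).prod)⁻¹ := by
  have hs : X.Sorted (X.Sep Y) (l ++ l'.reverse) := by
    refine ⟨List.pairwise_append.mpr ⟨h.1, ?_, ?_⟩, ?_⟩
    · rw [List.pairwise_reverse]
      refine h'.1.imp_of_mem fun {a b} ha hb hab => ?_
      exact (key_lt_iff ((h'.2 a).1 ha).1 ((h'.2 b).1 hb).1).1 hab
    · intro a ha b hb
      exact key_lt_of_cut ((h.2 a).1 ha) ((h'.2 b).1 (List.mem_reverse.1 hb))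
    · intro n
      rw [sep_eq_cut_union X Y Z, List.mem_append, List.mem_reverse, h.2, h'.2]; rfl
  rw [B_eq hs, List.map_append, List.prod_append, List.prod_inv_reverse, List.map_map,
    List.map_reverse]
  congr 2
  · refine List.map_congr_left fun n hn => ?_
    rw [eq_neg_of_ne ((h.2 n).1 hn).1.2, neg_neg]
  · congr 1
    refine List.map_congr_left fun n hn => ?_
    simp

lemma B_mul_B (X Y Z : Flag W) : B X Y * B Y Z = B X Z := by
  obtain ⟨l, hl⟩ := exists_sorted X Y (A := X.Cut Y Z) Set.inter_subset_left
  obtain ⟨l', hl'⟩ := exists_sorted Y X (A := Y.Cut X Z) Set.inter_subset_left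
  obtain ⟨l'', hl''⟩ := exists_sorted Z X (A := Z.Cut X Y) Set.inter_subset_left
  have h1 := B_eq_mul_inv hl hl'
  have h2 := B_eq_mul_inv (cut_comm Y X Z ▸ hl') (cut_comm Z X Y ▸ hl'')
  have h3 := B_eq_mul_inv (cut_comm X Y Z ▸ hl) hl''
  rw [h1, h2, h3]; group

lemma B_apply_B_apply (X Y Z : Flag W) (z : Vec d) : B X Y (B Y Z z) = B X Z z := by
  rw [← B_mul_B X Y Z, LinearEquiv.mul_apply]

lemma B_apply_eq_self {X Y : Flag W} {z : Vec d} (h : ∀ n ∈ X.Sep Y, lor n z = 0) :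
    B X Y z = z := by
  obtain ⟨l, hl⟩ := exists_sorted X Y subset_rfl
  rw [B_eq hl]
  have : ∀ n ∈ l, n ∈ X.Sep Y := fun n => (hl.2 n).1
  clear hl
  induction l with
  | nil => simp
  | cons n t ih =>
    rw [List.map_cons, List.prod_cons, LinearEquiv.mul_apply,
      ih fun n hn => this n (List.mem_cons_of_mem _ hn)]
    exact bends_apply_eq_self (W.unit n (this n (by simp)).1) _ (h n (this n (by simp)))

lemma lor_eq_zero_of_sep {X Y : Flag W} (h : X.pt = Y.pt) {n : Vec d} (hn : n ∈ X.Sep Y) :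
    lor n X.pt = 0 := by
  have h1 := lor_or_nonpos hn
  have h2 := Y.lor_or_nonneg hn.1
  rw [← h] at h2
  have h3 := le_antisymm h1 h2
  rw [lor_or] at h3
  refine (mul_eq_zero.mp h3).resolve_left fun h => ?_
  have hs := sg_mul_self (Y.side n)
  rw [h] at hs; simp at hs

lemma B_apply_pt_congr (X : Flag W) {Y Y' : Flag W} (h : Y.pt = Y'.pt) :
    B X Y Y.pt = B X Y' Y'.pt := by
  rw [← B_apply_B_apply X Y Y', ← h, B_apply_eq_self (X := Y) (Y := Y')]
  exact fun n hn => lor_eq_zero_of_sep h hn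

end Flag

end BentDomain

namespace BentDomain
variable {d : ℕ} {W : WallSystem d}

/-- The set of vectors projecting to `fut` and lying on the positive side of `m`. -/
def HalfCyl (m : Vec d) : Set (Vec d) := {z | proj m z ∈ fut d ∧ 0 ≤ lor m z}

lemma fut_halfCyl {m z : Vec d} (hm : lor m m = 1) (hz : z ∈ fut d) (h : 0 ≤ lor m z) :
    z ∈ HalfCyl m := ⟨proj_mem_fut hm hz, h⟩

lemma Inside.halfCyl {m m' z : Vec d} (hm : lor m m = 1) (hm' : lor m' m' = 1)
    (h : Inside m m') (hz : z ∈ HalfCyl m') : z ∈ HalfCyl m ∧ 0 < lor m z := by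
  obtain ⟨hp, hc⟩ := hz
  set p := proj m' z with hpdef
  set c := lor m' z
  have ez : z = p + c • m' := by rw [hpdef, proj_apply]; module
  have h0 : lor m' p = 0 := lor_proj hm' z
  have h1 := h.lor_lt hp
  have ha := h.1
  have h2 : 0 < lor m p := by
    rw [h0] at h1
    exact pos_of_mul_pos_right h1 (by linarith)
  have h3 : lor m z = lor m p + c * lor m m' := by rw [ez]; simp
  have h4 : 0 < lor m z := by rw [h3]; nlinarith
  refine ⟨⟨?_, h4.le⟩, h4⟩
  have e : proj m z = proj m p + c • (m' - lor m m' • m) := by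
    rw [ez, map_add, map_smul, proj_apply m m']
  rw [e]
  rcases hc.eq_or_lt with h5 | h5
  · rw [← h5]; simpa using proj_mem_fut hm hp
  · exact add_mem_fut (proj_mem_fut hm hp) (smul_mem_fut h.2 h5)

lemma proj_smul_sg (s : ℤˣ) (n z : Vec d) : proj (sg s • n) z = proj n z := by
  rcases Int.units_eq_one_or s with rfl | rfl <;> simp [proj_apply]

lemma bends_halfCyl {n z : Vec d} (hn : lor n n = 1) (s t : ℤˣ) (hz : z ∈ HalfCyl (sg s • n)) :
    bends t n z ∈ HalfCyl (sg s • n) := by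
  obtain ⟨c, hc, h⟩ := exists_lor_bends hn t
  obtain ⟨h1, h2⟩ := hz
  rw [proj_smul_sg] at h1
  refine ⟨by rwa [proj_smul_sg, proj_bends hn], ?_⟩
  rw [lor_smul_left] at *
  rw [h, mul_left_comm]
  exact mul_nonneg hc.le h2

namespace Flag

lemma B_mem_halfCyl_aux {Y : Flag W} {y : Vec d} (hy : y ∈ fut d) (n : Vec d)
    (t : List (Vec d)) (hl : (n :: t).Pairwise (fun n n' => Inside (Y.or n) (Y.or n')))
    (hS : ∀ n' ∈ n :: t, n' ∈ W.S) (hyn : ∀ n' ∈ n :: t, 0 ≤ lor (Y.or n') y) :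
    ((n :: t).map fun n => bends (Y.side n) n).prod y ∈ HalfCyl (Y.or n) := by
  induction t generalizing n with
  | nil =>
    simp only [List.map_cons, List.map_nil, List.prod_cons, List.prod_nil, mul_one]
    exact bends_halfCyl (W.unit n (hS n (by simp))) _ _
      (fut_halfCyl (Y.or_unit (hS n (by simp))) hy (hyn n (by simp)))
  | cons n' t ih =>
    rw [List.map_cons, List.prod_cons, LinearEquiv.mul_apply]
    refine bends_halfCyl (W.unit n (hS n (by simp))) _ _ ?_
    rw [List.pairwise_cons] at hl
    exact ((hl.1 n' (by simp)).halfCyl (Y.or_unit (hS n (by simp)))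
      (Y.or_unit (hS n' (by simp))) (ih n' hl.2 (fun a ha => hS a (List.mem_cons_of_mem _ ha))
        (fun a ha => hyn a (List.mem_cons_of_mem _ ha)))).1

lemma Sorted.inside {X Y : Flag W} {l : List (Vec d)} (h : X.Sorted (X.Sep Y) l) :
    l.Pairwise (fun n n' => Inside (Y.or n) (Y.or n')) :=
  h.1.imp_of_mem fun {a b} ha hb hab => (inside_iff_key_lt ((h.2 a).1 ha) ((h.2 b).1 hb)).2 hab

lemma B_mem_halfCyl {X Y : Flag W} {n : Vec d} {t : List (Vec d)}
    (h : X.Sorted (X.Sep Y) (n :: t)) : B X Y Y.pt ∈ HalfCyl (Y.or n) := by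
  rw [B_eq h]
  have hS : ∀ n' ∈ n :: t, n' ∈ W.S := fun a ha => ((h.2 a).1 ha).1
  exact B_mem_halfCyl_aux Y.mem n t h.inside hS fun a ha => Y.lor_or_nonneg (hS a ha)

/-- A point of the first separating wall lies in the closed chamber of `X`. -/
lemma side_le_of_first {X Y : Flag W} {n : Vec d} {t : List (Vec d)}
    (h : X.Sorted (X.Sep Y) (n :: t)) {w : Vec d} (hw : w ∈ fut d) (h0 : lor n w = 0) :
    ∀ n' ∈ W.S, 0 ≤ sg (X.side n') * lor n' w := by
  intro n' hn'
  by_contra! hc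
  have hn : n ∈ X.Sep Y := (h.2 n).1 (by simp)
  have hne : n ≠ n' := by rintro rfl; simp [h0] at hc
  have hmw : lor (Y.or n) w = 0 := by simp [lor_or, h0]
  have hm'w : 0 < lor (-X.or n') w := by rw [lor_neg_left, lor_or]; linarith
  have hx' : lor (-X.or n') X.pt ≤ 0 := by
    rw [lor_neg_left]; linarith [X.lor_or_nonneg hn']
  have hu : lor (-X.or n') (-X.or n') = 1 := by simpa using X.or_unit hn'
  rcases inside_or_inside (Y.or_unit hn.1) hu
    (by rw [lor_neg_right, abs_neg, abs_lor_or_or]; exact W.sep n hn.1 n' hn' hne) X.mem hw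
    (lor_or_nonpos hn) hx' hmw.ge hm'w.le with hi | hi
  · have := hi.lor_lt hw
    rw [hmw] at this; linarith
  · have h1 := hi.lor_lt Y.mem
    have h2 := Y.lor_or_nonneg hn.1
    have h3 : 0 < lor (-X.or n') Y.pt := by
      by_contra! hcc
      have := hi.1
      nlinarith
    have hsep : n' ∈ X.Sep Y := by
      refine ⟨hn', fun he => ?_⟩
      have := Y.lor_or_nonneg hn'
      rw [lor_or, ← he, ← lor_or] at this
      rw [lor_neg_left] at h3
      linarith
    have he : -X.or n' = Y.or n' := by rw [or_neg_of_ne hsep.2, neg_neg]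
    rw [he] at hi
    have h4 := key_lt_of_inside hsep hn hi
    have h5 : n' ∈ t := by
      have := (h.2 n').2 hsep
      rcases List.mem_cons.1 this with h6 | h6
      · exact absurd h6.symm hne
      · exact h6
    have := (List.pairwise_cons.1 h.1).1 n' h5
    exact lt_asymm h4 this

/-- The flag with the same sides as `X` at a point `w` of the closed chamber. -/
def move (X : Flag W) (w : Vec d) (hw : w ∈ fut d)
    (h : ∀ n' ∈ W.S, 0 ≤ sg (X.side n') * lor n' w) : Flag W := ⟨w, X.side, hw, h⟩

open Classical in
/-- The flag at `w` with sides those of `X` except at `n`. -/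
noncomputable def flip (X : Flag W) (n w : Vec d) (hw : w ∈ fut d) (h0 : lor n w = 0)
    (h : ∀ n' ∈ W.S, 0 ≤ sg (X.side n') * lor n' w) : Flag W where
  pt := w
  side := Function.update X.side n (-X.side n)
  mem := hw
  le n' hn' := by
    by_cases he : n' = n
    · subst he; simp [h0]
    · simpa [he] using h n' hn'

section
variable {X : Flag W} {n w : Vec d} {hw : w ∈ fut d} {h0 : lor n w = 0}
  {h : ∀ n' ∈ W.S, 0 ≤ sg (X.side n') * lor n' w}

@[simp] lemma flip_pt : (X.flip n w hw h0 h).pt = w := rfl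

@[simp] lemma sep_move : X.Sep (X.move w hw h) = ∅ := by ext; simp [Sep, move]

lemma sep_flip (hn : n ∈ W.S) : X.Sep (X.flip n w hw h0 h) = {n} := by
  ext n'
  by_cases he : n' = n
  · subst he
    simp [Sep, flip, hn]
  · simp [Sep, flip, he]

lemma sep_flip_right {Y : Flag W} (hn : n ∈ X.Sep Y) :
    (X.flip n w hw h0 h).Sep Y = X.Sep Y \ {n} := by
  ext n'
  by_cases he : n' = n
  · subst he
    have := eq_neg_of_ne hn.2
    simp [Sep, flip, this]
  · simp [Sep, flip, he]

lemma B_flip (hn : n ∈ W.S) :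
    B X (X.flip n w hw h0 h) = bends (-X.side n) n := by
  rw [B_eq (l := [n]) ⟨by simp, by simp [sep_flip hn]⟩]
  simp [flip]

end

/-- The developed domain, seen from the flag `X`. -/
def U (X : Flag W) : Set (Vec d) := {z | ∃ Z : Flag W, z = B X Z Z.pt}

lemma B_mem_U (X Z : Flag W) : B X Z Z.pt ∈ X.U := ⟨Z, rfl⟩

lemma pt_mem_U (X : Flag W) : X.pt ∈ X.U := by simpa using B_mem_U X X

lemma B_apply_mem_U {X Y : Flag W} {z : Vec d} (h : z ∈ Y.U) : B X Y z ∈ X.U := by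
  obtain ⟨Z, rfl⟩ := h
  exact ⟨Z, B_apply_B_apply _ _ _ _⟩

lemma image_U (X Y : Flag W) : B X Y '' Y.U = X.U := by
  ext z
  constructor
  · rintro ⟨y, hy, rfl⟩; exact B_apply_mem_U hy
  · intro hz
    exact ⟨B Y X z, B_apply_mem_U hz, by rw [B_apply_B_apply, B_self]; rfl⟩

lemma U_eq_of_B_eq_one {X Y : Flag W} (h : B X Y = 1) : X.U = Y.U := by
  rw [← image_U X Y, h]; exact Set.image_id _

lemma U_eq_of_sep {X Y : Flag W} (h : X.Sep Y = ∅) : X.U = Y.U :=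
  U_eq_of_B_eq_one (B_eq_one h)

lemma segment_subset_of_sep {X Y : Flag W} (h : X.Sep Y = ∅) :
    segment ℝ X.pt Y.pt ⊆ X.U := by
  rintro _ ⟨a, b, ha, hb, hab, rfl⟩
  have hs : ∀ n' ∈ W.S, 0 ≤ sg (X.side n') * lor n' (a • X.pt + b • Y.pt) := by
    intro n hn
    have h1 := X.le n hn
    have h2 := Y.le n hn
    have h3 : X.side n = Y.side n := by
      by_contra hne
      have : n ∈ X.Sep Y := ⟨hn, hne⟩
      rw [h] at this; exact this
    rw [← h3] at h2
    simp only [lor_add_right, lor_smul_right]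
    nlinarith [mul_nonneg ha h1, mul_nonneg hb h2]
  have := pt_mem_U (X.move _ (convex_fut X.mem Y.mem ha hb hab) hs)
  rw [← U_eq_of_sep (X := X) sep_move] at this
  exact this

lemma exists_wall_crossing {m x q : Vec d} (hx : proj m x ∈ fut d) (hq : proj m q ∈ fut d)
    (h1 : lor m x ≤ 0) (h2 : 0 ≤ lor m q) :
    ∃ w ∈ segment ℝ x q, w ∈ fut d ∧ lor m w = 0 := by
  have h3 : (0 : ℝ) ∈ (fun t : ℝ => lor m ((1 - t) • x + t • q)) '' Set.Icc 0 1 := by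
    apply intermediate_value_Icc zero_le_one
    · apply Continuous.continuousOn
      fun_prop
    · simpa using ⟨h1, h2⟩
  obtain ⟨t, ht, h0⟩ := h3
  have h0 : lor m ((1 - t) • x + t • q) = 0 := h0
  refine ⟨_, ⟨1 - t, t, by linarith [ht.2], ht.1, by ring, rfl⟩, ?_, h0⟩
  rw [← proj_eq_self h0, map_add, map_smul, map_smul]
  exact convex_fut hx hq (by linarith [ht.2]) ht.1 (by ring)

lemma lor_eq_zero_of_or {X : Flag W} {n w : Vec d} (h : lor (X.or n) w = 0) : lor n w = 0 := by
  rw [lor_or] at h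
  refine (mul_eq_zero.mp h).resolve_left fun h => ?_
  have hs := sg_mul_self (X.side n)
  rw [h] at hs; simp at hs

/-- Induction on the number of walls separating two flags. -/
lemma sep_induction {P : Flag W → Flag W → Prop} (h0 : ∀ X Y, X.Sep Y = ∅ → P X Y)
    (hs : ∀ (X Y : Flag W) (n : Vec d) (t : List (Vec d)), X.Sorted (X.Sep Y) (n :: t) →
      (∀ X' : Flag W, X'.Sep Y = X.Sep Y \ {n} → P X' Y) → P X Y) (X Y : Flag W) : P X Y := by
  induction hk : (X.Sep Y).ncard using Nat.strong_induction_on generalizing X with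
  | _ k ih =>
    obtain ⟨l, hl⟩ := exists_sorted X Y subset_rfl
    cases l with
    | nil =>
      refine h0 X Y (Set.eq_empty_of_forall_notMem fun n hn => ?_)
      simpa using (hl.2 n).2 hn
    | cons n t =>
      refine hs X Y n t hl fun X' hX' => ih _ ?_ X' rfl
      rw [hX', ← hk]
      exact Set.ncard_sdiff_singleton_lt_of_mem ((hl.2 n).1 (by simp)) (finite_sep X Y)

lemma segment_split {x q w z : Vec d} (hw : w ∈ segment ℝ x q) (hz : z ∈ segment ℝ x q) :
    z ∈ segment ℝ x w ∨ z ∈ segment ℝ w q := by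
  have hr : w ∈ Set.range (AffineMap.lineMap x q : ℝ → Vec d) := by
    rw [segment_eq_image_lineMap] at hw
    exact Set.image_subset_range _ _ hw
  rw [← insert_endpoints_openSegment] at hz
  rcases hz with rfl | rfl | hz
  · exact Or.inl (left_mem_segment _ _ _)
  · exact Or.inr (right_mem_segment _ _ _)
  · rcases openSegment_subset_union x q hr hz with rfl | h | h
    · exact Or.inl (right_mem_segment _ _ _)
    · exact Or.inl (openSegment_subset_segment _ _ _ h)
    · exact Or.inr (openSegment_subset_segment _ _ _ h)

lemma segment_subset_U (X Y : Flag W) : segment ℝ X.pt (B X Y Y.pt) ⊆ X.U := by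
  induction X, Y using sep_induction with
  | h0 X Y h =>
    rw [B_eq_one h]; exact segment_subset_of_sep h
  | hs X Y n t hl ih =>
    have hn : n ∈ X.Sep Y := (hl.2 n).1 (by simp)
    have hq := B_mem_halfCyl hl
    obtain ⟨w, hw, hwf, hw0⟩ := exists_wall_crossing (proj_mem_fut (Y.or_unit hn.1) X.mem) hq.1
      (lor_or_nonpos hn) hq.2
    have hw0 := lor_eq_zero_of_or hw0
    have hs := side_le_of_first hl hwf hw0
    let W₁ := X.move w hwf hs
    let W₂ := X.flip n w hwf hw0 hs
    have h1 : segment ℝ X.pt w ⊆ X.U := segment_subset_of_sep (Y := W₁) sep_move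
    have h2 : segment ℝ w (B X Y Y.pt) ⊆ X.U := by
      have h3 := ih W₂ (sep_flip_right hn)
      have h4 : B X W₂ w = w := by
        rw [B_flip hn.1]; exact bends_apply_eq_self (W.unit n hn.1) _ hw0
      rw [← B_apply_B_apply X W₂ Y]
      nth_rw 1 [← h4]
      have := image_segment ℝ (B X W₂ : Vec d →ₗ[ℝ] Vec d).toAffineMap w (B W₂ Y Y.pt)
      simp only [LinearMap.coe_toAffineMap, LinearEquiv.coe_coe] at this
      rw [← this, ← image_U X W₂]
      exact Set.image_mono h3
    intro z hz
    rcases segment_split hw hz with h | h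
    · exact h1 h
    · exact h2 h

lemma convex_U (X : Flag W) : Convex ℝ X.U := by
  rw [convex_iff_segment_subset]
  rintro _ ⟨Z, rfl⟩ _ ⟨Z', rfl⟩
  rw [← B_apply_B_apply X Z Z']
  have := image_segment ℝ (B X Z : Vec d →ₗ[ℝ] Vec d).toAffineMap Z.pt (B Z Z' Z'.pt)
  simp only [LinearMap.coe_toAffineMap, LinearEquiv.coe_coe] at this
  rw [← this, ← image_U X Z]
  exact Set.image_mono (segment_subset_U Z Z')

lemma pt_eq_of_B_apply_eq (X Y : Flag W) (h : B X Y Y.pt = X.pt) : Y.pt = X.pt := by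
  induction X, Y using sep_induction with
  | h0 X Y h' => rwa [B_eq_one h'] at h
  | hs X Y n t hl ih =>
    have hn : n ∈ X.Sep Y := (hl.2 n).1 (by simp)
    have hq := B_mem_halfCyl hl
    rw [h] at hq
    have h0 := lor_eq_zero_of_or (le_antisymm (lor_or_nonpos hn) hq.2)
    have hX : X.pt ∈ fut d := X.mem
    refine ih (X.flip n X.pt X.mem h0 X.le) (sep_flip_right hn) ?_
    apply (B X (X.flip n X.pt X.mem h0 X.le)).injective
    rw [B_apply_B_apply, h, flip_pt, B_flip hn.1]
    exact (bends_apply_eq_self (W.unit n hn.1) _ h0).symm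

end Flag
end BentDomain

namespace BentDomain
open Filter Topology
variable {d : ℕ} {W : WallSystem d}

namespace Flag

open Classical in
/-- A flag at a given point. -/
noncomputable def std (W : WallSystem d) (x : Vec d) (hx : x ∈ fut d) : Flag W where
  pt := x
  side n := if 0 ≤ lor n x then 1 else -1
  mem := hx
  le n _ := by
    split_ifs with h
    · simpa using h
    · simp; linarith

open Classical in
/-- The developing map, based at the flag `X`. -/
noncomputable def F (X : Flag W) (y : Vec d) : Vec d :=
  if h : y ∈ fut d then B X (std W y h) y else 0

lemma F_pt (X Y : Flag W) : F X Y.pt = B X Y Y.pt := by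
  rw [F, dif_pos Y.mem]
  exact B_apply_pt_congr X (Y := std W Y.pt Y.mem) (Y' := Y) rfl

lemma F_eq_B_F (X Y : Flag W) {y : Vec d} (hy : y ∈ fut d) : F X y = B X Y (F Y y) := by
  rw [F, F, dif_pos hy, dif_pos hy, B_apply_B_apply]

lemma image_F (X : Flag W) : F X '' fut d = X.U := by
  ext z
  constructor
  · rintro ⟨y, hy, rfl⟩
    exact ⟨std W y hy, F_pt X (std W y hy)⟩
  · rintro ⟨Z, rfl⟩
    exact ⟨Z.pt, Z.mem, F_pt X Z⟩

lemma F_mem_U (X : Flag W) {y : Vec d} (hy : y ∈ fut d) : F X y ∈ X.U :=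
  image_F X ▸ Set.mem_image_of_mem _ hy

lemma injOn_F (X : Flag W) : Set.InjOn (F X) (fut d) := by
  intro y hy y' hy' h
  have h1 : B X (std W y hy) y = B X (std W y' hy') y' := by
    simpa only [F, dif_pos hy, dif_pos hy'] using h
  symm
  apply pt_eq_of_B_apply_eq (std W y hy) (std W y' hy')
  apply (B X (std W y hy)).injective
  rw [B_apply_B_apply]; exact h1.symm

lemma F_smul (X : Flag W) {y : Vec d} (hy : y ∈ fut d) {r : ℝ} (hr : 0 < r) :
    F X (r • y) = r • F X y := by
  have h : (std W y hy).Sep (std W (r • y) (smul_mem_fut hy hr)) = ∅ := by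
    ext n
    simp [Sep, std, hr]
  rw [F, F, dif_pos hy, dif_pos (smul_mem_fut hy hr), ← B_mul_B X (std W y hy), B_eq_one h]
  simp

lemma smul_mem_U (X : Flag W) {z : Vec d} (hz : z ∈ X.U) {r : ℝ} (hr : 0 < r) :
    r • z ∈ X.U := by
  rw [← image_F] at *
  obtain ⟨y, hy, rfl⟩ := hz
  exact ⟨r • y, smul_mem_fut hy hr, F_smul X hy hr⟩

lemma add_mem_U (X : Flag W) {y z : Vec d} (hy : y ∈ X.U) (hz : z ∈ X.U) : y + z ∈ X.U := by
  have := X.convex_U hy hz (a := 1 / 2) (b := 1 / 2) (by norm_num) (by norm_num) (by norm_num)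
  have := X.smul_mem_U this (r := 2) (by norm_num)
  rwa [smul_add, smul_smul, smul_smul, show (2 : ℝ) * (1 / 2) = 1 by norm_num, one_smul,
    one_smul] at this

end Flag

lemma WallSystem.eventually_sign (W : WallSystem d) {x : Vec d} (hx : x ∈ fut d) :
    ∀ᶠ y in 𝓝 x, y ∈ fut d ∧ ∀ n ∈ W.S, lor n x ≠ 0 → 0 < lor n x * lor n y := by
  obtain ⟨ε, hε, hsub⟩ := Metric.nhds_basis_closedBall.mem_iff.1 (isOpen_fut.mem_nhds hx)
  have hfin := W.fin _ hsub (isCompact_closedBall x ε)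
  have h1 : ∀ᶠ y in 𝓝 x, ∀ n ∈ {n ∈ W.S | ∃ y ∈ Metric.closedBall x ε, lor n y = 0},
      lor n x ≠ 0 → 0 < lor n x * lor n y := by
    rw [Filter.eventually_all_finite hfin]
    intro n _
    by_cases h0 : lor n x = 0
    · simp [h0]
    · have : Continuous fun y : Vec d => lor n x * lor n y := by fun_prop
      filter_upwards [this.continuousAt.eventually (lt_mem_nhds (mul_self_pos.2 h0))] with y hy _
      exact hy
  filter_upwards [h1, Metric.closedBall_mem_nhds x hε] with y hy1 hy2
  refine ⟨hsub hy2, fun n hn h0 => ?_⟩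
  by_cases hT : n ∈ {n ∈ W.S | ∃ y ∈ Metric.closedBall x ε, lor n y = 0}
  · exact hy1 n hT h0
  · by_contra! hc
    apply hT
    refine ⟨hn, ?_⟩
    have hpre := (convex_closedBall x ε).isPreconnected
    have hc2 : Continuous fun y : Vec d => lor n x * lor n y := by fun_prop
    have := hpre.intermediate_value hy2 (Metric.mem_closedBall_self hε.le)
      hc2.continuousOn
    obtain ⟨z, hz, hz0⟩ := this (Set.mem_Icc.2 ⟨hc, (mul_self_pos.2 h0).le⟩)
    exact ⟨z, hz, (mul_eq_zero.1 hz0).resolve_left h0⟩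

lemma WallSystem.unique_wall (W : WallSystem d) {x : Vec d} (hx : x ∈ fut d) {n n' : Vec d}
    (hn : n ∈ W.S) (hn' : n' ∈ W.S) (h : lor n x = 0) (h' : lor n' x = 0) : n = n' := by
  by_contra hne
  rcases inside_or_inside (W.unit n hn) (W.unit n' hn') (W.sep n hn n' hn' hne) hx hx h.le h'.le
    h.ge h'.ge with hi | hi
  · have := hi.lor_lt hx; rw [h, h'] at this; simp at this
  · have := hi.lor_lt hx; rw [h, h'] at this; simp at this

open Classical in
/-- The piecewise linear map bending one side of a wall. -/
noncomputable def foldMap (n : Vec d) (s t : ℤˣ) (y : Vec d) : Vec d :=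
  if 0 ≤ sg s * lor n y then y else bends t n y

lemma continuous_foldMap {n : Vec d} (hn : lor n n = 1) (s t : ℤˣ) :
    Continuous (foldMap n s t) := by
  have hc : Continuous (bends t n) := (bends t n).toLinearMap.continuous_of_finiteDimensional
  refine Continuous.if_le continuous_id hc continuous_const (by fun_prop) fun y hy => ?_
  refine (bends_apply_eq_self hn t ?_).symm
  rcases Int.units_eq_one_or s with rfl | rfl <;> simpa using hy.symm

lemma foldMap_foldMap {n : Vec d} (hn : lor n n = 1) (s t : ℤˣ) (y : Vec d) :
    foldMap n s (-t) (foldMap n s t y) = y := by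
  by_cases h : 0 ≤ sg s * lor n y
  · simp [foldMap, h]
  · obtain ⟨c, hc, hb⟩ := exists_lor_bends hn t
    have h2 : ¬ 0 ≤ sg s * lor n (bends t n y) := by
      rw [hb, mul_left_comm]
      push Not at h ⊢
      exact mul_neg_of_pos_of_neg hc h
    rw [foldMap, foldMap, if_neg h, if_neg h2, bends_neg, ← LinearEquiv.mul_apply, inv_mul_cancel]
    rfl

/-- `foldMap` as a homeomorphism. -/
noncomputable def foldHomeo (n : Vec d) (hn : lor n n = 1) (s t : ℤˣ) : Vec d ≃ₜ Vec d where
  toFun := foldMap n s t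
  invFun := foldMap n s (-t)
  left_inv y := foldMap_foldMap hn s t y
  right_inv y := by simpa using foldMap_foldMap hn s (-t) y
  continuous_toFun := continuous_foldMap hn s t
  continuous_invFun := continuous_foldMap hn s (-t)

namespace Flag

open Classical in
lemma exists_homeo_F (X : Flag W) : ∃ h : Vec d ≃ₜ Vec d, F X =ᶠ[𝓝 X.pt] h := by
  have ev := W.eventually_sign X.mem
  have key : ∀ y, (∀ n ∈ W.S, lor n X.pt ≠ 0 → 0 < lor n X.pt * lor n y) →
      ∀ n ∈ W.S, lor n X.pt ≠ 0 → 0 ≤ sg (X.side n) * lor n y := by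
    intro y hy n hn h0
    have h1 := X.le n hn
    have h2 := hy n hn h0
    rcases Int.units_eq_one_or (X.side n) with h | h <;> rw [h] at h1 ⊢ <;> simp at h1 ⊢ <;>
      nlinarith
  by_cases hex : ∃ n ∈ W.S, lor n X.pt = 0
  · obtain ⟨n, hn, h0⟩ := hex
    refine ⟨foldHomeo n (W.unit n hn) (X.side n) (-X.side n), ?_⟩
    filter_upwards [ev] with y hy
    have hne : ∀ n' ∈ W.S, n' ≠ n → lor n' X.pt ≠ 0 := fun n' hn' hne h =>
      hne (W.unique_wall X.mem hn' hn h h0)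
    change F X y = foldMap n (X.side n) (-X.side n) y
    by_cases hs : 0 ≤ sg (X.side n) * lor n y
    · rw [foldMap, if_pos hs]
      have hv : ∀ n' ∈ W.S, 0 ≤ sg (X.side n') * lor n' y := fun n' hn' => by
        by_cases he : n' = n
        · subst he; exact hs
        · exact key y hy.2 n' hn' (hne n' hn' he)
      have := F_pt X (X.move y hy.1 hv)
      rw [B_eq_one sep_move] at this
      exact this
    · rw [foldMap, if_neg hs]
      let Y : Flag W := ⟨y, Function.update X.side n (-X.side n), hy.1, fun n' hn' => by
        by_cases he : n' = n
        · subst he; simp; linarith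
        · simpa [he] using key y hy.2 n' hn' (hne n' hn' he)⟩
      have hsep : X.Sep Y = {n} := by
        ext n'
        by_cases he : n' = n
        · subst he
          simp [Sep, Y, hn]
        · simp [Sep, Y, he]
      have := F_pt X Y
      rw [B_eq (l := [n]) ⟨by simp, by simp [hsep]⟩] at this
      simpa [Y] using this
  · push Not at hex
    refine ⟨Homeomorph.refl _, ?_⟩
    filter_upwards [ev] with y hy
    have := F_pt X (X.move y hy.1 fun n hn => key y hy.2 n hn (hex n hn))
    rw [B_eq_one sep_move] at this
    exact this

/-- `B X Y` as a homeomorphism. -/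
noncomputable def BHomeo (X Y : Flag W) : Vec d ≃ₜ Vec d :=
  (B X Y).toContinuousLinearEquiv.toHomeomorph

lemma map_F_nhds (X : Flag W) {x : Vec d} (hx : x ∈ fut d) : map (F X) (𝓝 x) = 𝓝 (F X x) := by
  obtain ⟨h, hh⟩ := exists_homeo_F (std W x hx)
  have h1 : F X =ᶠ[𝓝 x] (h.trans (BHomeo X (std W x hx))) := by
    filter_upwards [hh, isOpen_fut.mem_nhds hx] with y hy hy'
    rw [F_eq_B_F X (std W x hx) hy', hy]; rfl
  rw [map_congr h1, Homeomorph.map_nhds_eq, h1.eq_of_nhds]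

lemma continuousOn_F (X : Flag W) : ContinuousOn (F X) (fut d) := fun _ hx =>
  ContinuousAt.continuousWithinAt (map_F_nhds X hx).le

lemma isOpen_U (X : Flag W) : IsOpen X.U := by
  rw [isOpen_iff_mem_nhds]
  intro z hz
  rw [← image_F] at hz
  obtain ⟨y, hy, rfl⟩ := hz
  rw [← map_F_nhds X hy, ← image_F]
  exact image_mem_map (isOpen_fut.mem_nhds hy)

lemma isOpenEmbedding_F (X : Flag W) : IsOpenEmbedding fun y : fut d => F X y := by
  refine .of_continuous_injective_isOpenMap (continuousOn_iff_continuous_domRestrict.1 X.continuousOn_F)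
    (fun a b h => Subtype.ext (X.injOn_F a.2 b.2 h)) ?_
  rw [isOpenMap_iff_nhds_le]
  intro a
  rw [← map_F_nhds X a.2, ← isOpen_fut.isOpenEmbedding_subtypeVal.map_nhds_eq, Filter.map_map]
  rfl

/-- The preimage of a compact subset of `U` under the developing map. -/
lemma isCompact_preimage_F (X : Flag W) {K : Set (Vec d)} (hK : IsCompact K) (hKU : K ⊆ X.U) :
    IsCompact {y ∈ fut d | F X y ∈ K} := by
  have h1 : IsCompact ((fun y : fut d => F X y) ⁻¹' K) := by
    refine X.isOpenEmbedding_F.isInducing.isCompact_preimage' hK fun z hz => ?_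
    obtain ⟨y, hy, rfl⟩ := (image_F X).symm ▸ hKU hz
    exact ⟨⟨y, hy⟩, rfl⟩
  convert h1.image continuous_subtype_val
  ext y; simp [and_comm]

end Flag

/-- Linear automorphisms of a wall system. -/
structure IsAut (W : WallSystem d) (γ : Vec d ≃ₗ[ℝ] Vec d) : Prop where
  lor : ∀ x y, lor (γ x) (γ y) = lor x y
  fut : ∀ x, γ x ∈ fut d ↔ x ∈ fut d
  wall : ∀ n, γ n ∈ W.S ↔ n ∈ W.S

lemma bends_map {γ : Vec d ≃ₗ[ℝ] Vec d} (hγ : ∀ x y, lor (γ x) (γ y) = lor x y) {n : Vec d}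
    (hn : lor n n = 1) (s : ℤˣ) : bends s (γ n) = γ * bends s n * γ⁻¹ := by
  have h1 : bend (γ n) = γ * bend n * γ⁻¹ := by
    rw [eq_mul_inv_iff_mul_eq]
    refine LinearEquiv.ext fun z => ?_
    simp [LinearEquiv.mul_apply, bend_apply hn, bend_apply ((hγ n n).trans hn), hγ]
  rw [bends, h1, bends, conj_zpow]

namespace Flag

/-- The image of a flag by an automorphism. -/
def map (γ : Vec d ≃ₗ[ℝ] Vec d) (hγ : IsAut W γ) (X : Flag W) : Flag W where
  pt := γ X.pt
  side n := X.side (γ.symm n)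
  mem := (hγ.fut _).2 X.mem
  le n hn := by
    have := X.le (γ.symm n) ((hγ.wall _).1 (by simpa))
    rwa [← hγ.lor, γ.apply_symm_apply] at this

variable {γ : Vec d ≃ₗ[ℝ] Vec d} (hγ : IsAut W γ)
include hγ

lemma B_map (X Y : Flag W) : B (X.map γ hγ) (Y.map γ hγ) = γ * B X Y * γ⁻¹ := by
  obtain ⟨l, hl⟩ := exists_sorted X Y subset_rfl
  have hs : (X.map γ hγ).Sorted ((X.map γ hγ).Sep (Y.map γ hγ)) (l.map γ) := by
    refine ⟨?_, fun n => ?_⟩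
    · rw [List.pairwise_map]
      refine hl.1.imp fun {a b} hab => ?_
      simpa [key, map, hγ.lor] using hab
    · rw [List.mem_map]
      constructor
      · rintro ⟨a, ha, rfl⟩
        have := (hl.2 a).1 ha
        exact ⟨(hγ.wall a).2 this.1, by simpa [map] using this.2⟩
      · rintro ⟨h1, h2⟩
        refine ⟨γ.symm n, (hl.2 _).2 ⟨(hγ.wall _).1 (by simpa), h2⟩, by simp⟩
  rw [B_eq hs, B_eq hl]
  have : ∀ n ∈ l, lor n n = 1 := fun n hn => W.unit n ((hl.2 n).1 hn).1
  clear hl hs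
  induction l with
  | nil => simp
  | cons n t ih =>
    simp only [List.map_cons, List.prod_cons]
    rw [ih fun n hn => this n (List.mem_cons_of_mem _ hn)]
    rw [bends_map hγ.lor (this n (by simp))]
    simp [map]

/-- The holonomy representation, based at `X`. -/
noncomputable def hol (X : Flag W) : Vec d ≃ₗ[ℝ] Vec d := B X (X.map γ hγ) * γ

lemma F_map (X : Flag W) {y : Vec d} (hy : y ∈ fut d) : F X (γ y) = X.hol hγ (F X y) := by
  have h1 := F_pt X ((std W y hy).map γ hγ)
  change F X (γ y) = _ at h1
  rw [h1, F, dif_pos hy, hol, LinearEquiv.mul_apply, ← B_mul_B X (X.map γ hγ), B_map]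
  simp [LinearEquiv.mul_apply, map, std]

omit hγ in
lemma image_hol (X : Flag W) (hγ : IsAut W γ) : X.hol hγ '' X.U = X.U := by
  rw [← image_F X, Set.image_image]
  ext z
  constructor
  · rintro ⟨y, hy, rfl⟩
    exact ⟨γ y, (hγ.fut y).2 hy, F_map hγ X hy⟩
  · rintro ⟨y, hy, rfl⟩
    have hy' : γ.symm y ∈ fut d := (hγ.fut _).1 (by simpa)
    refine ⟨γ.symm y, hy', ?_⟩
    change X.hol hγ (F X (γ.symm y)) = _
    rw [← F_map hγ X hy', γ.apply_symm_apply]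

end Flag
end BentDomain

namespace BentDomain
open Filter Topology
variable {d : ℕ} {W : WallSystem d}

/-! ### Compactness estimates for the Lorentz form -/

lemma lor_neg_of_closed {x v : Vec d} (hx : x ∈ fut d) (hv : v ≠ 0) (h1 : lor v v ≤ 0)
    (h2 : 0 ≤ v (Fin.last d)) : lor x v < 0 := by
  rcases h2.eq_or_lt with h | h
  · exfalso
    apply hv
    rw [lor_apply, ← h] at h1
    have h1 : ∑ i : Fin d, v i.castSucc * v i.castSucc = 0 :=
      le_antisymm (by simpa using h1) (Finset.sum_nonneg fun i _ => mul_self_nonneg _)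
    rw [Finset.sum_eq_zero_iff_of_nonneg (fun i _ => mul_self_nonneg _)] at h1
    ext i
    refine Fin.lastCases ?_ (fun j => ?_) i
    · simpa using h.symm
    · simpa using h1 j (Finset.mem_univ _)
  · exact lor_neg_of_mem_fut_of_le hx h1 h

lemma exists_norm_le_neg_lor {e : Vec d} (he : e ∈ fut d) :
    ∃ δ > 0, ∀ v ∈ fut d, δ * ‖v‖ ≤ -lor e v := by
  let K : Set (Vec d) := Metric.sphere 0 1 ∩ {v | lor v v ≤ 0 ∧ 0 ≤ v (Fin.last d)}
  have hK : IsCompact K := by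
    refine (isCompact_sphere _ _).inter_right ?_
    have h1 : IsClosed {v : Vec d | lor v v ≤ 0} := isClosed_le (by fun_prop) continuous_const
    have h2 : IsClosed {v : Vec d | 0 ≤ v (Fin.last d)} :=
      isClosed_le continuous_const (continuous_apply _)
    exact h1.inter h2
  have hpos : ∀ v ∈ K, 0 < -lor e v := fun v hv => by
    have hv0 : v ≠ 0 := by
      rintro rfl
      simpa using hv.1
    linarith [lor_neg_of_closed he hv0 hv.2.1 hv.2.2]
  obtain ⟨δ, hδ, h⟩ : ∃ δ > 0, ∀ v ∈ K, δ ≤ -lor e v := by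
    by_cases hne : K.Nonempty
    · obtain ⟨v, hv, hmin⟩ := hK.exists_isMinOn hne (f := fun v => -lor e v)
        (by fun_prop)
      exact ⟨_, hpos v hv, fun u hu => hmin hu⟩
    · exact ⟨1, one_pos, fun v hv => absurd ⟨v, hv⟩ hne⟩
  refine ⟨δ, hδ, fun v hv => ?_⟩
  have hn : 0 < ‖v‖ := norm_pos_iff.2 (ne_zero_of_mem_fut hv)
  have hm := smul_mem_fut hv (inv_pos.2 hn)
  have := h (‖v‖⁻¹ • v) ⟨by simp [norm_smul, hn.ne'], hm.1.le, hm.2.le⟩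
  rw [lor_smul_right, ← mul_neg, ← div_eq_inv_mul, le_div_iff₀ hn] at this
  exact this

lemma exists_sq_norm_le {K : Set (Vec d)} (hK : IsCompact K) (hKf : K ⊆ fut d) :
    ∃ δ > 0, ∀ x ∈ K, ∀ v, δ * ‖v‖ ^ 2 ≤ -lor x x * lor v v + 2 * lor x v ^ 2 := by
  have hc : IsCompact (K ×ˢ Metric.sphere (0 : Vec d) 1) := hK.prod (isCompact_sphere _ _)
  have hpos : ∀ p ∈ K ×ˢ Metric.sphere (0 : Vec d) 1,
      0 < -lor p.1 p.1 * lor p.2 p.2 + 2 * lor p.1 p.2 ^ 2 := by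
    rintro ⟨x, v⟩ ⟨hx, hv⟩
    have hx := hKf hx
    have hv0 : v ≠ 0 := by
      rintro rfl
      simp at hv
    by_cases h0 : lor x v = 0
    · have := lor_pos_of_orthogonal hx h0 hv0
      have := hx.1
      simp only [h0]; nlinarith
    · have := lor_mul_lor_le hx v
      have : 0 < lor x v ^ 2 := by positivity
      simp only; nlinarith
  obtain ⟨δ, hδ, h⟩ : ∃ δ > 0, ∀ p ∈ K ×ˢ Metric.sphere (0 : Vec d) 1,
      δ ≤ -lor p.1 p.1 * lor p.2 p.2 + 2 * lor p.1 p.2 ^ 2 := by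
    by_cases hne : (K ×ˢ Metric.sphere (0 : Vec d) 1).Nonempty
    · obtain ⟨v, hv, hmin⟩ := hc.exists_isMinOn hne
        (f := fun p => -lor p.1 p.1 * lor p.2 p.2 + 2 * lor p.1 p.2 ^ 2)
        (by fun_prop)
      exact ⟨_, hpos v hv, fun u hu => hmin hu⟩
    · exact ⟨1, one_pos, fun v hv => absurd ⟨v, hv⟩ hne⟩
  refine ⟨δ, hδ, fun x hx v => ?_⟩
  by_cases hv : v = 0
  · simp [hv]
  have hn : 0 < ‖v‖ := norm_pos_iff.2 hv
  have := h (x, ‖v‖⁻¹ • v) ⟨hx, by simp [norm_smul, hn.ne']⟩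
  simp only [lor_smul_right, lor_smul_left] at this
  have e : -lor x x * (‖v‖⁻¹ * (‖v‖⁻¹ * lor v v)) + 2 * (‖v‖⁻¹ * lor x v) ^ 2
      = (‖v‖ ^ 2)⁻¹ * (-lor x x * lor v v + 2 * lor x v ^ 2) := by
    field_simp
  rw [e, ← div_eq_inv_mul, le_div_iff₀ (by positivity)] at this
  exact this

namespace Flag

lemma lor_mul_lor_pos {n n' w w' : Vec d} (hn : n ∈ W.S) (hn' : n' ∈ W.S) (hne : n ≠ n')
    (hw : w ∈ fut d) (hw' : w' ∈ fut d) (h : lor n w = 0) (h' : lor n w' = 0) :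
    0 < lor n' w * lor n' w' := by
  have ha : 1 < lor n n' ^ 2 := (one_lt_sq_iff_one_lt_abs _).mpr (W.sep n hn n' hn' hne)
  have e1 : ∀ z, lor n z = 0 → lor (n' - lor n n' • n) z = lor n' z := fun z hz => by
    simp [hz]
  have h1 := lor_self_aux (W.unit n hn) (W.unit n' hn')
  rw [← e1 w h, ← e1 w' h']
  rcases mem_fut_or_neg_mem (u := n' - lor n n' • n) (by rw [h1]; linarith) with hu | hu
  · exact mul_pos_of_neg_of_neg (lor_neg_of_mem_fut hu hw) (lor_neg_of_mem_fut hu hw')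
  · have := mul_pos_of_neg_of_neg (lor_neg_of_mem_fut hu hw) (lor_neg_of_mem_fut hu hw')
    simpa only [lor_neg_left, neg_mul_neg] using this

lemma side_le_of_wall {X : Flag W} {n w : Vec d} (hn : n ∈ W.S) (h0 : lor n X.pt = 0)
    (hw : w ∈ fut d) (h : lor n w = 0) : ∀ n' ∈ W.S, 0 ≤ sg (X.side n') * lor n' w := by
  intro n' hn'
  by_cases he : n = n'
  · subst he; simp [h]
  · have h1 := lor_mul_lor_pos hn hn' he X.mem hw h0 h
    have h2 := X.le n' hn'
    rcases Int.units_eq_one_or (X.side n') with h | h <;> rw [h] at h2 ⊢ <;> simp at h2 ⊢ <;>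
      nlinarith

lemma mem_U_of_wall {X : Flag W} {n w : Vec d} (hn : n ∈ W.S) (h0 : lor n X.pt = 0)
    (hw : w ∈ fut d) (h : lor n w = 0) : w ∈ X.U := by
  have := pt_mem_U (X.move w hw (side_le_of_wall hn h0 hw h))
  rwa [← U_eq_of_sep (X := X) sep_move] at this

lemma proj_mem_fut_of_mem_U {X : Flag W} {n z : Vec d} (hn : n ∈ W.S) (h0 : lor n X.pt = 0)
    (hz : z ∈ X.U) : proj n z ∈ fut d := by
  obtain ⟨Z, rfl⟩ := hz
  obtain ⟨l, hl⟩ := exists_sorted X Z subset_rfl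
  cases l with
  | nil =>
    have : X.Sep Z = ∅ := Set.eq_empty_of_forall_notMem fun n hn => by simpa using (hl.2 n).2 hn
    rw [B_eq_one this]
    exact proj_mem_fut (W.unit n hn) Z.mem
  | cons n₁ t =>
    have hn₁ : n₁ ∈ X.Sep Z := (hl.2 n₁).1 (by simp)
    have hz := B_mem_halfCyl hl
    set z := B X Z Z.pt
    by_cases he : n₁ = n
    · subst he
      have := hz.1
      rwa [or, proj_smul_sg] at this
    · obtain ⟨hp, hc⟩ := hz
      set m := Z.or n₁
      have hm : lor m m = 1 := Z.or_unit hn₁.1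
      have hnm : 1 < lor n m ^ 2 := by
        rw [one_lt_sq_iff_one_lt_abs]
        have h1 := W.sep n hn n₁ hn₁.1 (Ne.symm he)
        simp only [m, or, lor_smul_right, abs_mul]
        rcases Int.units_eq_one_or (Z.side n₁) with h | h <;> simpa [h] using h1
      have hu : m - lor n m • n ∈ fut d := by
        refine mem_fut_of_lor_nonpos (x := X.pt) ?_ X.mem ?_
        · rw [lor_self_aux (W.unit n hn) hm]; linarith
        · simpa [h0] using lor_or_nonpos hn₁
      have ez : z = proj m z + lor m z • m := by rw [proj_apply]; module
      have e : proj n z = proj n (proj m z) + lor m z • (m - lor n m • n) := by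
        conv_lhs => rw [ez]
        rw [map_add, map_smul, proj_apply n m]
      rw [e]
      rcases hc.eq_or_lt with h5 | h5
      · rw [← h5]; simpa using proj_mem_fut (W.unit n hn) hp
      · exact add_mem_fut (proj_mem_fut (W.unit n hn) hp) (smul_mem_fut hu h5)

/-- The domain is inscribed in the cylinder of the wall `n`. -/
def Cyl (X : Flag W) (n : Vec d) : Prop :=
  n ∈ W.S ∧ (∀ w ∈ fut d, lor n w = 0 → w ∈ X.U) ∧ ∀ z ∈ X.U, proj n z ∈ fut d

lemma cyl_of_wall {X : Flag W} {n : Vec d} (hn : n ∈ W.S) (h0 : lor n X.pt = 0) : X.Cyl n :=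
  ⟨hn, fun _ => mem_U_of_wall hn h0, fun _ => proj_mem_fut_of_mem_U hn h0⟩

lemma exists_cyl_ne {X : Flag W} {n n₁ y : Vec d} (hn₁ : n₁ ∈ W.S)
    (hy : y ∈ fut d) (h1 : lor n₁ y = 0) (hs : 0 < sg (X.side n) * lor n y) :
    ∃ n', n' ≠ n ∧ X.Cyl n' := by
  have hne : n₁ ≠ n := by rintro rfl; simp [h1] at hs
  classical
  let Y : Flag W := ⟨y, Function.update (std W y hy).side n₁ (-X.side n₁), hy, fun n' hn' => by
    by_cases he : n' = n₁
    · subst he; simp [h1]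
    · rw [Function.update_of_ne he]
      exact (std W y hy).le n' hn'⟩
  have hYn : Y.side n = X.side n := by
    simp only [Y, std, Function.update_of_ne hne.symm]
    rcases Int.units_eq_one_or (X.side n) with h | h <;> rw [h] at hs ⊢ <;> simp at hs ⊢ <;>
      linarith
  have hsep : n₁ ∈ X.Sep Y := ⟨hn₁, by simp [Y]⟩
  obtain ⟨l, hl⟩ := exists_sorted X Y subset_rfl
  cases l with
  | nil => simpa using (hl.2 n₁).2 hsep
  | cons n' t =>
    have hn' : n' ∈ X.Sep Y := (hl.2 n').1 (by simp)
    obtain ⟨w, hw, hwf, hw0⟩ := exists_wall_crossing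
      (proj_mem_fut (Y.or_unit hn'.1) X.mem) (proj_mem_fut (Y.or_unit hn'.1) Y.mem)
      (lor_or_nonpos hn') (Y.lor_or_nonneg hn'.1)
    have hw0 := lor_eq_zero_of_or hw0
    have h3 := cyl_of_wall (X := X.move w hwf (side_le_of_first hl hwf hw0)) hn'.1 hw0
    refine ⟨n', fun he => hn'.2 (he ▸ hYn.symm), ?_⟩
    rw [Cyl, ← U_eq_of_sep (X := X) sep_move] at h3
    exact h3

lemma exists_functional {X : Flag W} {n n' : Vec d} (h : X.Cyl n) (h' : X.Cyl n')
    (hne : n ≠ n') : ∃ (ψ : Vec d →ₗ[ℝ] ℝ), ∃ δ > 0, ∀ z ∈ X.U, δ * ‖z‖ ≤ ψ z := by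
  by_cases hU : (fut d).Nonempty
  swap
  · refine ⟨0, 1, one_pos, fun z hz => ?_⟩
    rw [← image_F] at hz
    obtain ⟨y, hy, -⟩ := hz
    exact absurd ⟨y, hy⟩ hU
  obtain ⟨e, he⟩ := hU
  obtain ⟨δ, hδ, hδ'⟩ := exists_norm_le_neg_lor he
  let T : Vec d →ₗ[ℝ] Vec d × Vec d := (proj n).prod (proj n')
  have hT : LinearMap.ker T = ⊥ := by
    rw [LinearMap.ker_eq_bot']
    intro z hz
    have h1 : proj n z = 0 := congrArg Prod.fst hz
    have h2 : proj n' z = 0 := congrArg Prod.snd hz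
    rw [proj_apply, sub_eq_zero] at h1 h2
    have h3 : lor n' z = lor n z * lor n n' :=
      (congrArg (lor n') h1).trans (by rw [lor_smul_right, lor_comm n' n])
    have h4 : lor n z = lor n' z * lor n n' :=
      (congrArg (lor n) h2).trans (lor_smul_right _ _ _)
    have ha : 1 < lor n n' ^ 2 := (one_lt_sq_iff_one_lt_abs _).mpr (W.sep n h.1 n' h'.1 hne)
    have h5 : lor n z * (1 - lor n n' ^ 2) = 0 := by rw [h3] at h4; linarith
    have h6 : lor n z = 0 := (mul_eq_zero.1 h5).resolve_right (by linarith)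
    rw [h1, h6, zero_smul]
  obtain ⟨K, hK, hanti⟩ := T.exists_antilipschitzWith hT
  refine ⟨-(lor e ∘ₗ proj n) - lor e ∘ₗ proj n', δ / K, by positivity, fun z hz => ?_⟩
  have h1 := hδ' _ (h.2.2 z hz)
  have h2 := hδ' _ (h'.2.2 z hz)
  have h3 : ‖z‖ ≤ K * ‖T z‖ := by simpa using hanti.le_mul_dist z 0
  have h4 : ‖T z‖ ≤ ‖proj n z‖ + ‖proj n' z‖ :=
    max_le (le_add_of_nonneg_right (norm_nonneg _)) (le_add_of_nonneg_left (norm_nonneg _))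
  have hK' : (0 : ℝ) < K := hK
  have h5 : δ / K * ‖z‖ ≤ δ * ‖T z‖ := by
    rw [div_mul_eq_mul_div, div_le_iff₀ hK']
    nlinarith
  simp only [LinearMap.sub_apply, LinearMap.neg_apply, LinearMap.comp_apply]
  nlinarith

end Flag
end BentDomain

namespace BentDomain
open Filter Topology
variable {d : ℕ} {W : WallSystem d}

/-- `q` is a symmetric bilinear form whose negative cone is `U ∪ -U`. -/
structure RoundFor (U : Set (Vec d)) (q : Vec d →ₗ[ℝ] Vec d →ₗ[ℝ] ℝ) : Prop where
  symm : ∀ x y, q x y = q y x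
  neg : ∀ x ∈ U, q x x < 0
  mem : ∀ x, q x x < 0 → x ∈ U ∨ -x ∈ U

lemma exists_orthogonal_pair (hd : 2 ≤ d) (a b : Vec d) :
    ∃ z : Vec d, z ≠ 0 ∧ lor a z = 0 ∧ lor b z = 0 := by
  have h := LinearMap.ker_ne_bot_of_finrank_lt (f := (lor a).prod (lor b)) (by simp; omega)
  obtain ⟨z, hz, h0⟩ := (Submodule.ne_bot_iff _).1 h
  exact ⟨z, h0, congrArg Prod.fst hz, congrArg Prod.snd hz⟩

namespace Flag
variable {X : Flag W} {n : Vec d} {q : Vec d →ₗ[ℝ] Vec d →ₗ[ℝ] ℝ}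

lemma round_null (h : X.Cyl n) (hq : RoundFor X.U q) {e v : Vec d} (he : e ∈ fut d)
    (hen : lor n e = 0) (hv : lor e v = 0) (hvn : lor n v = 0) (hvv : lor v v = -lor e e) :
    q (e + v) (e + v) = 0 ∧ q (e + v) n = 0 := by
  have hn := W.unit n h.1
  have hf : ∀ t : ℝ, lor (e + t • v) (e + t • v) = lor e e * (1 - t ^ 2) := fun t => by
    simp only [lor_add_left, lor_add_right, lor_smul_left, lor_smul_right, hv, lor_comm v e, hvv]
    ring
  have hneg : ∀ t ∈ Set.Ioo (-1 : ℝ) 1, q (e + t • v) (e + t • v) ≤ 0 := fun t ht => by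
    refine (hq.neg _ (h.2.1 _ ?_ (by simp [hen, hvn]))).le
    refine mem_fut_of_lor_nonpos (x := e) ?_ he ?_
    · rw [hf]
      have := he.1
      have : 0 < 1 - t ^ 2 := by nlinarith [ht.1, ht.2]
      nlinarith
    · simp [lor_comm v e, hv, he.1.le]
  have hclosed : IsClosed {t : ℝ | q (e + t • v) (e + t • v) ≤ 0} := by
    refine isClosed_le ?_ continuous_const
    simp only [map_add, map_smul, LinearMap.add_apply, LinearMap.smul_apply, smul_eq_mul]
    fun_prop
  have h1 : q (e + v) (e + v) ≤ 0 := by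
    have h2 := hclosed.closure_subset_iff.2 hneg
    rw [closure_Ioo (by norm_num)] at h2
    have := h2 (show (1 : ℝ) ∈ Set.Icc (-1) 1 by norm_num)
    simpa using this
  have hnot : ∀ z, proj n z = e + v → ¬ q z z < 0 := by
    intro z hz hlt
    have h0 := hf 1
    rw [one_smul] at h0
    rcases hq.mem z hlt with h2 | h2
    · have := (h.2.2 _ h2).1
      rw [hz, h0] at this; norm_num at this
    · have := (h.2.2 _ h2).1
      rw [map_neg, hz, lor_neg_left, lor_neg_right, h0] at this; norm_num at this
  have h2 : q (e + v) (e + v) = 0 :=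
    le_antisymm h1 (not_lt.1 (hnot _ (proj_eq_self (by simp [hen, hvn]))))
  refine ⟨h2, ?_⟩
  by_contra hne
  have hs : ∀ s : ℝ, 0 ≤ 2 * s * q (e + v) n + s ^ 2 * q n n := fun s => by
    have := not_lt.1 (hnot (e + v + s • n) (by
      simp only [proj_apply, lor_add_right, lor_smul_right, hen, hvn, hn]; module))
    have gen : ∀ y, q (y + s • n) (y + s • n) = q y y + 2 * s * q y n + s ^ 2 * q n n := fun y => by
      simp only [map_add, map_smul, LinearMap.add_apply, LinearMap.smul_apply, smul_eq_mul,
        hq.symm n y]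
      ring
    have e1 := gen (e + v)
    rw [e1, h2] at this; linarith
  set b := q (e + v) n
  have hb := sq_pos_of_ne_zero hne
  have := hs (-b / (1 + |q n n|))
  have hp : 0 < 1 + |q n n| := by positivity
  have e2 : 2 * (-b / (1 + |q n n|)) * b + (-b / (1 + |q n n|)) ^ 2 * q n n
      = b ^ 2 / (1 + |q n n|) ^ 2 * (q n n - 2 * (1 + |q n n|)) := by
    field_simp; ring
  rw [e2] at this
  have h3 : q n n - 2 * (1 + |q n n|) < 0 := by linarith [le_abs_self (q n n), abs_nonneg (q n n)]
  have h4 : 0 < b ^ 2 / (1 + |q n n|) ^ 2 := by positivity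
  nlinarith

lemma round_orthogonal (h : X.Cyl n) (hq : RoundFor X.U q) {e v : Vec d} (he : e ∈ fut d)
    (hen : lor n e = 0) (hv : lor e v = 0) (hvn : lor n v = 0) (hv0 : v ≠ 0) :
    q e v = 0 ∧ lor e e * q v v = q e e * lor v v ∧ q v n = 0 ∧ q e n = 0 := by
  have h1 := lor_pos_of_orthogonal he hv hv0
  have h2 := he.1
  obtain ⟨s, hs, hs2⟩ : ∃ s : ℝ, 0 < s ∧ s * s * lor v v = -lor e e :=
    ⟨√(-lor e e / lor v v), Real.sqrt_pos.2 (div_pos (by linarith) h1), by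
      rw [Real.mul_self_sqrt (div_nonneg (by linarith) h1.le), div_mul_cancel₀ _ h1.ne']⟩
  obtain ⟨a1, a2⟩ := round_null h hq he hen (v := s • v) (by simp [hv]) (by simp [hvn])
    (by simp only [lor_smul_left, lor_smul_right]; linarith)
  obtain ⟨b1, b2⟩ := round_null h hq he hen (v := (-s) • v) (by simp [hv]) (by simp [hvn])
    (by simp only [lor_smul_left, lor_smul_right]; linarith)
  simp only [map_add, map_smul, LinearMap.add_apply, LinearMap.smul_apply, smul_eq_mul,
    hq.symm v e] at a1 a2 b1 b2
  have c1 : s * q e v = 0 := by linarith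
  have c2 : q e e = -(s * s * q v v) := by linarith
  have c3 : s * q v n = 0 := by linarith
  have hs' := hs.ne'
  refine ⟨by simpa [hs'] using c1, ?_, by simpa [hs'] using c3, by linarith⟩
  rw [c2, ← neg_eq_iff_eq_neg.2 hs2.symm.symm]; ring

/-- A round domain inscribed in a cylinder is given by a pencil of forms. -/
lemma round_form (hd : 2 ≤ d) (h : X.Cyl n) (hq : RoundFor X.U q) {e : Vec d} (he : e ∈ fut d)
    (hen : lor n e = 0) :
    ∃ κ μ : ℝ, ∀ z, q z z = κ * lor z z + μ * lor n z ^ 2 := by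
  have hn := W.unit n h.1
  have hee := he.1.ne
  have hE : q e n = 0 := by
    obtain ⟨v, hv0, hv, hvn⟩ := exists_orthogonal_pair hd e n
    exact (round_orthogonal h hq he hen hv hvn hv0).2.2.2
  have hO : ∀ v, lor e v = 0 → lor n v = 0 →
      q e v = 0 ∧ lor e e * q v v = q e e * lor v v ∧ q v n = 0 := by
    intro v hv hvn
    by_cases hv0 : v = 0
    · simp [hv0]
    · obtain ⟨a, b, c, -⟩ := round_orthogonal h hq he hen hv hvn hv0
      exact ⟨a, b, c⟩
  refine ⟨q e e / lor e e, q n n - q e e / lor e e, fun z => ?_⟩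
  set a := lor e z / lor e e
  set b := lor n z
  set v := z - a • e - b • n
  have hv : lor e v = 0 := by
    simp only [v, a, lor_sub_right, lor_smul_right, lor_comm e n, hen]; field_simp; ring
  have hvn : lor n v = 0 := by
    simp only [v, b, lor_sub_right, lor_smul_right, hn, hen]; ring
  obtain ⟨h1, h2, h3⟩ := hO v hv hvn
  have ez : z = a • e + b • n + v := by simp only [v]; module
  have hz1 : q z z = a * a * q e e + b * b * q n n + q v v := by
    rw [ez]
    simp only [map_add, map_smul, LinearMap.add_apply, LinearMap.smul_apply, smul_eq_mul,
      hq.symm v e, hq.symm n e, hq.symm n v, h1, h3, hE]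
    ring
  have hz2 : lor z z = a * a * lor e e + b * b + lor v v := by
    rw [ez]
    simp only [map_add, map_smul, LinearMap.add_apply, LinearMap.smul_apply, smul_eq_mul,
      lor_comm v e, lor_comm e n, lor_comm v n, hv, hvn, hen, hn]
    ring
  have h4 : q v v = q e e / lor e e * lor v v := by
    field_simp; linarith
  rw [hz1, hz2, h4]
  field_simp
  ring

lemma round_eq (hd : 2 ≤ d) {n' : Vec d} (h : X.Cyl n) (h' : X.Cyl n') (hne : n ≠ n')
    (hq : RoundFor X.U q) {e e' : Vec d} (he : e ∈ fut d)
    (hen : lor n e = 0) (he' : e' ∈ fut d) (hen' : lor n' e' = 0) :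
    ∃ κ : ℝ, ∀ z, q z z = κ * lor z z := by
  obtain ⟨κ, μ, h1⟩ := round_form hd h hq he hen
  obtain ⟨κ', μ', h2⟩ := round_form hd h' hq he' hen'
  have hn := W.unit n h.1
  have hn' := W.unit n' h'.1
  have ha : 1 < lor n n' ^ 2 := (one_lt_sq_iff_one_lt_abs _).mpr (W.sep n h.1 n' h'.1 hne)
  have huu := lor_self_aux hn hn'
  have hnu : lor n (n' - lor n n' • n) = 0 := by simp [hn]
  have hn'u : lor n' (n' - lor n n' • n) = 1 - lor n n' ^ 2 := by
    simp only [lor_sub_right, lor_smul_right, hn', lor_comm n' n]; ring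
  set u := n' - lor n n' • n with hu
  obtain ⟨z, hz0, hz, hz'⟩ := exists_orthogonal_pair hd n n'
  have hzu : lor u z = 0 := by simp [hu, hz, hz']
  have hzz : 0 < lor z z := by
    rcases mem_fut_or_neg_mem (u := u) (by rw [huu]; linarith) with hf | hf
    · exact lor_pos_of_orthogonal hf hzu hz0
    · exact lor_pos_of_orthogonal hf (by simp [hzu]) hz0
  have hκ : κ = κ' := by
    have := (h1 z).symm.trans (h2 z)
    rw [hz, hz'] at this
    have : (κ - κ') * lor z z = 0 := by linarith
    linarith [(mul_eq_zero.1 this).resolve_right hzz.ne']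
  have hμ : μ' = 0 := by
    have := (h1 u).symm.trans (h2 u)
    rw [hnu, hn'u, hκ] at this
    have h3 : μ' * (1 - lor n n' ^ 2) ^ 2 = 0 := by linarith
    refine (mul_eq_zero.1 h3).resolve_right (pow_ne_zero _ (by linarith))
  exact ⟨κ', fun z => by rw [h2, hμ]; ring⟩

/-- The developed domain is not round if the base lies on a wall with further walls on both
sides. -/
lemma not_round (hd : 2 ≤ d) {e n n₁ n₂ y₁ y₂ : Vec d} (he : X.pt = e) (hn : n ∈ W.S)
    (hen : lor n e = 0) (hn₁ : n₁ ∈ W.S) (hn₂ : n₂ ∈ W.S) (hy₁ : y₁ ∈ fut d)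
    (hy₂ : y₂ ∈ fut d) (h1 : lor n₁ y₁ = 0) (h2 : lor n₂ y₂ = 0) (hp₁ : 0 < lor n y₁)
    (hp₂ : lor n y₂ < 0) : ¬ RoundFor X.U q := by
  intro hq
  subst he
  have side : ∀ Y : Flag W, Y.pt = X.pt → ∃ n', n ≠ n' ∧ Y.Cyl n ∧ Y.Cyl n' := by
    intro Y hY
    have hc : Y.Cyl n := cyl_of_wall hn (by rw [hY, hen])
    rcases Int.units_eq_one_or (Y.side n) with hs | hs
    · obtain ⟨n', hne, h⟩ := exists_cyl_ne (X := Y) (n := n) hn₁ hy₁ h1 (by simpa [hs] using hp₁)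
      exact ⟨n', hne.symm, hc, h⟩
    · obtain ⟨n', hne, h⟩ := exists_cyl_ne (X := Y) (n := n) hn₂ hy₂ h2 (by simpa [hs] using hp₂)
      exact ⟨n', hne.symm, hc, h⟩
  have wall : ∀ n' ∈ W.S, ∃ e' ∈ fut d, lor n' e' = 0 := fun n' hn' =>
    ⟨_, proj_mem_fut (W.unit n' hn') X.mem, lor_proj (W.unit n' hn') _⟩
  have form : ∀ Y : Flag W, Y.pt = X.pt → ∀ q, RoundFor Y.U q →
      ∃ κ : ℝ, ∀ z, q z z = κ * lor z z := by
    intro Y hY q hq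
    obtain ⟨n', hne, hc, hc'⟩ := side Y hY
    obtain ⟨e', he', hen'⟩ := wall n' hc'.1
    exact round_eq hd hc hc' hne hq X.mem hen he' hen'
  let X' := X.flip n X.pt X.mem hen X.le
  let b := bends (-X.side n) n
  have hb : B X X' = b := B_flip hn
  have hUb : ∀ z, z ∈ X'.U ↔ b z ∈ X.U := fun z => by
    rw [← image_U X X', hb]
    exact (b.injective.mem_set_image).symm
  obtain ⟨κ, hκ⟩ := form X rfl q hq
  obtain ⟨κ', hκ'⟩ := form X' rfl (q.compl₁₂ b.toLinearMap b.toLinearMap) {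
    symm := fun x y => hq.symm _ _
    neg := fun x hx => hq.neg _ ((hUb x).1 hx)
    mem := fun x hx => by
      rw [hUb, hUb, map_neg]
      exact hq.mem _ hx }
  have hκ' : ∀ z, q (b z) (b z) = κ' * lor z z := hκ'
  have hn1 := W.unit n hn
  have hbe : b X.pt = X.pt := bends_apply_eq_self hn1 _ hen
  have e1 := hκ' X.pt
  rw [hbe, hκ] at e1
  have hX := X.mem.1
  have e2 : κ = κ' := mul_right_cancel₀ hX.ne e1
  have hκ0 : κ ≠ 0 := by
    rintro rfl
    have := hq.neg _ (pt_mem_U X)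
    rw [hκ] at this; simp at this
  have e3 := hκ' n
  rw [hκ, ← e2, hn1] at e3
  have e4 := mul_left_cancel₀ hκ0 e3
  rcases Int.units_eq_one_or (-X.side n) with hs | hs
  · have : b n = (2 : ℝ) • n := by
      simp only [b, bends, hs, Units.val_one, zpow_one, bend_apply hn1, hn1]; module
    rw [this] at e4; norm_num [hn1] at e4
  · have : b n = (1 / 2 : ℝ) • n := by
      simp only [b, bends, hs, Units.val_neg, Units.val_one, _root_.zpow_neg, zpow_one,
        bend_inv_apply hn1, hn1]; module
    rw [this] at e4; norm_num [hn1] at e4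

end Flag
end BentDomain

namespace BentDomain
open Filter Topology
variable {d : ℕ}

/-! ### The ring of integers of `ℚ(√2)` and its two real embeddings -/

/-- The embedding of `ℤ[√2]` sending `√2` to `s * √2`. -/
noncomputable def emb (s : ℤˣ) : Zsqrtd 2 →+* ℝ :=
  Zsqrtd.lift ⟨sg s * √2, by
    rw [mul_mul_mul_comm, sg_mul_self, Real.mul_self_sqrt (by norm_num)]; norm_num⟩

lemma emb_one_apply (a : Zsqrtd 2) : emb 1 a = a.re + a.im * √2 := by
  simp [emb, sg]

lemma emb_neg_apply (a : Zsqrtd 2) : emb (-1) a = a.re - a.im * √2 := by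
  simp [emb, sg]; ring

lemma abs_re_le {a : Zsqrtd 2} {B : ℝ} (h1 : |emb 1 a| ≤ B) (h2 : |emb (-1) a| ≤ B) :
    |(a.re : ℝ)| ≤ B ∧ |(a.im : ℝ)| ≤ B := by
  rw [emb_one_apply, abs_le] at h1
  rw [emb_neg_apply, abs_le] at h2
  have h3 : 1 ≤ √2 := Real.one_le_sqrt.2 (by norm_num)
  refine ⟨abs_le.2 ⟨by linarith, by linarith⟩, ?_⟩
  have h4 : |(a.im : ℝ) * √2| ≤ B := abs_le.2 ⟨by linarith, by linarith⟩
  rw [abs_mul, abs_of_pos (by positivity : 0 < √2)] at h4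
  nlinarith [abs_nonneg (a.im : ℝ)]

lemma eq_zero_of_abs_emb_lt {a : Zsqrtd 2} (h1 : |emb 1 a| < 1) (h2 : |emb (-1) a| < 1) :
    a = 0 := by
  have h := abs_re_le (le_max_left (|emb 1 a|) (|emb (-1) a|)) (le_max_right _ _)
  have hm := max_lt h1 h2
  have aux : ∀ z : ℤ, |(z : ℝ)| < 1 → z = 0 := fun z hz => by
    rw [← Int.cast_abs] at hz
    have : |z| < 1 := by exact_mod_cast hz
    exact Int.abs_lt_one_iff.1 this
  exact Zsqrtd.ext (aux _ (h.1.trans_lt hm)) (aux _ (h.2.trans_lt hm))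

lemma finite_int_abs_le (B : ℝ) : {z : ℤ | |(z : ℝ)| ≤ B}.Finite := by
  refine (Set.finite_Icc (-⌈B⌉) ⌈B⌉).subset fun z hz => ?_
  have hz : |(z : ℝ)| ≤ B := hz
  rw [Set.mem_Icc, ← abs_le]
  have : (|z| : ℝ) ≤ ⌈B⌉ := by
    exact (hz.trans (Int.le_ceil B))
  exact_mod_cast this

lemma finite_emb_le (B : ℝ) : {a : Zsqrtd 2 | |emb 1 a| ≤ B ∧ |emb (-1) a| ≤ B}.Finite := by
  refine Set.Finite.of_finite_image (f := fun a : Zsqrtd 2 => (a.re, a.im)) ?_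
    fun a _ b _ h => Zsqrtd.ext (congrArg Prod.fst h) (congrArg Prod.snd h)
  refine ((finite_int_abs_le B).prod (finite_int_abs_le B)).subset ?_
  rintro _ ⟨a, ha, rfl⟩
  exact abs_re_le ha.1 ha.2

lemma emb_injective (s : ℤˣ) : Function.Injective (emb s) :=
  Zsqrtd.lift_injective _ fun n h => by
    have h1 : n * n ≤ 2 := h.ge
    have h2 : -2 < n := by nlinarith
    have h3 : n < 2 := by nlinarith
    interval_cases n <;> simp at h

/-! ### The lattice `ℤ[√2]^{d+1}` -/

/-- The real vector obtained by applying an embedding coordinatewise. -/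
noncomputable def vec (s : ℤˣ) (v : Fin (d + 1) → Zsqrtd 2) : Vec d := fun i => emb s (v i)

lemma vec_add (s : ℤˣ) (v w : Fin (d + 1) → Zsqrtd 2) : vec s (v + w) = vec s v + vec s w := by
  ext i; simp [vec]

lemma vec_smul (s : ℤˣ) (a : Zsqrtd 2) (v : Fin (d + 1) → Zsqrtd 2) :
    vec s (a • v) = emb s a • vec s v := by
  ext i; simp [vec]

lemma vec_sum {κ : Type*} (s : ℤˣ) (t : Finset κ) (v : κ → Fin (d + 1) → Zsqrtd 2) :
    vec s (∑ i ∈ t, v i) = ∑ i ∈ t, vec s (v i) := by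
  ext i; simp [vec]

lemma vec_injective (s : ℤˣ) : Function.Injective (vec s : (Fin (d + 1) → Zsqrtd 2) → Vec d) :=
  fun _ _ h => funext fun i => emb_injective s (congrFun h i)

lemma finite_vec_le (B : ℝ) :
    {v : Fin (d + 1) → Zsqrtd 2 | ‖vec 1 v‖ ≤ B ∧ ‖vec (-1) v‖ ≤ B}.Finite := by
  refine (Set.Finite.pi fun _ => finite_emb_le B).subset fun v hv i _ => ?_
  exact ⟨(norm_le_pi_norm (vec 1 v) i).trans hv.1, (norm_le_pi_norm (vec (-1) v) i).trans hv.2⟩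

/-- The Lorentz form over `ℤ[√2]`. -/
def lorO (x y : Fin (d + 1) → Zsqrtd 2) : Zsqrtd 2 :=
  ∑ i : Fin d, x i.castSucc * y i.castSucc - ⟨0, 1⟩ * (x (Fin.last d) * y (Fin.last d))

/-- The Galois conjugate of the Lorentz form, which is positive definite. -/
noncomputable def cj : Vec d →ₗ[ℝ] Vec d →ₗ[ℝ] ℝ :=
  LinearMap.mk₂ ℝ (fun x y => ∑ i : Fin d, x i.castSucc * y i.castSucc
    + √2 * (x (Fin.last d) * y (Fin.last d)))
    (fun x y z => by simp only [Pi.add_apply, add_mul, Finset.sum_add_distrib]; ring)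
    (fun c x y => by simp only [Pi.smul_apply, smul_eq_mul, mul_assoc, ← Finset.mul_sum]; ring)
    (fun x y z => by simp only [Pi.add_apply, mul_add, Finset.sum_add_distrib]; ring)
    (fun c x y => by
      simp only [Pi.smul_apply, smul_eq_mul, mul_add, Finset.mul_sum]
      congr 1
      · exact Finset.sum_congr rfl fun i _ => by ring
      · ring)

lemma cj_apply (x y : Vec d) : cj x y = ∑ i : Fin d, x i.castSucc * y i.castSucc
    + √2 * (x (Fin.last d) * y (Fin.last d)) := rfl

lemma cj_comm (x y : Vec d) : cj x y = cj y x := by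
  simp only [cj_apply, fun i => mul_comm (x i) (y i)]

lemma emb_lorO (x y : Fin (d + 1) → Zsqrtd 2) : emb 1 (lorO x y) = lor (vec 1 x) (vec 1 y) := by
  have : emb 1 (⟨0, 1⟩ : Zsqrtd 2) = √2 := by simp [emb_one_apply]
  simp only [lorO, map_sub, map_sum, map_mul, this, lor_apply, vec]

lemma emb_neg_lorO (x y : Fin (d + 1) → Zsqrtd 2) :
    emb (-1) (lorO x y) = cj (vec (-1) x) (vec (-1) y) := by
  have : emb (-1) (⟨0, 1⟩ : Zsqrtd 2) = -√2 := by simp [emb_neg_apply]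
  simp only [lorO, map_sub, map_sum, map_mul, this, cj_apply, vec]
  ring

lemma sq_norm_le_cj (x : Vec d) : ‖x‖ ^ 2 ≤ cj x x := by
  have h3 : 1 ≤ √2 := Real.one_le_sqrt.2 (by norm_num)
  have key : ∀ i, x i ^ 2 ≤ cj x x := by
    intro i
    rw [cj_apply]
    have h0 : 0 ≤ ∑ i : Fin d, x i.castSucc * x i.castSucc :=
      Finset.sum_nonneg fun i _ => mul_self_nonneg _
    refine Fin.lastCases ?_ (fun j => ?_) i
    · nlinarith [mul_self_nonneg (x (Fin.last d))]
    · have : x j.castSucc * x j.castSucc ≤ ∑ i : Fin d, x i.castSucc * x i.castSucc :=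
        Finset.single_le_sum (f := fun i : Fin d => x i.castSucc * x i.castSucc)
        (fun i _ => mul_self_nonneg _) (Finset.mem_univ j)
      have h4 := mul_self_nonneg (x (Fin.last d))
      have h5 : 0 ≤ √2 * (x (Fin.last d) * x (Fin.last d)) := by positivity
      nlinarith
  have h0 : 0 ≤ cj x x := (sq_nonneg _).trans (key (Fin.last d))
  have : ‖x‖ ≤ √(cj x x) := (pi_norm_le_iff_of_nonneg (Real.sqrt_nonneg _)).2 fun i => by
    rw [Real.norm_eq_abs]; exact Real.abs_le_sqrt (key i)
  calc ‖x‖ ^ 2 ≤ √(cj x x) ^ 2 := by gcongr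
    _ = cj x x := Real.sq_sqrt h0

lemma eq_zero_of_cj {x : Vec d} (h : cj x x ≤ 0) : x = 0 := by
  have := sq_norm_le_cj x
  have h2 : ‖x‖ ^ 2 = 0 := le_antisymm (this.trans h) (sq_nonneg _)
  exact norm_eq_zero.1 (pow_eq_zero_iff two_ne_zero |>.1 h2)

lemma cj_self_nonneg (x : Vec d) : 0 ≤ cj x x := (sq_nonneg _).trans (sq_norm_le_cj x)

lemma abs_cj_le_one {x y : Vec d} (hx : cj x x = 1) (hy : cj y y = 1) : |cj x y| ≤ 1 := by
  have h1 := cj_self_nonneg (x - y)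
  have h2 := cj_self_nonneg (x + y)
  have h3 := cj_comm x y
  simp only [map_add, map_sub, LinearMap.add_apply, LinearMap.sub_apply] at h1 h2
  rw [abs_le]; constructor <;> linarith

/-- The vectors of the lattice which define the walls. -/
def IsRoot (v : Fin (d + 1) → Zsqrtd 2) : Prop :=
  lorO v v = 1 ∧ ∃ w, v = Pi.single 0 1 + (4 : Zsqrtd 2) • w

lemma lorO_add_smul (u v x y : Fin (d + 1) → Zsqrtd 2) (c : Zsqrtd 2) :
    ∃ b, lorO (u + c • x) (v + c • y) = lorO u v + c * b := by
  have key : c ∣ lorO (u + c • x) (v + c • y) - lorO u v := by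
    have aux : ∀ i, c ∣ (u + c • x) i * (v + c • y) i - u i * v i := fun i =>
      ⟨x i * v i + u i * y i + c * x i * y i, by
        simp only [Pi.add_apply, Pi.smul_apply, smul_eq_mul]; ring⟩
    have : lorO (u + c • x) (v + c • y) - lorO u v =
        ∑ i : Fin d, ((u + c • x) i.castSucc * (v + c • y) i.castSucc - u i.castSucc * v i.castSucc)
        - ⟨0, 1⟩ * ((u + c • x) (Fin.last d) * (v + c • y) (Fin.last d)
          - u (Fin.last d) * v (Fin.last d)) := by
      simp only [lorO, Finset.sum_sub_distrib]; ring
    rw [this]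
    exact dvd_sub (Finset.dvd_sum fun i _ => aux _) ((aux _).mul_left _)
  obtain ⟨b, hb⟩ := key
  exact ⟨b, by rw [← hb]; ring⟩

lemma lorO_single (hd : 1 ≤ d) :
    lorO (Pi.single 0 1 : Fin (d + 1) → Zsqrtd 2) (Pi.single 0 1) = 1 := by
  obtain ⟨k, rfl⟩ : ∃ k, d = k + 1 := ⟨d - 1, by omega⟩
  have : Fin.last (k + 1) ≠ 0 := by simp [Fin.ext_iff]
  simp [lorO, Pi.single_apply, this]

lemma IsRoot.sep (hd : 1 ≤ d) {v w : Fin (d + 1) → Zsqrtd 2} (hv : IsRoot v) (hw : IsRoot w)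
    (hne : v ≠ w) : 1 < |lor (vec 1 v) (vec 1 w)| := by
  by_contra! h
  obtain ⟨h1, x, hx⟩ := hv
  obtain ⟨h2, y, hy⟩ := hw
  have hv' : cj (vec (-1) v) (vec (-1) v) = 1 := by rw [← emb_neg_lorO, h1, map_one]
  have hw' : cj (vec (-1) w) (vec (-1) w) = 1 := by rw [← emb_neg_lorO, h2, map_one]
  obtain ⟨b, hb⟩ := lorO_add_smul (Pi.single 0 1) (Pi.single 0 1) x y (4 : Zsqrtd 2)
  rw [← hx, ← hy, lorO_single hd] at hb
  have h3 := abs_cj_le_one hv' hw'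
  rw [← emb_neg_lorO] at h3
  rw [← emb_lorO] at h
  rw [hb, map_add, map_mul, map_one, map_ofNat, abs_le] at h h3
  have hb0 : b = 0 := eq_zero_of_abs_emb_lt (abs_lt.2 ⟨by linarith, by linarith⟩)
    (abs_lt.2 ⟨by linarith, by linarith⟩)
  rw [hb0, mul_zero, add_zero] at hb
  have h4 : cj (vec (-1) v) (vec (-1) w) = 1 := by rw [← emb_neg_lorO, hb, map_one]
  have h5 : vec (-1) v - vec (-1) w = 0 := eq_zero_of_cj (by
    simp only [map_sub, LinearMap.sub_apply, hv', hw', h4, cj_comm (vec (-1) w) (vec (-1) v)]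
    norm_num)
  exact hne (vec_injective _ (sub_eq_zero.1 h5))

/-- The wall system of the lattice. -/
noncomputable def rootWalls (hd : 1 ≤ d) : WallSystem d where
  S := vec 1 '' {v | IsRoot v}
  unit := by
    rintro _ ⟨v, hv, rfl⟩
    rw [← emb_lorO, hv.1, map_one]
  sep := by
    rintro _ ⟨v, hv, rfl⟩ _ ⟨w, hw, rfl⟩ hne
    exact hv.sep hd hw fun h => hne (by rw [h])
  fin := by
    intro K hK hKc
    obtain ⟨δ, hδ, h⟩ := exists_sq_norm_le hKc hK
    obtain ⟨C, hC⟩ := (hKc.image (f := fun x => lor x x) (by fun_prop)).isBounded.exists_norm_le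
    refine ((finite_vec_le (max 1 (C / δ + 1))).image (vec 1)).subset ?_
    rintro _ ⟨⟨v, hv, rfl⟩, x, hx, hvx⟩
    refine ⟨v, ⟨?_, ?_⟩, rfl⟩
    · have h1 := h x hx (vec 1 v)
      rw [← emb_lorO, hv.1, map_one, lor_comm x (vec 1 v), hvx] at h1
      have h2 := (neg_le_abs _).trans (hC _ ⟨x, hx, rfl⟩)
      have h3 : ‖vec 1 v‖ ^ 2 ≤ C / δ := by
        rw [le_div_iff₀ hδ]; linarith
      refine le_max_of_le_right ?_
      nlinarith [sq_nonneg (‖vec 1 v‖ - 1)]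
    · have h1 := sq_norm_le_cj (vec (-1) v)
      rw [← emb_neg_lorO, hv.1, map_one] at h1
      refine le_max_of_le_left ?_
      exact (sq_le_one_iff₀ (norm_nonneg _)).1 h1

/-- Linear maps acting on the lattice and trivially on its quotient modulo `4`. -/
def IsCongr (g : Vec d → Vec d) : Prop :=
  ∀ v, ∃ w, g (vec 1 v) = vec 1 (v + (4 : Zsqrtd 2) • w)

lemma IsCongr.comp {g h : Vec d → Vec d} (hg : IsCongr g) (hh : IsCongr h) :
    IsCongr (fun x => g (h x)) := fun v => by
  obtain ⟨w, hw⟩ := hh v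
  obtain ⟨u, hu⟩ := hg (v + (4 : Zsqrtd 2) • w)
  exact ⟨w + u, by simp only [hw, hu, smul_add, add_assoc]⟩

/-- The congruence subgroup, without the condition on the time direction. -/
def congrGroup (d : ℕ) : Subgroup (Vec d ≃ₗ[ℝ] Vec d) where
  carrier := {g | (∀ x y, lor (g x) (g y) = lor x y) ∧ IsCongr g ∧ IsCongr g.symm}
  mul_mem' := by
    rintro g h ⟨h1, h2, h3⟩ ⟨h4, h5, h6⟩
    exact ⟨fun x y => by rw [LinearEquiv.mul_apply, LinearEquiv.mul_apply, h1, h4],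
      h2.comp h5, h6.comp h3⟩
  one_mem' := ⟨fun _ _ => rfl, fun v => ⟨0, by simp⟩, fun v => ⟨0, by rw [smul_zero, add_zero]; rfl⟩⟩
  inv_mem' := by
    rintro g ⟨h1, h2, h3⟩
    refine ⟨fun x y => ?_, h3, h2⟩
    have := h1 (g.symm x) (g.symm y)
    rw [g.apply_symm_apply, g.apply_symm_apply] at this
    exact this.symm

/-- The congruence subgroup. -/
def futGroup (d : ℕ) : Subgroup (Vec d ≃ₗ[ℝ] Vec d) where
  carrier := {g | g ∈ congrGroup d ∧ ∀ x, g x ∈ fut d ↔ x ∈ fut d}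
  mul_mem' := by
    rintro g h ⟨h1, h2⟩ ⟨h3, h4⟩
    exact ⟨mul_mem h1 h3, fun x => by rw [LinearEquiv.mul_apply, h2, h4]⟩
  one_mem' := ⟨one_mem _, fun _ => Iff.rfl⟩
  inv_mem' := by
    rintro g ⟨h1, h2⟩
    refine ⟨inv_mem h1, fun x => ?_⟩
    have := h2 (g.symm x)
    rw [g.apply_symm_apply] at this
    exact this.symm

lemma isRoot_of_map {g : Vec d → Vec d} (h1 : ∀ x y, lor (g x) (g y) = lor x y)
    (h2 : IsCongr g) {n : Vec d} (hn : n ∈ vec 1 '' {v : Fin (d + 1) → Zsqrtd 2 | IsRoot v}) :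
    g n ∈ vec 1 '' {v : Fin (d + 1) → Zsqrtd 2 | IsRoot v} := by
  obtain ⟨v, ⟨hv, x, hx⟩, rfl⟩ := hn
  obtain ⟨w, hw⟩ := h2 v
  refine ⟨_, ⟨?_, x + w, ?_⟩, hw.symm⟩
  · apply emb_injective 1
    rw [emb_lorO, ← hw, h1, ← emb_lorO, hv]
  · rw [hx, smul_add, add_assoc]

lemma isAut_of_mem (hd : 1 ≤ d) {g : Vec d ≃ₗ[ℝ] Vec d} (hg : g ∈ futGroup d) :
    IsAut (rootWalls hd) g where
  lor := hg.1.1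
  fut := hg.2
  wall n := by
    refine ⟨fun h => ?_, fun h => isRoot_of_map hg.1.1 hg.1.2.1 h⟩
    have : g.symm (g n) ∈ _ := isRoot_of_map (inv_mem hg.1).1 hg.1.2.2 h
    rwa [g.symm_apply_apply] at this

lemma vec_single (s : ℤˣ) (i : Fin (d + 1)) :
    vec s (Pi.single i 1) = Pi.single i (1 : ℝ) := by
  ext j
  by_cases h : j = i
  · subst h; simp [vec]
  · simp [vec, h]

lemma finite_futGroup {K : Set (Vec d)} (hK : IsCompact K) (hKf : K ⊆ fut d) :
    {g ∈ futGroup d | ∃ x ∈ K, g x ∈ K}.Finite := by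
  obtain ⟨δ, hδ, h⟩ := exists_sq_norm_le hK hKf
  let e : Fin (d + 1) → Fin (d + 1) → Zsqrtd 2 := fun i => Pi.single i 1
  obtain ⟨B, hB⟩ : ∃ B : ℝ, ∀ g ∈ futGroup d, (∃ x ∈ K, g x ∈ K) → ∀ i, ‖g (vec 1 (e i))‖ ≤ B := by
    have hc : ∀ i, ∃ C : ℝ, ∀ p ∈ K ×ˢ K,
        -lor p.1 p.1 * lor (vec 1 (e i)) (vec 1 (e i)) + 2 * lor p.2 (vec 1 (e i)) ^ 2 ≤ C :=
      fun i => (((hK.prod hK).image (f := fun p : Vec d × Vec d =>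
        -lor p.1 p.1 * lor (vec 1 (e i)) (vec 1 (e i)) + 2 * lor p.2 (vec 1 (e i)) ^ 2)
        (by fun_prop)).bddAbove).imp fun C hC p hp => hC ⟨p, hp, rfl⟩
    choose C hC using hc
    obtain ⟨M, hM⟩ := (Set.finite_range C).bddAbove
    refine ⟨M / δ + 1, fun g hg ⟨x, hx, hgx⟩ i => ?_⟩
    have h1 := h (g x) hgx (g (vec 1 (e i)))
    rw [hg.1.1, hg.1.1, hg.1.1] at h1
    have h2 := (hC i (x, x) ⟨hx, hx⟩).trans (hM ⟨i, rfl⟩)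
    have h3 : ‖g (vec 1 (e i))‖ ^ 2 ≤ M / δ := by
      rw [le_div_iff₀ hδ]; linarith
    nlinarith [sq_nonneg (‖g (vec 1 (e i))‖ - 1)]
  obtain ⟨B', hB'⟩ := (Set.finite_range fun i => cj (vec (-1) (e i)) (vec (-1) (e i))).bddAbove
  refine Set.Finite.of_finite_image (f := fun g : Vec d ≃ₗ[ℝ] Vec d => fun i => g (vec 1 (e i))) ?_ ?_
  · refine (Set.Finite.pi fun _ => (finite_vec_le (max B (B' + 1))).image (vec 1)).subset ?_
    rintro _ ⟨g, ⟨hg, hx⟩, rfl⟩ i _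
    obtain ⟨w, hw⟩ := hg.1.2.1 (e i)
    refine ⟨_, ⟨?_, ?_⟩, hw.symm⟩
    · rw [← hw]; exact (hB g hg hx i).trans (le_max_left _ _)
    · have h1 : lorO (e i + (4 : Zsqrtd 2) • w) (e i + (4 : Zsqrtd 2) • w) = lorO (e i) (e i) := by
        apply emb_injective 1
        rw [emb_lorO, ← hw, hg.1.1, ← emb_lorO]
      have h2 := sq_norm_le_cj (vec (-1) (e i + (4 : Zsqrtd 2) • w))
      rw [← emb_neg_lorO, h1, emb_neg_lorO] at h2
      have h3 := h2.trans (hB' ⟨i, rfl⟩)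
      refine le_max_of_le_right ?_
      nlinarith [sq_nonneg (‖vec (-1) (e i + (4 : Zsqrtd 2) • w)‖ - 1)]
  · intro g _ g' _ h
    apply LinearEquiv.toLinearMap_injective
    refine (Pi.basisFun ℝ (Fin (d + 1))).ext fun i => ?_
    have := congrFun h i
    simp only [e, vec_single] at this
    simpa using this

end BentDomain

namespace BentDomain
open Filter Topology

/-! ### Short vectors spanning the space -/

lemma exists_normalized_functional {ι : Type*} [Fintype ι] [DecidableEq ι]
    {f : (ι → ℝ) →ₗ[ℝ] ℝ} (hf : f ≠ 0) : ∃ ψ : (ι → ℝ) →ₗ[ℝ] ℝ, ∃ ν : ι → ℝ, ψ ν = 1 ∧ ‖ν‖ ≤ 1 ∧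
      (∀ y, |ψ y| ≤ Fintype.card ι * ‖y‖) ∧ ∀ y, f y = 0 → ψ y = 0 := by
  have hne : Nonempty ι := by
    by_contra h
    rw [not_nonempty_iff] at h
    exact hf (LinearMap.ext fun x => by rw [Subsingleton.elim x 0]; simp)
  obtain ⟨k, hk⟩ := Finite.exists_max fun i => |f (Pi.single i 1)|
  have h0 : f (Pi.single k 1) ≠ 0 := by
    intro h
    apply hf
    refine (Pi.basisFun ℝ ι).ext fun i => ?_
    have := hk i
    rw [h, abs_zero] at this
    simpa using abs_nonpos_iff.1 this
  refine ⟨(f (Pi.single k 1))⁻¹ • f, Pi.single k 1, ?_, ?_, fun y => ?_, fun y hy => ?_⟩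
  · simp [h0]
  · refine (pi_norm_le_iff_of_nonneg zero_le_one).2 fun i => ?_
    by_cases h : i = k
    · subst h; simp
    · simp [h]
  · have hy : f y = ∑ i, y i * f (Pi.single i 1) := by
      conv_lhs => rw [pi_eq_sum_univ' y]
      rw [map_sum]
      refine Finset.sum_congr rfl fun i _ => ?_
      rw [map_smul, smul_eq_mul]
    have : |f y| ≤ Fintype.card ι * ‖y‖ * |f (Pi.single k 1)| := by
      rw [hy]
      refine (Finset.abs_sum_le_sum_abs _ _).trans ?_
      have : ∀ i ∈ Finset.univ, |y i * f (Pi.single i 1)| ≤ ‖y‖ * |f (Pi.single k 1)| :=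
        fun i _ => by
          rw [abs_mul]
          exact mul_le_mul (norm_le_pi_norm y i) (hk i) (abs_nonneg _) (norm_nonneg _)
      refine (Finset.sum_le_card_nsmul _ _ _ this).trans_eq ?_
      rw [nsmul_eq_mul, mul_assoc, Finset.card_univ]
    rw [LinearMap.smul_apply, smul_eq_mul, abs_mul, abs_inv, inv_mul_le_iff₀ (abs_pos.2 h0)]
    linarith
  · simp [hy]

lemma exists_int_mem_ball {ι : Type*} [Fintype ι] [DecidableEq ι] {r : ℝ} (hr : 0 < r)
    (f : (ι → ℝ) →ₗ[ℝ] (ι → ℝ)) (hdet : LinearMap.det f ≠ 0)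
    (h : |LinearMap.det f| < r ^ Fintype.card ι) :
    ∃ z : ι → ℤ, z ≠ 0 ∧ ‖f (fun i => (z i : ℝ))‖ < r := by
  have hfund := ZSpan.isAddFundamentalDomain' (Pi.basisFun ℝ ι) MeasureTheory.volume
  have hcount : Countable (Submodule.span ℤ (Set.range (Pi.basisFun ℝ ι))).toAddSubgroup :=
    inferInstanceAs (Countable (Submodule.span ℤ (Set.range (Pi.basisFun ℝ ι))))
  obtain ⟨x, hx0, hx⟩ := MeasureTheory.exists_ne_zero_mem_lattice_of_measure_mul_two_pow_lt_measure
    (s := f ⁻¹' Metric.ball 0 r) hfund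
    (fun x hx => by simpa using hx)
    ((convex_ball 0 r).linear_preimage f) (by
      rw [MeasureTheory.Measure.addHaar_preimage_linearMap _ hdet,
        ZSpan.fundamentalDomain_pi_basisFun, MeasureTheory.volume_pi, MeasureTheory.Measure.pi_pi]
      rw [← MeasureTheory.volume_pi, Real.volume_pi_ball _ hr]
      simp only [Real.volume_Ico, sub_zero, ENNReal.ofReal_one, Finset.prod_const_one, one_mul,
        Module.finrank_fintype_fun_eq_card]
      rw [← ENNReal.ofReal_mul (abs_nonneg _), ← ENNReal.ofReal_ofNat 2,
        ← ENNReal.ofReal_pow (by norm_num), ENNReal.ofReal_lt_ofReal_iff_of_nonneg (by positivity),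
        mul_pow, abs_inv, inv_mul_eq_div, lt_div_iff₀ (abs_pos.2 hdet)]
      have : (0 : ℝ) < 2 ^ Fintype.card ι := by positivity
      nlinarith)
  have hmem := ((Pi.basisFun ℝ ι).mem_span_iff_repr_mem ℤ (x : ι → ℝ)).1 x.2
  choose z hz using hmem
  have hz : (fun i => (z i : ℝ)) = (x : ι → ℝ) := by
    ext i; simpa using hz i
  refine ⟨z, ?_, ?_⟩
  · rintro rfl
    apply hx0
    apply Subtype.ext
    rw [← hz]; ext i; simp
  · rw [hz]; simpa using hx

lemma exists_span_short {ι : Type*} [Fintype ι] [DecidableEq ι] {r D : ℝ} (hr : 0 < r)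
    (hD : 0 < D) : ∃ B : ℝ, ∀ g : (ι → ℝ) ≃ₗ[ℝ] (ι → ℝ), |LinearMap.det (g : (ι → ℝ) →ₗ[ℝ] (ι → ℝ))| = D →
      (∀ z : ι → ℤ, z ≠ 0 → r ≤ ‖g (fun i => (z i : ℝ))‖) →
      Submodule.span ℝ {y : ι → ℝ | ∃ z : ι → ℤ, y = (fun i => (z i : ℝ)) ∧ ‖g y‖ ≤ B} = ⊤ := by
  let t : ℝ := D / r ^ Fintype.card ι + 1
  have ht : 0 < t := by positivity
  refine ⟨r + (t + 1) * (Fintype.card ι * r), fun g hg hmin => ?_⟩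
  by_contra hne
  obtain ⟨f, hf, hle⟩ := Submodule.exists_le_ker_of_lt_top _ (lt_top_iff_ne_top.2 hne)
  have hf' : f.comp (g.symm : (ι → ℝ) →ₗ[ℝ] (ι → ℝ)) ≠ 0 := fun h => hf (LinearMap.ext fun x => by
    have := LinearMap.congr_fun h (g x)
    simpa using this)
  obtain ⟨ψ, ν, hψν, hν, hψ, hker⟩ := exists_normalized_functional hf'
  let T := LinearMap.transvection ((t⁻¹ - 1) • ψ) ν
  have hT : LinearMap.det T = t⁻¹ := by
    rw [LinearMap.transvection.det]; simp [hψν]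
  have hd : |LinearMap.det (T ∘ₗ (g : (ι → ℝ) →ₗ[ℝ] (ι → ℝ)))| = D / t := by
    rw [LinearMap.det_comp, abs_mul, hg, hT, abs_of_pos (inv_pos.2 ht), inv_mul_eq_div]
  obtain ⟨z, hz0, hz⟩ := exists_int_mem_ball hr (T ∘ₗ (g : (ι → ℝ) →ₗ[ℝ] (ι → ℝ)))
    (by rw [← abs_pos, hd]; positivity) (by
      rw [hd, div_lt_iff₀ ht]
      have : r ^ Fintype.card ι * t = D + r ^ Fintype.card ι := by
        simp only [t]; field_simp
      rw [this]; have : 0 < r ^ Fintype.card ι := by positivity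
      linarith)
  set y : ι → ℝ := fun i => (z i : ℝ) with hy
  set p := g y with hp
  have hTp : (T ∘ₗ (g : (ι → ℝ) →ₗ[ℝ] (ι → ℝ))) y = p + ((t⁻¹ - 1) * ψ p) • ν := by
    simp [T, LinearMap.transvection.apply, hp]
  rw [hTp] at hz
  set w := p + ((t⁻¹ - 1) * ψ p) • ν with hw
  have hψw : ψ p = t * ψ w := by
    rw [hw, map_add, map_smul, hψν, smul_eq_mul]; field_simp; ring
  have hpw : p = w + ((t - 1) * ψ w) • ν := by
    have : (t - 1) * ψ w = -((t⁻¹ - 1) * ψ p) := by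
      rw [hψw]; field_simp; ring
    rw [this, hw]; module
  have hle1 : |ψ w| ≤ Fintype.card ι * r :=
    (hψ w).trans (mul_le_mul_of_nonneg_left hz.le (by positivity))
  have hpB : ‖p‖ ≤ r + (t + 1) * (Fintype.card ι * r) := by
    rw [hpw]
    refine (norm_add_le _ _).trans (add_le_add hz.le ?_)
    rw [norm_smul, Real.norm_eq_abs, abs_mul]
    have h1 : |t - 1| ≤ t + 1 := by rw [abs_le]; constructor <;> linarith
    calc |t - 1| * |ψ w| * ‖ν‖ ≤ |t - 1| * |ψ w| * 1 := by gcongr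
      _ ≤ (t + 1) * (Fintype.card ι * r) := by
        rw [mul_one]; exact mul_le_mul h1 hle1 (abs_nonneg _) (by linarith)
  have hfy : f y = 0 := hle (Submodule.subset_span ⟨z, rfl, hpB⟩)
  have hψp : ψ p = 0 := hker p (by simpa [hp] using hfy)
  rw [hψp, eq_comm, mul_eq_zero, or_iff_right ht.ne'] at hψw
  rw [hψw, mul_zero, zero_smul, add_zero] at hpw
  have := hmin z hz0
  rw [← hy, ← hp, hpw] at this
  linarith

end BentDomain

namespace BentDomain
open Filter Topology Matrix
variable {d : ℕ}

/-! ### Bases of short lattice vectors -/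

lemma abs_sum_mul_le (x y : Vec d) :
    |∑ i : Fin d, x i.castSucc * y i.castSucc| ≤ d * (‖x‖ * ‖y‖) := by
  refine (Finset.abs_sum_le_sum_abs _ _).trans ?_
  have : ∀ i ∈ Finset.univ, |x (Fin.castSucc i) * y (Fin.castSucc i)| ≤ ‖x‖ * ‖y‖ :=
    fun (i : Fin d) _ => by
      rw [abs_mul]
      exact mul_le_mul (norm_le_pi_norm x _) (norm_le_pi_norm y _) (abs_nonneg _) (norm_nonneg _)
  refine (Finset.sum_le_card_nsmul _ _ _ this).trans_eq ?_
  rw [nsmul_eq_mul, Finset.card_univ, Fintype.card_fin]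

lemma abs_last_mul_le (x y : Vec d) :
    |√2 * (x (Fin.last d) * y (Fin.last d))| ≤ 2 * (‖x‖ * ‖y‖) := by
  have h : √2 ≤ 2 := Real.sqrt_le_iff.2 ⟨by norm_num, by norm_num⟩
  rw [abs_mul, abs_mul, abs_of_pos sqrt2_pos]
  exact mul_le_mul h (mul_le_mul (norm_le_pi_norm x _) (norm_le_pi_norm y _) (abs_nonneg _)
    (norm_nonneg _)) (by positivity) (by norm_num)

lemma abs_lor_le (x y : Vec d) : |lor x y| ≤ (d + 2) * (‖x‖ * ‖y‖) := by
  rw [lor_apply]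
  refine (abs_sub _ _).trans ?_
  linarith [abs_sum_mul_le x y, abs_last_mul_le x y]

lemma abs_cj_le (x y : Vec d) : |cj x y| ≤ (d + 2) * (‖x‖ * ‖y‖) := by
  rw [cj_apply]
  refine (abs_add_le _ _).trans ?_
  linarith [abs_sum_mul_le x y, abs_last_mul_le x y]

/-- The isometric involution fixing the line of `u`, equal to `-1` on its orthogonal. -/
noncomputable def halfTurn (u : Vec d) (hu : lor u u ≠ 0) : Vec d ≃ₗ[ℝ] Vec d :=
  LinearEquiv.ofInvolutive
    { toFun := fun v => (2 * lor u v / lor u u) • u - v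
      map_add' := fun v w => by rw [lor_add_right, mul_add, add_div]; module
      map_smul' := fun c v => by
        rw [lor_smul_right, RingHom.id_apply, mul_left_comm, mul_div_assoc]; module }
    (fun v => by
      change (2 * lor u ((2 * lor u v / lor u u) • u - v) / lor u u) • u
        - ((2 * lor u v / lor u u) • u - v) = v
      have : 2 * lor u ((2 * lor u v / lor u u) • u - v) / lor u u = 2 * lor u v / lor u u := by
        rw [lor_sub_right, lor_smul_right]; field_simp; ring
      rw [this]; module)

lemma halfTurn_apply (u : Vec d) (hu : lor u u ≠ 0) (v : Vec d) :
    halfTurn u hu v = (2 * lor u v / lor u u) • u - v := rfl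

lemma halfTurn_halfTurn (u : Vec d) (hu : lor u u ≠ 0) (v : Vec d) :
    halfTurn u hu (halfTurn u hu v) = v := (halfTurn u hu).left_inv v

lemma lor_halfTurn (u : Vec d) (hu : lor u u ≠ 0) (v w : Vec d) :
    lor (halfTurn u hu v) (halfTurn u hu w) = lor v w := by
  simp only [halfTurn_apply, lor_sub_left, lor_sub_right, lor_smul_left, lor_smul_right,
    lor_comm v u]
  field_simp; ring

lemma halfTurn_add {x y : Vec d} (hx : lor x x = -1) (hy : lor y y = -1)
    (h : lor (x + y) (x + y) ≠ 0) : halfTurn (x + y) h x = y := by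
  have h1 : lor (x + y) (x + y) = 2 * lor (x + y) x := by
    simp only [lor_add_left, lor_add_right, hx, hy, lor_comm y x]; ring
  rw [halfTurn_apply, ← h1, div_self h]; module

/-- The base point of the hyperboloid. -/
noncomputable def basePt (d : ℕ) : Vec d := Pi.single (Fin.last d) (√(√2))⁻¹

lemma lor_basePt : lor (basePt d) (basePt d) = -1 := by
  have h : √(√2) * √(√2) = √2 := Real.mul_self_sqrt sqrt2_pos.le
  have h2 : √(√2) ≠ 0 := (Real.sqrt_pos.2 sqrt2_pos).ne'
  have h3 : ∀ i : Fin d, basePt d i.castSucc = 0 := fun i => by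
    simp [basePt, (Fin.castSucc_lt_last i).ne]
  rw [lor_apply, Finset.sum_eq_zero fun i _ => by rw [h3, mul_zero]]
  simp only [basePt, Pi.single_eq_same]
  rw [← mul_inv, h, mul_inv_cancel₀ sqrt2_pos.ne']; norm_num

lemma basePt_mem : basePt d ∈ fut d :=
  ⟨by rw [lor_basePt]; norm_num, by
    simp only [basePt, Pi.single_eq_same]; exact inv_pos.2 (Real.sqrt_pos.2 sqrt2_pos)⟩

abbrev TwoIdx (d : ℕ) := Fin (d + 1) ⊕ Fin (d + 1)

/-- The two embeddings, in real coordinates. -/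
noncomputable def embEquiv (d : ℕ) : (TwoIdx d → ℝ) ≃ₗ[ℝ] (TwoIdx d → ℝ) where
  toFun y := Sum.elim (fun i => y (Sum.inl i) + y (Sum.inr i) * √2)
    (fun i => y (Sum.inl i) - y (Sum.inr i) * √2)
  map_add' x y := by ext (i | i) <;> simp <;> ring
  map_smul' c y := by ext (i | i) <;> simp <;> ring
  invFun y := Sum.elim (fun i => (y (Sum.inl i) + y (Sum.inr i)) / 2)
    (fun i => (y (Sum.inl i) - y (Sum.inr i)) / (2 * √2))
  left_inv y := by
    have := sqrt2_pos.ne'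
    ext (i | i)
    · simp
    · simp; field_simp; ring
  right_inv y := by
    have := sqrt2_pos.ne'
    ext (i | i)
    · simp; field_simp; ring
    · simp; field_simp; ring

/-- A lattice vector from its integral coordinates. -/
def ofInts (z : TwoIdx d → ℤ) : Fin (d + 1) → Zsqrtd 2 := fun i => ⟨z (Sum.inl i), z (Sum.inr i)⟩

lemma embEquiv_int (z : TwoIdx d → ℤ) :
    embEquiv d (fun i => (z i : ℝ)) = Sum.elim (vec 1 (ofInts z)) (vec (-1) (ofInts z)) := by
  ext (i | i) <;> simp [embEquiv, vec, ofInts, emb_one_apply, emb_neg_apply]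

/-- Act on the first factor only. -/
noncomputable def onFirst (g : Vec d ≃ₗ[ℝ] Vec d) : (TwoIdx d → ℝ) ≃ₗ[ℝ] (TwoIdx d → ℝ) :=
  (LinearEquiv.sumArrowLequivProdArrow _ _ ℝ ℝ).trans
    ((g.prodCongr (LinearEquiv.refl ℝ (Vec d))).trans
      (LinearEquiv.sumArrowLequivProdArrow _ _ ℝ ℝ).symm)

lemma onFirst_elim (g : Vec d ≃ₗ[ℝ] Vec d) (v w : Vec d) :
    onFirst g (Sum.elim v w) = Sum.elim (g v) w := by
  ext (i | i)
  · rfl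
  · rfl

lemma norm_sum_elim (v w : Vec d) (B : ℝ) :
    ‖(Sum.elim v w : TwoIdx d → ℝ)‖ ≤ B ↔ ‖v‖ ≤ B ∧ ‖w‖ ≤ B := by
  by_cases hB : 0 ≤ B
  · simp [pi_norm_le_iff_of_nonneg hB]
  · constructor
    · intro h; exact absurd ((norm_nonneg _).trans h) hB
    · intro h; exact absurd ((norm_nonneg _).trans h.1) hB

lemma abs_det_onFirst {g : Vec d ≃ₗ[ℝ] Vec d} (hg : ∀ v, g (g v) = v) :
    |LinearMap.det (onFirst g : (TwoIdx d → ℝ) →ₗ[ℝ] (TwoIdx d → ℝ))| = 1 := by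
  have h : (onFirst g : (TwoIdx d → ℝ) →ₗ[ℝ] (TwoIdx d → ℝ)) ∘ₗ (onFirst g).toLinearMap
      = LinearMap.id := by
    refine LinearMap.ext fun y => ?_
    obtain ⟨v, w, rfl⟩ : ∃ v w : Vec d, y = Sum.elim v w :=
      ⟨y ∘ Sum.inl, y ∘ Sum.inr, (Sum.elim_comp_inl_inr y).symm⟩
    simp [onFirst_elim, hg]
  have := congrArg LinearMap.det h
  rw [LinearMap.det_comp, LinearMap.det_id, ← sq] at this
  rw [← sq_abs] at this
  exact (pow_eq_one_iff_of_nonneg (abs_nonneg _) two_ne_zero).1 this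

lemma exists_short_basis (d : ℕ) : ∃ B : ℝ, ∀ x ∈ fut d, lor x x = -1 →
    ∃ g : Vec d ≃ₗ[ℝ] Vec d, (∀ v w, lor (g v) (g w) = lor v w) ∧ (∀ v, g (g v) = v) ∧
      g x = basePt d ∧ ∃ b : Fin (d + 1) → Fin (d + 1) → Zsqrtd 2,
        LinearIndependent ℝ (fun i => vec 1 (b i)) ∧
        ∀ i, ‖g (vec 1 (b i))‖ ≤ B ∧ ‖vec (-1) (b i)‖ ≤ B := by
  have hr : (0 : ℝ) < 1 / (d + 2) := by positivity
  obtain ⟨B, hB⟩ := exists_span_short (ι := TwoIdx d) hr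
    (abs_pos.2 (LinearEquiv.isUnit_det' (embEquiv d)).ne_zero)
  refine ⟨B, fun x hx hxx => ?_⟩
  have hu : lor (x + basePt d) (x + basePt d) ≠ 0 := (add_mem_fut hx basePt_mem).1.ne
  set g := halfTurn (x + basePt d) hu with hg
  have hgl : ∀ v w, lor (g v) (g w) = lor v w := lor_halfTurn _ hu
  have hgg : ∀ v, g (g v) = v := halfTurn_halfTurn _ hu
  refine ⟨g, hgl, hgg, halfTurn_add hxx lor_basePt hu, ?_⟩
  have happ : ∀ z : TwoIdx d → ℤ, ((embEquiv d).trans (onFirst g)) (fun i => (z i : ℝ))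
      = Sum.elim (g (vec 1 (ofInts z))) (vec (-1) (ofInts z)) := fun z => by
    rw [LinearEquiv.trans_apply, embEquiv_int, onFirst_elim]
  have hspan := hB ((embEquiv d).trans (onFirst g)) (by
    rw [LinearEquiv.coe_trans, LinearMap.det_comp, abs_mul, abs_det_onFirst hgg, one_mul]) (by
    intro z hz
    by_contra! hlt
    rw [happ] at hlt
    obtain ⟨h1, h2⟩ := (norm_sum_elim _ _ _).1 le_rfl (a := _) |>.imp
      (fun h => h.trans_lt hlt) (fun h => h.trans_lt hlt)
    have small : ∀ v : Vec d, ‖v‖ < 1 / (d + 2) → (d + 2) * (‖v‖ * ‖v‖) < 1 := fun v hv => by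
      have h3 : (0 : ℝ) < d + 2 := by positivity
      rw [lt_div_iff₀ h3] at hv
      have h4 : (1 : ℝ) ≤ d + 2 := by linarith [(Nat.cast_nonneg d : (0 : ℝ) ≤ d)]
      have h5 := norm_nonneg v
      nlinarith
    have h3 : lorO (ofInts z) (ofInts z) = 0 := eq_zero_of_abs_emb_lt (by
        rw [emb_lorO, ← hgl]
        exact (abs_lor_le _ _).trans_lt (small _ h1)) (by
        rw [emb_neg_lorO]
        exact (abs_cj_le _ _).trans_lt (small _ h2))
    have h4 : vec (-1) (ofInts z) = 0 := eq_zero_of_cj (by rw [← emb_neg_lorO, h3, map_zero])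
    apply hz
    ext i
    have h5 : ∀ j, ofInts z j = 0 := fun j => emb_injective (-1) (by
      rw [map_zero]; exact congrFun h4 j)
    rcases i with i | i
    · exact congrArg Zsqrtd.re (h5 i)
    · exact congrArg Zsqrtd.im (h5 i))
  let pr : (TwoIdx d → ℝ) →ₗ[ℝ] Vec d := LinearMap.funLeft ℝ ℝ Sum.inl
  let s : Set (Vec d) := {y | ∃ v, y = vec 1 v ∧ ‖g (vec 1 v)‖ ≤ B ∧ ‖vec (-1) v‖ ≤ B}
  have hs : Submodule.span ℝ s = ⊤ := by
    rw [eq_top_iff]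
    have h1 : Submodule.map (pr ∘ₗ (embEquiv d).toLinearMap) ⊤ = ⊤ := by
      rw [Submodule.map_top, LinearMap.range_eq_top]
      intro v
      refine ⟨(embEquiv d).symm (Sum.elim v 0), ?_⟩
      simp only [LinearMap.comp_apply, LinearEquiv.coe_coe, LinearEquiv.apply_symm_apply]
      rfl
    rw [← h1, ← hspan, Submodule.map_span]
    refine Submodule.span_mono ?_
    rintro _ ⟨y, ⟨z, rfl, hz⟩, rfl⟩
    rw [happ, norm_sum_elim] at hz
    refine ⟨ofInts z, ?_, hz⟩
    simp only [LinearMap.comp_apply, LinearEquiv.coe_coe, embEquiv_int]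
    rfl
  obtain ⟨f, hf, -, hli⟩ := Submodule.exists_fun_fin_finrank_span_eq ℝ s
  have hfin : Module.finrank ℝ (Submodule.span ℝ s) = d + 1 := by
    rw [hs, finrank_top]; simp
  choose b hb using hf
  refine ⟨fun i => b (Fin.cast hfin.symm i), ?_, fun i => (hb _).2⟩
  have : (fun i => vec 1 (b (Fin.cast hfin.symm i))) = f ∘ Fin.cast hfin.symm :=
    funext fun i => (hb _).1.symm
  rw [this]
  exact hli.comp _ (Fin.cast_injective _)

/-! ### Isometries matching two bases of short vectors -/

/-- A family of lattice vectors which generates `Q` times the lattice. -/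
def Generates (Q : ℕ) (b : Fin (d + 1) → Fin (d + 1) → Zsqrtd 2) : Prop :=
  ∀ v, ∃ c : Fin (d + 1) → Zsqrtd 2, (Q : Zsqrtd 2) • v = ∑ i, c i • b i

lemma isCongr_of_generates {Q : ℕ} (hQ : Q ≠ 0) {b b' m : Fin (d + 1) → Fin (d + 1) → Zsqrtd 2}
    (hb : Generates Q b) (hm : ∀ i, b' i = b i + (4 * Q : Zsqrtd 2) • m i)
    {g : Vec d ≃ₗ[ℝ] Vec d} (hg : ∀ i, g (vec 1 (b i)) = vec 1 (b' i)) : IsCongr g := by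
  intro v
  obtain ⟨c, hc⟩ := hb v
  refine ⟨∑ i, c i • m i, ?_⟩
  have hQ' : (Q : ℝ) ≠ 0 := Nat.cast_ne_zero.2 hQ
  have h1 : (Q : Zsqrtd 2) • (v + (4 : Zsqrtd 2) • ∑ i, c i • m i) = ∑ i, c i • b' i := by
    simp only [hm, smul_add, hc, Finset.smul_sum, Finset.sum_add_distrib]
    congr 1
    refine Finset.sum_congr rfl fun i _ => ?_
    simp only [smul_smul]
    congr 1; ring
  have h2 := congrArg (vec 1) h1
  have h3 := congrArg g (congrArg (vec 1) hc)
  simp only [vec_sum, vec_smul, map_natCast, map_sum, map_smul, hg] at h2 h3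
  rw [← h3] at h2
  exact (smul_right_injective _ hQ' h2).symm

lemma exists_congr_map {Q : ℕ} (hQ : Q ≠ 0) {b b' m : Fin (d + 1) → Fin (d + 1) → Zsqrtd 2}
    (hli : LinearIndependent ℝ fun i => vec 1 (b i))
    (hli' : LinearIndependent ℝ fun i => vec 1 (b' i))
    (hb : Generates Q b) (hb' : Generates Q b') (hm : ∀ i, b' i = b i + (4 * Q : Zsqrtd 2) • m i)
    (hgram : ∀ i j, lorO (b i) (b j) = lorO (b' i) (b' j)) :
    ∃ g ∈ congrGroup d, ∀ i, g (vec 1 (b i)) = vec 1 (b' i) := by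
  have hcard : Fintype.card (Fin (d + 1)) = Module.finrank ℝ (Vec d) := by simp
  let β := basisOfLinearIndependentOfCardEqFinrank hli hcard
  let β' := basisOfLinearIndependentOfCardEqFinrank hli' hcard
  have e : ∀ i, β i = vec 1 (b i) := fun i => by simp [β]
  have e' : ∀ i, β' i = vec 1 (b' i) := fun i => by simp [β']
  let g := β.equiv β' (Equiv.refl _)
  have hg : ∀ i, g (vec 1 (b i)) = vec 1 (b' i) := fun i => by
    rw [← e, ← e', Module.Basis.equiv_apply]; rfl
  have hg' : ∀ i, g.symm (vec 1 (b' i)) = vec 1 (b i) := fun i => by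
    rw [← hg, g.symm_apply_apply]
  refine ⟨g, ⟨fun x y => ?_, isCongr_of_generates hQ hb hm hg,
    isCongr_of_generates (m := fun i => -m i) hQ hb' (fun i => by rw [hm, smul_neg]; abel) hg'⟩, hg⟩
  have : lor.compl₁₂ g.toLinearMap g.toLinearMap = (lor : Vec d →ₗ[ℝ] Vec d →ₗ[ℝ] ℝ) := by
    refine β.ext fun i => β.ext fun j => ?_
    simp only [LinearMap.compl₁₂_apply, LinearEquiv.coe_coe, e, hg, ← emb_lorO, hgram]
  exact LinearMap.congr_fun (LinearMap.congr_fun this x) y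

lemma emb_mul_emb (a : Zsqrtd 2) : emb 1 a * emb (-1) a = a.norm := by
  rw [emb_one_apply, emb_neg_apply, Zsqrtd.norm_def]
  push_cast
  have : √2 * √2 = (2 : ℝ) := Real.mul_self_sqrt (by norm_num)
  linear_combination -(a.im : ℝ) ^ 2 * this

lemma generates_of_norm_dvd {Q : ℕ} {b : Fin (d + 1) → Fin (d + 1) → Zsqrtd 2}
    (h : (Matrix.of b).det.norm ∣ Q) : Generates Q b := by
  intro v
  obtain ⟨k, hk⟩ := h
  let M := Matrix.of b
  refine ⟨((k : Zsqrtd 2) * star M.det) • (v ᵥ* M.adjugate), ?_⟩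
  have h1 : (v ᵥ* M.adjugate) ᵥ* M = M.det • v := by
    rw [Matrix.vecMul_vecMul, Matrix.adjugate_mul, Matrix.vecMul_smul, Matrix.vecMul_one]
  have h2 : ∑ i, (((k : Zsqrtd 2) * star M.det) • (v ᵥ* M.adjugate)) i • b i
      = (((k : Zsqrtd 2) * star M.det) • (v ᵥ* M.adjugate)) ᵥ* M :=
    (Matrix.vecMul_eq_sum _ _).symm
  rw [h2, Matrix.smul_vecMul, h1, smul_smul]
  congr 1
  have h3 : ((Q : ℤ) : Zsqrtd 2) = M.det * star M.det * k := by
    rw [hk, Int.cast_mul, Zsqrtd.norm_eq_mul_conj]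
  rw [Int.cast_natCast] at h3
  rw [h3]; ring

lemma emb_det (s : ℤˣ) (b : Fin (d + 1) → Fin (d + 1) → Zsqrtd 2) :
    emb s (Matrix.of b).det = (Matrix.of fun i => vec s (b i)).det := by
  rw [RingHom.map_det]; rfl

lemma abs_det_le {v : Fin (d + 1) → Vec d} {B : ℝ} (h : ∀ i, ‖v i‖ ≤ B) :
    |(Matrix.of v).det| ≤ (d + 1).factorial * B ^ (d + 1) := by
  have := Matrix.det_le (A := Matrix.of v) (abv := AbsoluteValue.abs) (x := B)
    fun i j => (norm_le_pi_norm (v i) j).trans (h i)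
  simpa using this

lemma abs_det_map {g : Vec d ≃ₗ[ℝ] Vec d} (hg : ∀ v, g (g v) = v) (v : Fin (d + 1) → Vec d) :
    |(Matrix.of fun i => g (v i)).det| = |(Matrix.of v).det| := by
  let G := LinearMap.toMatrix' (g : Vec d →ₗ[ℝ] Vec d)
  have h1 : (Matrix.of fun i => g (v i)) = Matrix.of v * Gᵀ := by
    ext i j
    have : g (v i) = G *ᵥ v i := by
      rw [LinearMap.toMatrix'_mulVec]; rfl
    simp only [Matrix.of_apply, this, Matrix.mul_apply, Matrix.mulVec, dotProduct,
      Matrix.transpose_apply, mul_comm]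
  have h2 : G * G = 1 := by
    rw [← LinearMap.toMatrix'_comp, ← LinearMap.toMatrix'_id]
    congr 1
    exact LinearMap.ext fun v => hg v
  have h3 : |G.det| = 1 := by
    have := congrArg Matrix.det h2
    rw [Matrix.det_mul, Matrix.det_one, ← sq, ← sq_abs] at this
    exact (pow_eq_one_iff_of_nonneg (abs_nonneg _) two_ne_zero).1 this
  rw [h1, Matrix.det_mul, Matrix.det_transpose, abs_mul, h3, mul_one]

lemma exists_generating_basis (d : ℕ) : ∃ B : ℝ, ∃ Q : ℕ, Q ≠ 0 ∧ ∀ x ∈ fut d, lor x x = -1 →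
    ∃ b : Fin (d + 1) → Fin (d + 1) → Zsqrtd 2, LinearIndependent ℝ (fun i => vec 1 (b i)) ∧
      Generates Q b ∧ (∀ i, |lor x (vec 1 (b i))| ≤ B) ∧
      ∀ i j, |emb 1 (lorO (b i) (b j))| ≤ B ∧ |emb (-1) (lorO (b i) (b j))| ≤ B := by
  obtain ⟨B, h⟩ := exists_short_basis d
  let D : ℝ := (d + 1).factorial * B ^ (d + 1)
  refine ⟨max ((d + 2) * (‖basePt d‖ * B)) ((d + 2) * (B * B)), (⌈D * D⌉₊).factorial,
    Nat.factorial_ne_zero _, fun x hx hxx => ?_⟩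
  obtain ⟨g, hgl, hgg, hgx, b, hli, hb⟩ := h x hx hxx
  have hB : 0 ≤ B := (norm_nonneg _).trans (hb 0).1
  refine ⟨b, hli, generates_of_norm_dvd ?_, fun i => le_max_of_le_left ?_, fun i j =>
    ⟨le_max_of_le_right ?_, le_max_of_le_right ?_⟩⟩
  · have h1 : |emb 1 (Matrix.of b).det| ≤ D := by
      rw [emb_det, ← abs_det_map hgg]
      exact abs_det_le fun i => (hb i).1
    have h2 : |emb (-1) (Matrix.of b).det| ≤ D := by
      rw [emb_det]; exact abs_det_le fun i => (hb i).2
    have h3 : |((Matrix.of b).det.norm : ℝ)| ≤ D * D := by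
      rw [← emb_mul_emb, abs_mul]
      exact mul_le_mul h1 h2 (abs_nonneg _) ((abs_nonneg _).trans h1)
    have h4 : (Matrix.of b).det.norm.natAbs ≤ ⌈D * D⌉₊ := by
      have : (((Matrix.of b).det.norm.natAbs : ℕ) : ℝ) ≤ ⌈D * D⌉₊ := by
        rw [Nat.cast_natAbs, Int.cast_abs]; exact h3.trans (Nat.le_ceil _)
      exact_mod_cast this
    have h5 : (Matrix.of b).det.norm ≠ 0 := by
      intro h0
      have h6 : emb 1 (Matrix.of b).det ≠ 0 := by
        rw [emb_det]
        exact ((Matrix.isUnit_iff_isUnit_det _).1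
          (Matrix.linearIndependent_rows_iff_isUnit.1 hli)).ne_zero
      have h7 : (Matrix.of b).det ≠ 0 := fun h => h6 (by rw [h, map_zero])
      have h8 := emb_mul_emb (Matrix.of b).det
      rw [h0, Int.cast_zero, mul_eq_zero, or_iff_right h6, ← map_zero (emb (-1))] at h8
      exact h7 (emb_injective _ h8)
    rw [← Int.natAbs_dvd, Int.natCast_dvd_natCast]
    exact Nat.dvd_factorial (Int.natAbs_pos.2 h5) h4
  · rw [← hgl, hgx]
    exact (abs_lor_le _ _).trans (by have := (hb i).1; gcongr)
  · rw [emb_lorO, ← hgl]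
    exact (abs_lor_le _ _).trans (by have := (hb i).1; have := (hb j).1; gcongr)
  · rw [emb_neg_lorO]
    exact (abs_cj_le _ _).trans (by have := (hb i).2; have := (hb j).2; gcongr)

end BentDomain

namespace BentDomain
open Filter Topology
variable {d : ℕ}

/-! ### Cocompactness of the lattice -/

lemma eq_zero_of_lor {y : Vec d} (h : ∀ v, lor y v = 0) : y = 0 := by
  have key : ∀ i, y i = 0 := by
    intro i
    have := h (Pi.single i 1)
    rw [lor_apply] at this
    induction i using Fin.lastCases with
    | last =>
      rw [Finset.sum_eq_zero fun j _ => by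
        rw [Pi.single_eq_of_ne (Fin.castSucc_lt_last j).ne, mul_zero]] at this
      simpa [sqrt2_pos.ne'] using this
    | cast j =>
      rw [Finset.sum_eq_single j (fun k _ hk => by
        rw [Pi.single_eq_of_ne (fun h => hk (Fin.castSucc_injective _ h)), mul_zero])
        (fun h => absurd (Finset.mem_univ _) h)] at this
      simpa [(Fin.castSucc_lt_last j).ne'] using this
  exact funext key

lemma isCompact_lor_le {b : Fin (d + 1) → Vec d} (hb : LinearIndependent ℝ b) (B : ℝ) :
    IsCompact {y : Vec d | lor y y = -1 ∧ ∀ i, |lor y (b i)| ≤ B} := by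
  let T : Vec d →ₗ[ℝ] Vec d := LinearMap.pi fun i => lor.flip (b i)
  have hT : ∀ y i, T y i = lor y (b i) := fun _ _ => rfl
  have hinj : Function.Injective T := by
    rw [← LinearMap.ker_eq_bot, LinearMap.ker_eq_bot']
    intro y hy
    refine eq_zero_of_lor fun v => ?_
    have h0 : lor y = 0 := by
      refine (basisOfLinearIndependentOfCardEqFinrank hb (by simp)).ext fun i => ?_
      simpa [hT] using congrFun hy i
    rw [h0]; rfl
  let e := (LinearEquiv.ofInjectiveEndo T hinj).toContinuousLinearEquiv.toHomeomorph
  have he : ∀ y, e y = T y := fun _ => rfl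
  have h1 : IsCompact (e ⁻¹' Metric.closedBall 0 (max B 0)) :=
    e.isCompact_preimage.2 (isCompact_closedBall _ _)
  refine h1.of_isClosed_subset ?_ ?_
  · have h2 : IsClosed {y : Vec d | lor y y = -1} := isClosed_eq (by fun_prop) continuous_const
    have h3 : IsClosed {y : Vec d | ∀ i, |lor y (b i)| ≤ B} := by
      simp only [Set.ofPred_forall]
      exact isClosed_iInter fun i => isClosed_le (by fun_prop) continuous_const
    exact h2.inter h3
  · intro y hy
    rw [Set.mem_preimage, mem_closedBall_zero_iff, he,
      pi_norm_le_iff_of_nonneg (le_max_right _ _)]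
    intro i
    exact (hy.2 i).trans (le_max_left _ _)

lemma isCompact_inter_fut {K : Set (Vec d)} (hK : IsCompact K) (h : ∀ x ∈ K, lor x x = -1) :
    IsCompact (K ∩ fut d) := by
  have : K ∩ fut d = K ∩ {x | 0 ≤ x (Fin.last d)} := by
    ext x
    refine and_congr_right fun hx => ⟨fun h => h.2.le, fun h0 => ?_⟩
    have hlt : lor x x < 0 := by rw [h x hx]; norm_num
    rcases mem_fut_or_neg_mem hlt with h1 | h1
    · exact h1
    · have h2 := h1.2
      have h0 : 0 ≤ x (Fin.last d) := h0
      rw [Pi.neg_apply] at h2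
      linarith
  rw [this]
  exact hK.inter_right (isClosed_le continuous_const (continuous_apply _))

lemma finite_residues (m : ℕ) [NeZero m] : ∃ ρ : Zsqrtd 2 → ZMod m × ZMod m,
    ∀ a b, ρ a = ρ b → ∃ c, b = a + (m : Zsqrtd 2) * c := by
  refine ⟨fun a => ((a.re : ZMod m), (a.im : ZMod m)), fun a b h => ?_⟩
  obtain ⟨h1, h2⟩ := Prod.ext_iff.1 h
  obtain ⟨p, hp⟩ := ((ZMod.intCast_eq_intCast_iff_dvd_sub _ _ _).1 h1)
  obtain ⟨q, hq⟩ := ((ZMod.intCast_eq_intCast_iff_dvd_sub _ _ _).1 h2)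
  refine ⟨⟨p, q⟩, ?_⟩
  ext
  · simp; linarith
  · simp; linarith

lemma exists_compact_congrGroup (d : ℕ) : ∃ K : Set (Vec d), IsCompact K ∧
    (∀ x ∈ K, lor x x = -1) ∧ ∀ x ∈ fut d, lor x x = -1 → ∃ g ∈ congrGroup d, g x ∈ K := by
  obtain ⟨B, Q, hQ, h⟩ := exists_generating_basis d
  let H := {x : Vec d // x ∈ fut d ∧ lor x x = -1}
  have h : ∀ x : H, _ := fun x => h x.1 x.2.1 x.2.2
  choose b hli hgen hB hG using h
  have : NeZero (4 * Q) := ⟨by positivity⟩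
  obtain ⟨ρ, hρ⟩ := finite_residues (4 * Q)
  let T : H → (Fin (d + 1) → Fin (d + 1) → Zsqrtd 2) ×
      (Fin (d + 1) → Fin (d + 1) → ZMod (4 * Q) × ZMod (4 * Q)) := fun x =>
    (fun i j => lorO (b x i) (b x j), fun i j => ρ (b x i j))
  have hfin : (Set.range T).Finite := by
    refine ((Set.Finite.pi fun _ => Set.Finite.pi fun _ => finite_emb_le B).prod
      (Set.toFinite Set.univ)).subset ?_
    rintro _ ⟨x, rfl⟩
    exact ⟨fun i _ j _ => hG x i j, Set.mem_univ _⟩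
  have hrep : ∀ t, ∃ K : Set (Vec d), IsCompact K ∧ (∀ x ∈ K, lor x x = -1) ∧
      ∀ x : H, T x = t → ∃ g ∈ congrGroup d, g x ∈ K := by
    intro t
    by_cases ht : ∃ y, T y = t
    · obtain ⟨y, hy⟩ := ht
      refine ⟨_, isCompact_lor_le (hli y) B, fun x hx => hx.1, fun x hx => ?_⟩
      have hxy : T x = T y := hx.trans hy.symm
      have h1 : ∀ i j, lorO (b x i) (b x j) = lorO (b y i) (b y j) := fun i j =>
        congrFun (congrFun (congrArg Prod.fst hxy) i) j
      have h2 : ∀ i j, ∃ c, b y i j = b x i j + ((4 * Q : ℕ) : Zsqrtd 2) * c := fun i j =>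
        hρ _ _ (congrFun (congrFun (congrArg Prod.snd hxy) i) j)
      choose m hm using h2
      obtain ⟨g, hg, hgb⟩ := exists_congr_map hQ (m := m) (hli x) (hli y) (hgen x) (hgen y)
        (fun i => funext fun j => by
          rw [hm]; simp) h1
      refine ⟨g, hg, by rw [hg.1]; exact x.2.2, fun i => ?_⟩
      rw [← hgb, hg.1]
      exact hB x i
    · exact ⟨∅, isCompact_empty, by simp, fun x hx => absurd ⟨x, hx⟩ ht⟩
  choose K hK hK1 hK2 using hrep
  refine ⟨⋃ t ∈ Set.range T, K t, hfin.isCompact_biUnion fun t _ => hK t, ?_, fun x hx hxx => ?_⟩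
  · intro x hx
    simp only [Set.mem_iUnion] at hx
    obtain ⟨t, -, hx⟩ := hx
    exact hK1 t x hx
  · obtain ⟨g, hg, hgx⟩ := hK2 _ ⟨x, hx, hxx⟩ rfl
    exact ⟨g, hg, Set.mem_biUnion ⟨_, rfl⟩ hgx⟩

lemma mem_futGroup_of {g : Vec d ≃ₗ[ℝ] Vec d} (hg : g ∈ congrGroup d) {x : Vec d}
    (hx : x ∈ fut d) (hgx : g x ∈ fut d) : g ∈ futGroup d := by
  have key : ∀ (g : Vec d ≃ₗ[ℝ] Vec d), g ∈ congrGroup d → ∀ x ∈ fut d, g x ∈ fut d →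
      ∀ y ∈ fut d, g y ∈ fut d := by
    intro g hg x hx hgx y hy
    refine mem_fut_of_lor_nonpos (x := g x) (by rw [hg.1]; exact hy.1) hgx ?_
    rw [hg.1]; exact (lor_neg_of_mem_fut hy hx).le
  refine ⟨hg, fun y => ⟨fun h => ?_, key g hg x hx hgx y⟩⟩
  have := key g.symm (inv_mem hg) (g x) hgx (by rwa [g.symm_apply_apply]) (g y) h
  rwa [g.symm_apply_apply] at this

lemma exists_compact_futGroup (d : ℕ) : ∃ K ⊆ fut d, IsCompact K ∧ (∀ x ∈ K, lor x x = -1) ∧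
    ∀ x ∈ fut d, lor x x = -1 → ∃ g ∈ futGroup d, g x ∈ K := by
  obtain ⟨K, hK, hK1, hK2⟩ := exists_compact_congrGroup d
  have hneg : ∀ g ∈ congrGroup d, ∀ x ∈ fut d, g x ∉ fut d → -g x ∈ fut d := fun g hg x hx h =>
    (mem_fut_or_neg_mem (by rw [hg.1]; exact hx.1)).resolve_left h
  by_cases hflip : ∃ τ ∈ congrGroup d, ∃ x ∈ fut d, τ x ∉ fut d
  · obtain ⟨τ, hτ, z, hz, hτz⟩ := hflip
    have hτK : IsCompact (τ '' K) := hK.image (LinearMap.continuous_of_finiteDimensional τ.toLinearMap)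
    have hflip : ∀ y, -y ∈ fut d → τ y ∈ fut d := by
      intro y hy
      by_contra hn
      have h1 : τ (-y) ∈ fut d := by
        rw [map_neg]
        exact (mem_fut_or_neg_mem (by rw [hτ.1]; simpa using hy.1)).resolve_left hn
      exact hτz (((mem_futGroup_of hτ hy h1).2 z).2 hz)
    have h1 : ∀ x ∈ K ∪ τ '' K, lor x x = -1 := by
      rintro x (hx | ⟨y, hy, rfl⟩)
      · exact hK1 x hx
      · rw [hτ.1]; exact hK1 y hy
    refine ⟨(K ∪ τ '' K) ∩ fut d, Set.inter_subset_right, isCompact_inter_fut (hK.union hτK) h1,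
      fun x hx => h1 x hx.1, fun x hx hxx => ?_⟩
    obtain ⟨g, hg, hgx⟩ := hK2 x hx hxx
    by_cases h : g x ∈ fut d
    · exact ⟨g, mem_futGroup_of hg hx h, Or.inl hgx, h⟩
    · have h2 := hflip _ (hneg g hg x hx h)
      exact ⟨τ * g, mem_futGroup_of (mul_mem hτ hg) hx h2, Or.inr ⟨_, hgx, rfl⟩, h2⟩
  · push Not at hflip
    refine ⟨K ∩ fut d, Set.inter_subset_right, isCompact_inter_fut hK hK1, fun x hx => hK1 x hx.1,
      fun x hx hxx => ?_⟩
    obtain ⟨g, hg, hgx⟩ := hK2 x hx hxx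
    have h := hflip g hg x hx
    exact ⟨g, mem_futGroup_of hg hx h, hgx, h⟩

end BentDomain

namespace BentDomain
open Filter Topology
variable {d : ℕ}

/-! ### Explicit walls -/

/-- Roots in the plane of the first and last coordinates. -/
def planeVec (a b : Zsqrtd 2) : Fin (d + 1) → Zsqrtd 2 := Pi.single 0 a + Pi.single (Fin.last d) b

lemma lorO_planeVec (hd : 1 ≤ d) (a b a' b' : Zsqrtd 2) :
    lorO (planeVec a b : Fin (d + 1) → Zsqrtd 2) (planeVec a' b') = a * a' - ⟨0, 1⟩ * (b * b') := by
  obtain ⟨k, rfl⟩ : ∃ k, d = k + 1 := ⟨d - 1, by omega⟩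
  have h0 : Fin.last (k + 1) ≠ 0 := by simp [Fin.ext_iff]
  have h1 : ∀ i : Fin (k + 1), (i.castSucc : Fin (k + 2)) ≠ Fin.last (k + 1) :=
    fun i => (Fin.castSucc_lt_last i).ne
  simp [lorO, planeVec, h0, h1, Pi.single_apply]

lemma vec_planeVec (s : ℤˣ) (a b : Zsqrtd 2) : vec s (planeVec a b : Fin (d + 1) → Zsqrtd 2)
    = Pi.single 0 (emb s a) + Pi.single (Fin.last d) (emb s b) := by
  have h : ∀ (i : Fin (d + 1)) a, vec s (Pi.single i a) = Pi.single i (emb s a) := fun i a => by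
    ext j
    by_cases h : j = i
    · subst h; simp [vec]
    · simp [vec, h]
  rw [planeVec, vec_add, h, h]

lemma isRoot_planeVec (hd : 1 ≤ d) {a b : Zsqrtd 2} (h : a * a - ⟨0, 1⟩ * (b * b) = 1)
    (ha : ∃ c, a = 1 + 4 * c) (hb : ∃ c, b = 4 * c) :
    IsRoot (planeVec a b : Fin (d + 1) → Zsqrtd 2) := by
  obtain ⟨c, rfl⟩ := ha
  obtain ⟨c', rfl⟩ := hb
  refine ⟨by rw [lorO_planeVec hd, h], planeVec c c', ?_⟩
  rw [planeVec, planeVec, Pi.single_add, smul_add, ← Pi.single_smul, ← Pi.single_smul, smul_eq_mul,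
    smul_eq_mul, add_assoc]

lemma basePt_eq (d : ℕ) : basePt d
    = (√(√2))⁻¹ • vec 1 (planeVec 0 1 : Fin (d + 1) → Zsqrtd 2) := by
  rw [vec_planeVec, map_zero, map_one, Pi.single_zero, zero_add, ← Pi.single_smul, smul_eq_mul,
    mul_one, basePt]

lemma exists_walls (hd : 1 ≤ d) : ∃ n ∈ (rootWalls hd).S, ∃ n₁ ∈ (rootWalls hd).S,
    ∃ n₂ ∈ (rootWalls hd).S, ∃ y₁ ∈ fut d, ∃ y₂ ∈ fut d, lor n (basePt d) = 0 ∧ lor n₁ y₁ = 0 ∧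
      lor n₂ y₂ = 0 ∧ 0 < lor n y₁ ∧ lor n y₂ < 0 := by
  let α : Zsqrtd 2 := ⟨33, 24⟩
  let β : Zsqrtd 2 := ⟨28, 20⟩
  have r0 : IsRoot (planeVec 1 0 : Fin (d + 1) → Zsqrtd 2) :=
    isRoot_planeVec hd (by ext <;> simp) ⟨0, by simp⟩ ⟨0, by simp⟩
  have rs : ∀ b, b = β ∨ b = -β → IsRoot (planeVec α b : Fin (d + 1) → Zsqrtd 2) := fun b hb =>
    isRoot_planeVec hd (by rcases hb with rfl | rfl <;> decide) ⟨⟨8, 6⟩, by decide⟩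
      (by
        rcases hb with rfl | rfl
        · exact ⟨⟨7, 5⟩, by decide⟩
        · exact ⟨-⟨7, 5⟩, by decide⟩)
  have hs : (0 : ℝ) < (√(√2))⁻¹ := inv_pos.2 (Real.sqrt_pos.2 sqrt2_pos)
  have hα : 0 < emb 1 α := by rw [emb_one_apply]; simp only [α]; positivity
  have hβ : 0 < emb 1 β := by rw [emb_one_apply]; simp only [β]; positivity
  have hl : ∀ a b, lor (vec 1 (planeVec a b)) (basePt d) = -((√(√2))⁻¹ * (√2 * emb 1 b)) := by
    intro a b
    have : emb 1 (⟨0, 1⟩ : Zsqrtd 2) = √2 := by simp [emb_one_apply]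
    rw [basePt_eq, lor_smul_right, ← emb_lorO, lorO_planeVec hd]
    simp [this]
  have hn : ∀ b, lor (vec 1 (planeVec 1 0 : Fin (d + 1) → Zsqrtd 2)) (vec 1 (planeVec α b))
      = emb 1 α := fun b => by
    rw [← emb_lorO, lorO_planeVec hd]; simp
  have hu : ∀ v : Fin (d + 1) → Zsqrtd 2, IsRoot v → lor (vec 1 v) (vec 1 v) = 1 := fun v hv =>
    (rootWalls hd).unit _ ⟨v, hv, rfl⟩
  have r1 := rs β (Or.inl rfl)
  have r2 := rs (-β) (Or.inr rfl)
  refine ⟨_, ⟨_, r0, rfl⟩, _, ⟨_, r1, rfl⟩, _, ⟨_, r2, rfl⟩, _,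
    proj_mem_fut (hu _ r1) basePt_mem, _, proj_mem_fut (hu _ r2) basePt_mem, by rw [hl]; simp,
    lor_proj (hu _ r1) _, lor_proj (hu _ r2) _, ?_, ?_⟩
  · rw [proj_apply, lor_sub_right, lor_smul_right, hn, hl, hl, map_zero]
    have : 0 < (√(√2))⁻¹ * (√2 * emb 1 β) * emb 1 α := by positivity
    linarith
  · rw [proj_apply, lor_sub_right, lor_smul_right, hn, hl, hl, map_zero, map_neg]
    have : 0 < (√(√2))⁻¹ * (√2 * emb 1 β) * emb 1 α := by positivity
    linarith

end BentDomain

namespace BentDomain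
open Filter Topology

/-- Open convex cones on whose closure some linear functional is coercive. -/
structure SharpCone {E : Type*} [NormedAddCommGroup E] [NormedSpace ℝ E] (U : Set E) : Prop where
  isOpen : IsOpen U
  nonempty : U.Nonempty
  add_mem : ∀ {x y}, x ∈ U → y ∈ U → x + y ∈ U
  smul_mem : ∀ {x} {r : ℝ}, x ∈ U → 0 < r → r • x ∈ U
  coercive : ∃ ψ : E →L[ℝ] ℝ, ∃ δ > 0, ∀ z ∈ U, δ * ‖z‖ ≤ ψ z

namespace SharpCone

variable {E : Type*} [NormedAddCommGroup E] [NormedSpace ℝ E] {U : Set E} (hU : SharpCone U)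
include hU

lemma convex : Convex ℝ U := by
  intro x hx y hy a b ha hb hab
  rcases ha.eq_or_lt with rfl | ha
  · simpa [show b = 1 by linarith] using hy
  rcases hb.eq_or_lt with rfl | hb
  · simpa [show a = 1 by linarith] using hx
  exact hU.add_mem (hU.smul_mem hx ha) (hU.smul_mem hy hb)

lemma closure_add {x y : E} (hx : x ∈ closure U) (hy : y ∈ closure U) : x + y ∈ closure U :=
  map_mem_closure₂ continuous_add hx hy fun _ ha _ hb => hU.add_mem ha hb

lemma zero_mem_closure : (0 : E) ∈ closure U := by
  obtain ⟨u, hu⟩ := hU.nonempty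
  have h1 : Tendsto (fun t : ℝ => t • u) (𝓝[>] 0) (𝓝 0) := by
    have : Continuous fun t : ℝ => t • u := by fun_prop
    simpa using (this.tendsto 0).mono_left nhdsWithin_le_nhds
  refine mem_closure_of_tendsto h1 ?_
  filter_upwards [self_mem_nhdsWithin] with t ht
  exact hU.smul_mem hu ht

lemma closure_smul {x : E} (hx : x ∈ closure U) {r : ℝ} (hr : 0 ≤ r) : r • x ∈ closure U := by
  rcases hr.eq_or_lt with rfl | hr
  · simpa using hU.zero_mem_closure
  · exact map_mem_closure (continuous_const_smul r) hx fun _ ha => hU.smul_mem ha hr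

lemma add_mem_of_closure {x y : E} (hx : x ∈ U) (hy : y ∈ closure U) : x + y ∈ U := by
  have h1 : {y' | x + y - y' ∈ U} ∈ 𝓝 y := by
    have : Continuous fun y' => x + y - y' := by fun_prop
    exact (hU.isOpen.preimage this).mem_nhds (by simpa using hx)
  obtain ⟨y', h, hy'⟩ := mem_closure_iff_nhds.1 hy _ h1
  simpa using hU.add_mem h hy'

lemma closure_coercive : ∃ ψ : E →L[ℝ] ℝ, ∃ δ > 0, ∀ z ∈ closure U, δ * ‖z‖ ≤ ψ z := by
  obtain ⟨ψ, δ, hδ, h⟩ := hU.coercive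
  refine ⟨ψ, δ, hδ, fun z hz => ?_⟩
  exact closure_minimal (s := U) (t := {z | δ * ‖z‖ ≤ ψ z}) h
    (isClosed_le (by fun_prop) (by fun_prop)) hz

lemma eq_zero_of_neg_mem {x : E} (hx : x ∈ closure U) (hx' : -x ∈ closure U) : x = 0 := by
  obtain ⟨ψ, δ, hδ, h⟩ := hU.closure_coercive
  have h1 := h x hx
  have h2 := h _ hx'
  rw [norm_neg, map_neg] at h2
  have : ‖x‖ = 0 := by nlinarith [norm_nonneg x]
  simpa using this

/-- The order bound between two compact sets. -/
lemma exists_bound {K L : Set E} (hK : IsCompact K) (hL : IsCompact L) (hLU : L ⊆ U) :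
    ∃ A : ℝ, 1 ≤ A ∧ ∀ x ∈ K, ∀ y ∈ L, A • y - x ∈ U := by
  have key : ∃ A : ℝ, 1 ≤ A ∧ ∀ p ∈ K ×ˢ L, A • p.2 - p.1 ∈ U := by
    refine IsCompact.induction_on (p := fun s => ∃ A : ℝ, 1 ≤ A ∧ ∀ p ∈ s ∩ (K ×ˢ L), A • p.2 - p.1 ∈ U)
      (hK.prod hL) ⟨1, le_rfl, by simp⟩ ?_ ?_ ?_ |>.imp fun A hA => ⟨hA.1, fun p hp => hA.2 p ⟨hp, hp⟩⟩
    · rintro s t hst ⟨A, hA, h⟩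
      exact ⟨A, hA, fun p hp => h p ⟨hst hp.1, hp.2⟩⟩
    · rintro s t ⟨A, hA, h⟩ ⟨B, hB, h'⟩
      have mono : ∀ {A B : ℝ}, A ≤ B → ∀ p ∈ K ×ˢ L, A • p.2 - p.1 ∈ U → B • p.2 - p.1 ∈ U := by
        intro A B hAB p hp h
        have := hU.add_mem_of_closure h (hU.closure_smul (subset_closure (hLU hp.2)) (sub_nonneg.2 hAB))
        convert this using 1; module
      refine ⟨max A B, le_max_of_le_left hA, ?_⟩
      rintro p ⟨hp | hp, hp'⟩
      · exact mono (le_max_left _ _) p hp' (h p ⟨hp, hp'⟩)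
      · exact mono (le_max_right _ _) p hp' (h' p ⟨hp, hp'⟩)
    · rintro ⟨x, y⟩ hp
      have h1 : {t : ℝ | y - t • x ∈ U} ∈ 𝓝 (0 : ℝ) := by
        have c1 : Continuous fun t : ℝ => y - t • x := by fun_prop
        exact (hU.isOpen.preimage c1).mem_nhds (by simpa using hLU hp.2)
      obtain ⟨t, ht, ht0, ht1⟩ := (nonempty_of_mem (inter_mem (mem_nhdsWithin_of_mem_nhds h1)
        (Ioc_mem_nhdsGT (zero_lt_one : (0 : ℝ) < 1))))
      have h2 : t⁻¹ • y - x ∈ U := by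
        have := hU.smul_mem ht (inv_pos.2 ht0)
        rwa [smul_sub, smul_smul, inv_mul_cancel₀ ht0.ne', one_smul] at this
      have c2 : Continuous fun p : E × E => t⁻¹ • p.2 - p.1 := by fun_prop
      refine ⟨_, mem_nhdsWithin_of_mem_nhds ((hU.isOpen.preimage c2).mem_nhds h2), t⁻¹,
        (one_le_inv₀ ht0).2 ht1, fun p hp => hp.1⟩
  obtain ⟨A, hA, h⟩ := key
  exact ⟨A, hA, fun x hx y hy => h (x, y) ⟨hx, hy⟩⟩

lemma exists_maximal {p q : E} (hp : p ∈ closure U) (hq : q ∈ closure U) (hq0 : q ≠ 0) :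
    ∃ s : ℝ, 0 ≤ s ∧ p - s • q ∈ closure U ∧ ∀ t > s, p - t • q ∉ closure U := by
  obtain ⟨ψ, δ, hδ, h⟩ := hU.closure_coercive
  have hψ : 0 < ψ q := lt_of_lt_of_le (mul_pos hδ (norm_pos_iff.2 hq0)) (h q hq)
  have hb : ∀ t : ℝ, p - t • q ∈ closure U → t ≤ ψ p / ψ q := by
    intro t ht
    have h1 := h _ ht
    rw [map_sub, map_smul, smul_eq_mul] at h1
    rw [le_div_iff₀ hψ]
    nlinarith [mul_nonneg hδ.le (norm_nonneg (p - t • q))]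
  have hc : IsCompact {t : ℝ | t ∈ Set.Icc 0 (ψ p / ψ q) ∧ p - t • q ∈ closure U} := by
    refine isCompact_Icc.inter_right (isClosed_closure.preimage ?_)
    fun_prop
  have hn : {t : ℝ | t ∈ Set.Icc 0 (ψ p / ψ q) ∧ p - t • q ∈ closure U}.Nonempty :=
    ⟨0, ⟨le_rfl, hb 0 (by simpa using hp)⟩, by simpa using hp⟩
  obtain ⟨s, hs, hmax⟩ := hc.exists_isGreatest hn
  refine ⟨s, hs.1.1, hs.2, fun t ht htU => ?_⟩
  exact ht.not_ge (hmax ⟨⟨hs.1.1.trans ht.le, hb t htU⟩, htU⟩)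

/-- A flat boundary piece of the cone contains the two extremal rays of a two dimensional cone. -/
lemma exists_face {v w : E} (hvw : LinearIndependent ℝ ![v, w]) (hv : v ∈ closure U)
    (hw : w ∈ closure U) (h : v + w ∉ U) :
    ∃ a ∈ closure U, ∃ b ∈ closure U, ∃ ψ : E →L[ℝ] ℝ, ψ a = 0 ∧ ψ b = 0 ∧ (∀ z ∈ U, 0 < ψ z) ∧
      ∀ x y : ℝ, x • a + y • b ∈ closure U → 0 ≤ x ∧ 0 ≤ y := by
  obtain ⟨f, hf⟩ := geometric_hahn_banach_open_point hU.convex hU.isOpen h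
  have hle : ∀ z ∈ U, f z ≤ 0 := by
    intro z hz
    by_contra! hc
    have := hf _ (hU.smul_mem hz (r := (|f (v + w)| + 1) / f z) (by positivity))
    rw [map_smul, smul_eq_mul, div_mul_cancel₀ _ hc.ne'] at this
    linarith [le_abs_self (f (v + w))]
  have hle' : ∀ z ∈ closure U, f z ≤ 0 :=
    fun z hz => closure_minimal (t := {z | f z ≤ 0}) hle (isClosed_le (by fun_prop) (by fun_prop)) hz
  have h0 : 0 ≤ f (v + w) := by
    have : closure U ⊆ {z | f z ≤ f (v + w)} :=
      closure_minimal (fun z hz => (hf z hz).le) (isClosed_le (by fun_prop) (by fun_prop))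
    simpa using this hU.zero_mem_closure
  have hv0 : f v = 0 := by
    have := hle' v hv; have := hle' w hw; rw [map_add] at h0; linarith
  have hw0 : f w = 0 := by
    have := hle' v hv; have := hle' w hw; rw [map_add] at h0; linarith
  rw [LinearIndependent.pair_iff] at hvw
  have hwne : w ≠ 0 := by
    rintro rfl
    simpa using hvw 0 1 (by simp)
  obtain ⟨s, hs, hsU, hsmax⟩ := hU.exists_maximal hv hw hwne
  set a := v - s • w with ha
  have hane : a ≠ 0 := by
    intro h0
    have := hvw 1 (-s) (by rw [one_smul, neg_smul, ← sub_eq_add_neg, ← ha, h0])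
    simp at this
  obtain ⟨r, hr, hrU, hrmax⟩ := hU.exists_maximal hw hsU hane
  refine ⟨a, hsU, w - r • a, hrU, -f, by simp [ha, hv0, hw0], by simp [ha, hv0, hw0],
    fun z hz => ?_, fun x y hxy => ?_⟩
  · have := hf z hz
    rw [map_add, hv0, hw0] at this
    simpa using this
  have hind : ∀ x y : ℝ, x • a + y • (w - r • a) = 0 → x = 0 ∧ y = 0 := by
    intro x y h0
    have h1 := hvw (x - y * r) (y - (x - y * r) * s) (by rw [← h0, ha]; module)
    obtain ⟨h1, h2⟩ := h1
    rw [h1] at h2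
    have h3 : y = 0 := by linarith
    rw [h3] at h1
    exact ⟨by linarith, h3⟩
  have hy : 0 ≤ y := by
    by_contra! hy
    rcases le_or_gt x 0 with hx | hx
    · have h1 : -(x • a + y • (w - r • a)) ∈ closure U := by
        have := hU.closure_add (hU.closure_smul hsU (neg_nonneg.2 hx))
          (hU.closure_smul hrU (neg_nonneg.2 hy.le))
        convert this using 1; module
      exact hy.ne (hind x y (hU.eq_zero_of_neg_mem hxy h1)).2
    · have hp : 0 < x - y * r := by nlinarith
      have h1 := hU.closure_smul hxy (inv_nonneg.2 hp.le)
      refine hsmax (s + (-y) / (x - y * r)) ?_ ?_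
      · have : 0 < (-y) / (x - y * r) := div_pos (by linarith) hp
        linarith
      · convert h1 using 1
        have e : v - (s + -y / (x - y * r)) • w = a + (y / (x - y * r)) • w := by
          rw [ha, neg_div]; module
        have e2 : x • a + y • (w - r • a) = (x - y * r) • a + y • w := by module
        rw [e, e2, smul_add, smul_smul, smul_smul, inv_mul_cancel₀ hp.ne', one_smul, div_eq_inv_mul]
  refine ⟨?_, hy⟩
  by_contra! hx
  rcases hy.eq_or_lt with rfl | hy
  · rw [zero_smul, add_zero] at hxy
    have h1 := hU.closure_smul hxy (inv_nonneg.2 (neg_nonneg.2 hx.le))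
    rw [smul_smul, inv_neg, neg_mul, inv_mul_cancel₀ hx.ne, neg_smul, one_smul] at h1
    exact hane (hU.eq_zero_of_neg_mem hsU h1)
  · have h1 := hU.closure_smul hxy (inv_nonneg.2 hy.le)
    refine hrmax (r + (-x) / y) ?_ ?_
    · have : 0 < (-x) / y := div_pos (by linarith) hy
      linarith
    · convert h1 using 1
      rw [smul_add, smul_smul, smul_smul, inv_mul_cancel₀ hy.ne', one_smul, ← div_eq_inv_mul, neg_div]
      module

end SharpCone
end BentDomain

namespace BentDomain
open Filter Topology
variable {d : ℕ}

/-- The hyperboloid. -/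
def hyp (d : ℕ) : Set (Vec d) := {x | x ∈ fut d ∧ lor x x = -1}

/-- The hyperbolic cosine of the distance. -/
noncomputable def ch (x y : Vec d) : ℝ := -lor x y

lemma ch_comm (x y : Vec d) : ch x y = ch y x := by rw [ch, ch, lor_comm]

lemma one_le_ch {x y : Vec d} (hx : x ∈ hyp d) (hy : y ∈ hyp d) : 1 ≤ ch x y := by
  have h1 := lor_mul_lor_le hx.1 y
  have h2 := lor_neg_of_mem_fut hx.1 hy.1
  rw [hx.2, hy.2] at h1
  unfold ch
  nlinarith

/-- Cauchy–Schwarz on the orthogonal complement of a timelike vector. -/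
lemma lor_le_sqrt_mul_sqrt {z a b : Vec d} (hz : z ∈ fut d) (ha : lor z a = 0) (hb : lor z b = 0) :
    lor a b ≤ √(lor a a) * √(lor b b) := by
  have h0 := lor_nonneg_of_orthogonal hz ha
  have hb0 := lor_nonneg_of_orthogonal hz hb
  rw [← Real.sqrt_mul h0]
  apply Real.le_sqrt_of_sq_le
  have h : ∀ t : ℝ, 0 ≤ lor a a * (t * t) + 2 * lor a b * t + lor b b := by
    intro t
    have := lor_nonneg_of_orthogonal hz (v := t • a + b) (by simp [lor_add_right, ha, hb])
    simp only [lor_add_right, lor_smul_right, lor_add_left, lor_smul_left, lor_comm b a] at this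
    linarith
  have := discrim_le_zero h
  rw [discrim] at this
  linarith

/-- The quasi-metric on the hyperboloid seen from `z`. -/
noncomputable def chi (z x y : Vec d) : ℝ := √(ch x y / (ch x z * ch y z))

lemma chi_nonneg (z x y : Vec d) : 0 ≤ chi z x y := Real.sqrt_nonneg _

lemma chi_sq {z x y : Vec d} (hz : z ∈ hyp d) (hx : x ∈ hyp d) (hy : y ∈ hyp d) :
    ∀ a, a = (ch x z)⁻¹ • x - (ch y z)⁻¹ • y → lor z a = 0 ∧
      2 * chi z x y ^ 2 = lor a a + (ch x z)⁻¹ ^ 2 + (ch y z)⁻¹ ^ 2 := by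
  rintro a rfl
  have h1 := one_le_ch hx hz
  have h2 := one_le_ch hy hz
  have h3 := one_le_ch hx hy
  have e1 : lor z x = -ch x z := by rw [ch, neg_neg, lor_comm]
  have e2 : lor z y = -ch y z := by rw [ch, neg_neg, lor_comm]
  have e3 : lor x y = -ch x y := by rw [ch, neg_neg]
  have e4 : lor y x = -ch x y := by rw [ch, neg_neg, lor_comm]
  rw [chi, Real.sq_sqrt (by positivity)]
  simp only [lor_sub_right, lor_sub_left, lor_smul_right, lor_smul_left, e1, e2, e3, e4, hx.2, hy.2]
  constructor
  · field_simp; ring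
  · field_simp; ring

lemma chi_triangle {z x y w : Vec d} (hz : z ∈ hyp d) (hx : x ∈ hyp d) (hy : y ∈ hyp d)
    (hw : w ∈ hyp d) : chi z x w ≤ chi z x y + chi z y w := by
  obtain ⟨ha, ha'⟩ := chi_sq hz hx hy _ rfl
  obtain ⟨hb, hb'⟩ := chi_sq hz hy hw _ rfl
  obtain ⟨-, hc'⟩ := chi_sq hz hx hw _ rfl
  set a := (ch x z)⁻¹ • x - (ch y z)⁻¹ • y
  set b := (ch y z)⁻¹ • y - (ch w z)⁻¹ • w
  have hab : (ch x z)⁻¹ • x - (ch w z)⁻¹ • w = a + b := by simp [a, b]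
  rw [hab] at hc'
  simp only [lor_add_right, lor_add_left, lor_comm b a] at hc'
  have h0 := lor_nonneg_of_orthogonal hz.1 ha
  have h1 := lor_nonneg_of_orthogonal hz.1 hb
  have cs := lor_le_sqrt_mul_sqrt hz.1 ha hb
  have n1 := chi_nonneg z x y
  have n2 := chi_nonneg z y w
  have i1 : √(lor a a) * √(lor b b) ≤ (√2 * chi z x y) * (√2 * chi z y w) := by
    apply mul_le_mul _ _ (Real.sqrt_nonneg _) (by positivity)
    · rw [Real.sqrt_le_left (by positivity), mul_pow, Real.sq_sqrt (by norm_num), ha']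
      nlinarith [sq_nonneg (ch x z)⁻¹, sq_nonneg (ch y z)⁻¹]
    · rw [Real.sqrt_le_left (by positivity), mul_pow, Real.sq_sqrt (by norm_num), hb']
      nlinarith [sq_nonneg (ch y z)⁻¹, sq_nonneg (ch w z)⁻¹]
  have i2 : (√2 * chi z x y) * (√2 * chi z y w) = 2 * (chi z x y * chi z y w) := by
    rw [mul_mul_mul_comm, Real.mul_self_sqrt (by norm_num)]
  refine abs_le_of_sq_le_sq' ?_ (by positivity) |>.2
  nlinarith [sq_nonneg (ch y z)⁻¹]

lemma ch_le_two_mul {x y z : Vec d} (hx : x ∈ hyp d) (hy : y ∈ hyp d) (hz : z ∈ hyp d) :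
    ch x y ≤ 2 * (ch x z * ch z y) := by
  have h1 := one_le_ch hx hz
  have h2 := one_le_ch hy hz
  have e1 : lor z x = -ch x z := by rw [ch, neg_neg, lor_comm]
  have e2 : lor z y = -ch y z := by rw [ch, neg_neg, lor_comm]
  have e3 : lor x y = -ch x y := by rw [ch, neg_neg]
  have e4 : lor y x = -ch x y := by rw [ch, neg_neg, lor_comm]
  have h := lor_nonneg_of_orthogonal hz.1
    (v := (ch x z)⁻¹ • x + (ch y z)⁻¹ • y - (2 : ℝ) • z) (by
      simp only [lor_sub_right, lor_add_right, lor_smul_right, e1, e2, hz.2]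
      field_simp; ring)
  simp only [lor_sub_right, lor_add_right, lor_sub_left, lor_add_left, lor_smul_right, lor_smul_left,
    e1, e2, e3, e4, hx.2, hy.2, hz.2, lor_comm x z, lor_comm y z] at h
  have p1 : 0 < ch x z := by linarith
  have p2 : 0 < ch y z := by linarith
  rw [ch_comm z y]
  field_simp at h
  nlinarith [mul_pos p1 p2, sq_nonneg (ch x z), sq_nonneg (ch y z), mul_pos (mul_pos p1 p2) p1]

/-- Midpoints. -/
lemma exists_midpoint {x y : Vec d} (hx : x ∈ hyp d) (hy : y ∈ hyp d) :
    ∃ m ∈ hyp d, ch x m ^ 2 = (1 + ch x y) / 2 ∧ ch m y = ch x m := by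
  have h1 := one_le_ch hx hy
  have hs : 0 < √(2 + 2 * ch x y) := Real.sqrt_pos.2 (by linarith)
  have hs2 : √(2 + 2 * ch x y) * √(2 + 2 * ch x y) = 2 + 2 * ch x y :=
    Real.mul_self_sqrt (by linarith)
  have e3 : lor x y = -ch x y := by rw [ch, neg_neg]
  have e4 : lor y x = -ch x y := by rw [ch, neg_neg, lor_comm]
  set s := √(2 + 2 * ch x y)
  have e5 : ch x (s⁻¹ • (x + y)) = s⁻¹ * (1 + ch x y) := by
    rw [ch, lor_smul_right, lor_add_right, hx.2, e3]; ring
  refine ⟨s⁻¹ • (x + y), ⟨smul_mem_fut (add_mem_fut hx.1 hy.1) (inv_pos.2 hs), ?_⟩, ?_, ?_⟩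
  · simp only [lor_smul_left, lor_smul_right, lor_add_left, lor_add_right, hx.2, hy.2, e3, e4]
    field_simp
    linarith
  · rw [e5]
    field_simp
    nlinarith
  · rw [e5, ch, lor_smul_left, lor_add_left, hy.2, e3]; ring

lemma exists_near_midpoint {n : ℕ} (x : ℕ → Vec d) (hx : ∀ i ≤ n, x i ∈ hyp d) {z : Vec d}
    (hz : z ∈ hyp d) {B : ℝ} (hB : ∀ i < n, ch (x i) (x (i + 1)) ≤ B ^ 2) (hB0 : 0 ≤ B)
    (hn : 0 < n) (hmid : ch (x 0) z * ch (x n) z ≤ ch (x 0) (x n)) :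
    ∃ i ≤ n, ch (x i) z ≤ n * B := by
  by_contra! hc
  have hn' : (0 : ℝ) < n := by exact_mod_cast hn
  have hB1 : 0 < B := by
    rcases hB0.eq_or_lt with rfl | h
    · have := hB 0 hn
      have := one_le_ch (hx 0 (by omega)) (hx (0 + 1) (by omega))
      norm_num at *
      linarith
    · exact h
  have step : ∀ i < n, chi z (x i) (x (i + 1)) < 1 / n := by
    intro i hi
    have h1 := hc i hi.le
    have h2 := hc (i + 1) hi
    have hp : 0 < n * B := by positivity
    rw [chi, Real.sqrt_lt' (by positivity), div_lt_iff₀ (by nlinarith)]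
    calc ch (x i) (x (i + 1)) ≤ B ^ 2 := hB i hi
      _ = (1 / n) ^ 2 * ((n * B) * (n * B)) := by field_simp
      _ < _ := by gcongr
  have sum : ∀ k, 0 < k → k ≤ n → chi z (x 0) (x k) < k * (1 / n) := by
    intro k
    induction k with
    | zero => simp
    | succ k ih =>
      intro _ hk
      rcases Nat.eq_zero_or_pos k with rfl | hk0
      · simpa using step 0 hk
      · have h1 := ih hk0 (by omega)
        have h2 := chi_triangle hz (hx 0 (by omega)) (hx k (by omega)) (hx (k + 1) hk)
        have h3 := step k hk
        push_cast
        linarith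
  have h1 := sum n hn le_rfl
  rw [mul_one_div_cancel hn'.ne'] at h1
  have p1 := one_le_ch (hx 0 (by omega)) hz
  have p2 := one_le_ch (hx n le_rfl) hz
  have h2 : 1 ≤ chi z (x 0) (x n) := by
    rw [chi, Real.one_le_sqrt, one_le_div (by positivity)]
    exact hmid
  linarith

end BentDomain

namespace BentDomain
open Filter Topology
variable {d : ℕ}

lemma eventually_mul_log_add_lt (P Q : ℝ) : ∀ᶠ R : ℕ in atTop, P * Real.log R + Q < R := by
  have h1 : (fun x : ℝ => P * Real.log x + Q) =o[atTop] (id : ℝ → ℝ) :=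
    (Real.isLittleO_log_id_atTop.const_mul_left P).add (Asymptotics.isLittleO_const_id_atTop Q)
  have h2 := (h1.def (c := 1 / 2) (by norm_num)).and (eventually_gt_atTop 0)
  have h3 := tendsto_natCast_atTop_atTop (R := ℝ) |>.eventually h2
  filter_upwards [h3] with R hR
  obtain ⟨h, h0⟩ := hR
  have := (le_abs_self _).trans h
  simp only [id, Real.norm_eq_abs, abs_of_pos h0] at this
  linarith

/-- A map of a square grid into hyperbolic space which expands at least logarithmically has
bounded size. -/
lemma no_flat (d : ℕ) (α β b : ℝ) (hα : 0 ≤ α) (hb : 0 ≤ b) : ∃ R : ℕ,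
    ∀ x : ℤ → ℤ → Vec d, (∀ i j : ℤ, i.natAbs ≤ R → j.natAbs ≤ R → x i j ∈ hyp d) →
    (∀ i j i' j' : ℤ, i.natAbs ≤ R → j.natAbs ≤ R → i'.natAbs ≤ R → j'.natAbs ≤ R →
      (i - i').natAbs + (j - j').natAbs ≤ 1 → Real.log (ch (x i j) (x i' j')) ≤ b) →
    (∀ i j i' j' : ℤ, i.natAbs ≤ R → j.natAbs ≤ R → i'.natAbs ≤ R → j'.natAbs ≤ R →
      ((i - i').natAbs : ℝ) ≤ α * Real.log (ch (x i j) (x i' j')) + β ∧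
      ((j - j').natAbs : ℝ) ≤ α * Real.log (ch (x i j) (x i' j')) + β) → False := by
  set L := Real.log 2
  have hL : 0 ≤ L := Real.log_nonneg (by norm_num)
  obtain ⟨R, hR1, hR2, hR0⟩ := ((eventually_mul_log_add_lt (α * 2)
    (α * (2 * (Real.log 4 + b / 2) + L) + β)).and
    ((eventually_mul_log_add_lt (α * 2 * (1 + (b + L) * (α * 2)))
    (α * (2 * ((Real.log 4 + b / 2) + (b + L) * (α * (2 * (Real.log 4 + b / 2) + L) + β) + L) + L) + β)).and
    (eventually_gt_atTop 0))).exists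
  refine ⟨R, fun x hx hadj hexp => ?_⟩
  have hRp : (0 : ℝ) < R := by exact_mod_cast hR0
  have mul : ∀ {x y z : Vec d}, x ∈ hyp d → y ∈ hyp d → z ∈ hyp d →
      Real.log (ch x y) ≤ Real.log (ch x z) + Real.log (ch z y) + L := by
    intro x y z hx hy hz
    have h1 := one_le_ch hx hy
    have h2 := one_le_ch hx hz
    have h3 := one_le_ch hz hy
    rw [← Real.log_mul (by positivity) (by positivity), ← Real.log_mul (by positivity) (by positivity)]
    apply Real.log_le_log (by positivity)
    have := ch_le_two_mul hx hy hz
    linarith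
  have he : x (-R) 0 ∈ hyp d := hx _ _ (by omega) (by omega)
  have he' : x R 0 ∈ hyp d := hx _ _ (by omega) (by omega)
  obtain ⟨z, hz, hz1, hz2⟩ := exists_midpoint he he'
  have hee := one_le_ch he he'
  have hez := one_le_ch he hz
  set l := Real.log R + (Real.log 4 + b / 2) with hl
  -- points of the two paths near the midpoint
  have near : ∀ s : ℤ, s.natAbs = 1 → ∃ i j : ℤ, i.natAbs ≤ R ∧ 0 ≤ j ∧ j ≤ R ∧
      (i.natAbs = R ∨ j = R) ∧ Real.log (ch (x i (s * j)) z) ≤ l := by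
    intro s hs
    have hs' : s = 1 ∨ s = -1 := by omega
    let p : ℕ → ℤ := fun k => max (-R) (min R (k - 2 * R))
    let q : ℕ → ℤ := fun k => min R (min k (4 * R - k))
    have hq : ∀ k, (s * q k).natAbs = (q k).natAbs := fun k => by rw [Int.natAbs_mul, hs, one_mul]
    have pq : ∀ k ≤ 4 * R, (p k).natAbs ≤ R ∧ 0 ≤ q k ∧ q k ≤ R ∧ ((p k).natAbs = R ∨ q k = R) := by
      intro k hk
      simp only [p, q]
      omega
    have p0 : p 0 = -R := by simp only [p]; omega
    have q0 : s * q 0 = 0 := by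
      have : q 0 = 0 := by simp only [q]; omega
      rw [this, mul_zero]
    have p1 : p (4 * R) = R := by simp only [p]; omega
    have q1 : s * q (4 * R) = 0 := by
      have : q (4 * R) = 0 := by simp only [q]; omega
      rw [this, mul_zero]
    obtain ⟨k, hk, hk'⟩ := exists_near_midpoint (n := 4 * R) (fun k => x (p k) (s * q k))
      (fun k hk => hx _ _ (pq k hk).1 (by have := pq k hk; have := hq k; omega)) hz
      (B := Real.exp (b / 2)) (fun k hk => by
        have c1 := pq k hk.le
        have c2 := pq (k + 1) hk
        have d1 := hq k
        have d2 := hq (k + 1)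
        have h1 : (p k - p (k + 1)).natAbs + (s * q k - s * q (k + 1)).natAbs ≤ 1 := by
          rw [← mul_sub, Int.natAbs_mul, hs, one_mul]
          simp only [p, q]
          omega
        have h2 := hadj _ _ _ _ c1.1 (by omega) c2.1 (by omega) h1
        have h3 := one_le_ch (hx _ (s * q k) c1.1 (by omega))
          (hx _ (s * q (k + 1)) c2.1 (by omega))
        rw [← Real.exp_nat_mul, ← Real.log_le_iff_le_exp (by linarith)]
        convert h2 using 1
        push_cast; ring) (Real.exp_pos _).le (by omega)
      (by
        simp only [p0, q0, p1, q1]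
        rw [ch_comm (x R 0) z, hz2, ← sq, hz1]
        linarith)
    have c := pq k hk
    refine ⟨p k, q k, c.1, c.2.1, c.2.2.1, c.2.2.2, ?_⟩
    have h3 := one_le_ch (hx _ (s * q k) c.1 (by have := hq k; omega)) hz
    refine (Real.log_le_log (by linarith) hk').trans_eq ?_
    push_cast
    rw [Real.log_mul (by positivity) (by positivity), Real.log_mul (by positivity) (by positivity),
      Real.log_exp, hl]
    ring
  obtain ⟨i, j, hi, hj0, hj, hij, hu⟩ := near 1 rfl
  obtain ⟨i', j', hi', hj0', hj', -, hu'⟩ := near (-1) rfl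
  rw [one_mul] at hu
  have huH : x i j ∈ hyp d := hx _ _ hi (by omega)
  have huH' : x i' (-1 * j') ∈ hyp d := hx _ _ hi' (by omega)
  have h1 := (hexp i j i' (-1 * j') hi (by omega) hi' (by omega)).2
  have h2 := mul huH huH' hz
  rw [ch_comm z] at h2
  have hjt : ((j.toNat : ℕ) : ℤ) = j := by omega
  have hjt' : ((j.toNat : ℕ) : ℝ) = j := by exact_mod_cast congrArg (Int.cast (R := ℝ)) hjt
  have h3 : (j : ℝ) ≤ ((j - -1 * j').natAbs : ℝ) := by
    have : j.toNat ≤ (j - -1 * j').natAbs := by omega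
    rw [← hjt']
    exact_mod_cast this
  set D := α * (2 * l + L) + β with hD
  have h4 : (j : ℝ) ≤ D := by
    have : α * Real.log (ch (x i j) (x i' (-1 * j'))) ≤ α * (2 * l + L) := by gcongr; linarith
    linarith
  have hjR : j < R := by
    have : (j : ℝ) < R := by
      refine lt_of_le_of_lt h4 (lt_of_eq_of_lt ?_ hR1)
      rw [hD, hl]; ring
    exact_mod_cast this
  have hiR : i.natAbs = R := by omega
  -- the near point is close to a corner
  have chain : ∀ k : ℕ, k ≤ R → Real.log (ch (x i 0) (x i k)) ≤ (b + L) * k := by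
    intro k
    induction k with
    | zero =>
      intro _
      have : ch (x i 0) (x i 0) = 1 := by rw [ch, (hx i 0 hi (by omega)).2, neg_neg]
      simp [this]
    | succ k ih =>
      intro hk
      have m := mul (hx i 0 hi (by omega)) (hx i (k + 1 : ℕ) hi (by omega)) (hx i k hi (by omega))
      have a := hadj i k i (k + 1 : ℕ) hi (by omega) hi (by omega) (by omega)
      have := ih (by omega)
      push_cast at m a ⊢
      linarith
  have hc := chain j.toNat (by omega)
  rw [hjt, hjt'] at hc
  have h5 := mul (hx i 0 hi (by omega)) hz huH
  have h6 : Real.log (ch (x i 0) z) = Real.log (ch (x (-R) 0) z) := by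
    have : i = -R ∨ i = R := by omega
    rcases this with rfl | rfl
    · rfl
    · rw [ch_comm, hz2]
  have h7 : (b + L) * j ≤ (b + L) * D := by gcongr
  have h8 := mul he he' hz
  rw [hz2] at h8
  have h9 := (hexp (-R) 0 R 0 (by omega) (by omega) (by omega) (by omega)).1
  have h10 : (R : ℝ) ≤ ((-R - R : ℤ).natAbs : ℝ) := by
    have : R ≤ (-R - R : ℤ).natAbs := by omega
    exact_mod_cast this
  have h11 : α * Real.log (ch (x (-R) 0) (x R 0)) ≤ α * (2 * (l + (b + L) * D + L) + L) := by
    gcongr; linarith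
  refine absurd (h10.trans h9) (not_le.2 ?_)
  refine lt_of_le_of_lt ((add_le_add_iff_right β).2 h11) (lt_of_eq_of_lt ?_ hR2)
  rw [hD, hl]; ring

end BentDomain

namespace BentDomain
open Filter Topology
variable {d : ℕ}

lemma isClosed_hyp : IsClosed (hyp d) := by
  have : hyp d = {x | lor x x = -1} ∩ {x | 0 ≤ x (Fin.last d)} := by
    ext x
    constructor
    · exact fun h => ⟨h.2, h.1.2.le⟩
    · rintro ⟨h1, h2⟩
      have h1 : lor x x = -1 := h1
      refine ⟨(mem_fut_or_neg_mem (by rw [h1]; norm_num)).resolve_right fun h => ?_, h1⟩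
      have := h.2
      simp only [Pi.neg_apply] at this
      have h2 : 0 ≤ x (Fin.last d) := h2
      linarith
  rw [this]
  exact (isClosed_eq (by fun_prop) continuous_const).inter
    (isClosed_le continuous_const (continuous_apply _))

lemma exists_hyp_smul {y : Vec d} (hy : y ∈ fut d) : ∃ x ∈ hyp d, ∃ s : ℝ, 0 < s ∧ y = s • x := by
  have h0 : 0 < √(-lor y y) := Real.sqrt_pos.2 (by linarith [hy.1])
  have h1 : √(-lor y y) * √(-lor y y) = -lor y y := Real.mul_self_sqrt (by linarith [hy.1])
  refine ⟨(√(-lor y y))⁻¹ • y, ⟨smul_mem_fut hy (inv_pos.2 h0), ?_⟩, _, h0, ?_⟩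
  · simp only [lor_smul_left, lor_smul_right]
    field_simp
    linarith
  · rw [smul_smul, mul_inv_cancel₀ h0.ne', one_smul]

lemma map_mem_hyp (hd : 1 ≤ d) {g : Vec d ≃ₗ[ℝ] Vec d} (hg : g ∈ futGroup d) {x : Vec d}
    (hx : x ∈ hyp d) : g x ∈ hyp d :=
  ⟨((isAut_of_mem hd hg).fut x).2 hx.1, by rw [(isAut_of_mem hd hg).lor, hx.2]⟩

namespace Flag

lemma hol_mem_iff {W : WallSystem d} (X : Flag W) {γ : Vec d ≃ₗ[ℝ] Vec d} (hγ : IsAut W γ)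
    {z : Vec d} : X.hol hγ z ∈ X.U ↔ z ∈ X.U := by
  conv_lhs => rw [← image_hol X hγ]
  exact (X.hol hγ).injective.mem_set_image

lemma hol_mem_closure_iff {W : WallSystem d} (X : Flag W) {γ : Vec d ≃ₗ[ℝ] Vec d} (hγ : IsAut W γ)
    {z : Vec d} : X.hol hγ z ∈ closure X.U ↔ z ∈ closure X.U := by
  have h := (X.hol hγ).toContinuousLinearEquiv.toHomeomorph.image_closure X.U
  change X.hol hγ '' closure X.U = closure (X.hol hγ '' X.U) at h
  rw [image_hol] at h
  conv_lhs => rw [← h]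
  exact (X.hol hγ).injective.mem_set_image

variable {hd : 1 ≤ d} (X : Flag (rootWalls hd)) (hU : SharpCone X.U)
include hU

lemma exists_comparison_one : ∃ A : ℝ, 1 ≤ A ∧ ∀ x ∈ hyp d, ∀ y ∈ hyp d, ch x y ≤ 2 →
    A • F X y - F X x ∈ X.U := by
  obtain ⟨K, hKf, hK, hK1, hK2⟩ := exists_compact_futGroup d
  obtain ⟨δ, hδ, hδ'⟩ := exists_sq_norm_le hK hKf
  have hL : IsCompact (hyp d ∩ Metric.closedBall 0 √(7 / δ)) :=
    (isCompact_closedBall _ _).inter_left isClosed_hyp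
  obtain ⟨A, hA, h⟩ := hU.exists_bound (hK.image_of_continuousOn (X.continuousOn_F.mono hKf))
    (hL.image_of_continuousOn (X.continuousOn_F.mono fun _ hx => hx.1.1))
    (by rintro _ ⟨y, hy, rfl⟩; exact X.F_mem_U hy.1.1)
  refine ⟨A, hA, fun x hx y hy hxy => ?_⟩
  obtain ⟨g, hg, hgK⟩ := hK2 x hx.1 hx.2
  have hgy := map_mem_hyp hd hg hy
  have e : lor (g x) (g y) = lor x y := (isAut_of_mem hd hg).lor x y
  have h1 := h _ ⟨_, hgK, rfl⟩ (F X (g y)) ⟨g y, ⟨hgy, by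
    rw [mem_closedBall_zero_iff]
    apply Real.le_sqrt_of_sq_le
    rw [le_div_iff₀ hδ]
    have h2 := hδ' (g x) hgK (g y)
    have h3 := one_le_ch hx hy
    rw [hK1 _ hgK, hgy.2, e] at h2
    rw [ch] at *
    nlinarith⟩, rfl⟩
  rw [F_map (isAut_of_mem hd hg) X hx.1, F_map (isAut_of_mem hd hg) X hy.1, ← map_smul, ← map_sub,
    hol_mem_iff] at h1
  exact h1

lemma exists_comparison : ∃ A : ℝ, 1 ≤ A ∧ ∀ j : ℕ, ∀ x ∈ hyp d, ∀ y ∈ hyp d,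
    ch x y ≤ 2 ^ 2 ^ j → A ^ 2 ^ j • F X y - F X x ∈ closure X.U := by
  obtain ⟨A, hA, h⟩ := X.exists_comparison_one hU
  refine ⟨A, hA, fun j => ?_⟩
  induction j with
  | zero =>
    intro x hx y hy hxy
    rw [pow_zero, pow_one] at *
    exact subset_closure (h x hx y hy hxy)
  | succ j ih =>
    intro x hx y hy hxy
    obtain ⟨m, hm, h1, h2⟩ := exists_midpoint hx hy
    have h3 := one_le_ch hx hy
    have h4 := one_le_ch hx hm
    rw [pow_succ 2 j, pow_mul] at *
    have h5 : ch x m ≤ 2 ^ 2 ^ j := by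
      refine abs_le_of_sq_le_sq' ?_ (by positivity) |>.2
      linarith
    have i1 := ih x hx m hm h5
    have i2 := hU.closure_smul (ih m hm y hy (h2 ▸ h5)) (r := A ^ 2 ^ j) (by positivity)
    convert hU.closure_add i1 i2 using 1
    module

lemma exists_comparison_log : ∃ A : ℝ, 1 ≤ A ∧ ∀ x ∈ hyp d, ∀ y ∈ hyp d,
    ∃ N : ℕ, (N : ℝ) ≤ 1 + 2 * Real.log (ch x y) / Real.log 2 ∧
      A ^ N • F X y - F X x ∈ closure X.U ∧ A ^ N • F X x - F X y ∈ closure X.U := by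
  obtain ⟨A, hA, h⟩ := X.exists_comparison hU
  refine ⟨A, hA, fun x hx y hy => ?_⟩
  have h3 := one_le_ch hx hy
  have hl : 0 < Real.log 2 := Real.log_pos (by norm_num)
  have hl' := Real.log_nonneg h3
  have hex : ∃ j : ℕ, ch x y ≤ 2 ^ 2 ^ j := by
    obtain ⟨n, hn⟩ := pow_unbounded_of_one_lt (ch x y) (one_lt_two)
    exact ⟨n, hn.le.trans (pow_le_pow_right₀ one_le_two (Nat.lt_two_pow_self).le)⟩
  classical
  refine ⟨2 ^ Nat.find hex, ?_, h _ x hx y hy (Nat.find_spec hex),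
    h _ y hy x hx (ch_comm x y ▸ Nat.find_spec hex)⟩
  rcases Nat.eq_zero_or_pos (Nat.find hex) with h0 | h0
  · rw [h0]
    simp only [pow_zero, Nat.cast_one]
    have : 0 ≤ 2 * Real.log (ch x y) / Real.log 2 := by positivity
    linarith
  · obtain ⟨k, hk⟩ := Nat.exists_eq_succ_of_ne_zero h0.ne'
    have h1 := Nat.find_min hex (m := k) (by omega)
    push Not at h1
    have h2 := Real.log_le_log (by positivity) h1.le
    rw [Real.log_pow] at h2
    rw [hk, pow_succ]
    push_cast at h2 ⊢
    have : (2 : ℝ) ^ k * 2 ≤ 2 * Real.log (ch x y) / Real.log 2 := by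
      rw [le_div_iff₀ hl]; linarith
    linarith

lemma exists_proper_bound : ∃ B : ℝ, 1 ≤ B ∧ ∀ x ∈ hyp d, ∀ y ∈ hyp d, ∀ r : ℝ, 0 < r →
    (2 : ℝ) • r • F X y - F X x ∈ closure X.U → (2 : ℝ) • F X x - r • F X y ∈ closure X.U →
    ch x y ≤ B := by
  obtain ⟨K, hKf, hK, hK1, hK2⟩ := exists_compact_futGroup d
  obtain ⟨o, ho⟩ := hU.nonempty
  have hP : IsCompact (F X '' K) := hK.image_of_continuousOn (X.continuousOn_F.mono hKf)
  obtain ⟨A, hA, hA'⟩ := hU.exists_bound (isCompact_singleton (x := o)) hP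
    (by rintro _ ⟨y, hy, rfl⟩; exact X.F_mem_U (hKf hy))
  obtain ⟨ψ, δ, hδ, hψ⟩ := hU.closure_coercive
  obtain ⟨M, hM⟩ := (hP.image ψ.continuous).isBounded.exists_norm_le
  let L : Set (Vec d) := Metric.closedBall 0 (2 * M / δ) ∩ {v | (2 * A) • v - o ∈ closure X.U}
  have hL : IsCompact L := (isCompact_closedBall _ _).inter_right
    (isClosed_closure.preimage (by fun_prop))
  have hLU : L ⊆ X.U := by
    rintro v ⟨-, hv⟩
    have h1 := hU.smul_mem (hU.add_mem_of_closure ho hv) (r := (2 * A)⁻¹) (by positivity)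
    rwa [add_sub_cancel, smul_smul, inv_mul_cancel₀ (by positivity), one_smul] at h1
  have hL' := X.isCompact_preimage_F hL hLU
  have hc : ContinuousOn (fun p : Vec d × Vec d => -lor p.1 p.2 / √(-lor p.2 p.2))
      (K ×ˢ {y ∈ fut d | F X y ∈ L}) := by
    refine ContinuousOn.div (by fun_prop) (by fun_prop) fun p hp => ?_
    exact (Real.sqrt_pos.2 (by linarith [hp.2.1.1])).ne'
  obtain ⟨B, hB⟩ := ((hK.prod hL').image_of_continuousOn hc).isBounded.exists_norm_le
  refine ⟨max B 1, le_max_right _ _, fun x hx y hy r hr h1 h2 => le_max_of_le_left ?_⟩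
  obtain ⟨g, hg, hgK⟩ := hK2 x hx.1 hx.2
  have hgy := map_mem_hyp hd hg hy
  have e : lor (g x) (g y) = lor x y := (isAut_of_mem hd hg).lor x y
  rw [← X.hol_mem_closure_iff (isAut_of_mem hd hg), map_sub, map_smul, map_smul,
    ← F_map (isAut_of_mem hd hg) X hx.1, ← F_map (isAut_of_mem hd hg) X hy.1] at h1
  rw [← X.hol_mem_closure_iff (isAut_of_mem hd hg), map_sub, map_smul, map_smul,
    ← F_map (isAut_of_mem hd hg) X hx.1, ← F_map (isAut_of_mem hd hg) X hy.1] at h2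
  have hmem : r • F X (g y) ∈ L := by
    constructor
    · rw [mem_closedBall_zero_iff, le_div_iff₀ hδ]
      have h3 := hψ _ (subset_closure (X.smul_mem_U (X.F_mem_U hgy.1) hr))
      have h4 := hψ _ h2
      have h5 := hM _ ⟨_, ⟨g x, hgK, rfl⟩, rfl⟩
      have h6 : 0 ≤ δ * ‖(2 : ℝ) • F X (g x) - r • F X (g y)‖ := by positivity
      rw [map_sub, map_smul, smul_eq_mul] at h4
      have := (le_abs_self _).trans h5
      linarith
    · have h3 := hU.closure_smul h1 (r := A) (by positivity)
      have h4 := subset_closure (hA' o rfl _ ⟨g x, hgK, rfl⟩)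
      change (2 * A) • r • F X (g y) - o ∈ closure X.U
      convert hU.closure_add h3 h4 using 1
      module
  have := hB _ ⟨(g x, r • g y), ⟨hgK, smul_mem_fut hgy.1 hr, by
    change F X (r • g y) ∈ L; rwa [F_smul X hgy.1 hr]⟩, rfl⟩
  refine le_trans (le_of_eq ?_) ((le_abs_self _).trans this)
  simp only [lor_smul_right, lor_smul_left, hgy.2, e]
  rw [show -(r * (r * -1)) = r ^ 2 by ring, Real.sqrt_sq hr.le, ch]
  field_simp

end Flag
end BentDomain

namespace BentDomain
open Filter Topology
variable {d : ℕ}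

namespace SharpCone

variable {E : Type*} [NormedAddCommGroup E] [NormedSpace ℝ E] {U : Set E} (hU : SharpCone U)
include hU

/-- The order relations between points of a multiplicative grid near a flat face. -/
lemma exists_grid {a b o : E} (ha : a ∈ closure U) (hb : b ∈ closure U) (ho : o ∈ U)
    {ψ : E →L[ℝ] ℝ} (ψa : ψ a = 0) (ψb : ψ b = 0) (ψo : ∀ z ∈ U, 0 < ψ z)
    (hab : ∀ x y : ℝ, x • a + y • b ∈ closure U → 0 ≤ x ∧ 0 ≤ y) (R : ℕ) :
    ∃ p : ℤ → ℤ → E, (∀ i j, p i j ∈ U) ∧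
      (∀ i j i' j' : ℤ, (i - i').natAbs + (j - j').natAbs ≤ 1 →
        (2 : ℝ) • p i j - p i' j' ∈ closure U) ∧
      ∀ i j i' j' : ℤ, i.natAbs ≤ R → j.natAbs ≤ R → i'.natAbs ≤ R → j'.natAbs ≤ R →
        ∀ μ : ℝ, μ • p i' j' - p i j ∈ closure U →
          (2 : ℝ) ^ i ≤ 2 * μ * 2 ^ i' ∧ (2 : ℝ) ^ j ≤ 2 * μ * 2 ^ j' ∧ 1 ≤ μ := by
  let P : ℝ → ℤ → ℤ → E := fun ε i j => (2 : ℝ) ^ i • a + (2 : ℝ) ^ j • b + ε • o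
  have cont : ∀ (μ : ℝ) (i j i' j' : ℤ), Continuous fun ε => μ • P ε i' j' - P ε i j :=
    fun μ i j i' j' => by simp only [P]; fun_prop
  have ev : ∀ᶠ ε in 𝓝[>] (0 : ℝ), ∀ i ∈ Finset.Icc (-R : ℤ) R, ∀ j ∈ Finset.Icc (-R : ℤ) R,
      ∀ i' ∈ Finset.Icc (-R : ℤ) R, ∀ j' ∈ Finset.Icc (-R : ℤ) R,
      ((2 : ℝ) ^ i / 2 / 2 ^ i') • P ε i' j' - P ε i j ∉ closure U ∧
      ((2 : ℝ) ^ j / 2 / 2 ^ j') • P ε i' j' - P ε i j ∉ closure U := by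
    simp only [Filter.eventually_all_finset]
    intro i _ j _ i' _ j' _
    refine nhdsWithin_le_nhds (Eventually.and ?_ ?_)
    · refine (cont _ i j i' j').continuousAt.eventually_mem
        (isClosed_closure.isOpen_compl.mem_nhds fun h => ?_)
      have := (hab (((2 : ℝ) ^ i / 2 / 2 ^ i') * 2 ^ i' - 2 ^ i)
        (((2 : ℝ) ^ i / 2 / 2 ^ i') * 2 ^ j' - 2 ^ j) (by
          convert h using 1; simp only [P]; module)).1
      rw [div_mul_cancel₀ _ (by positivity)] at this
      have := zpow_pos (two_pos (α := ℝ)) i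
      linarith
    · refine (cont _ i j i' j').continuousAt.eventually_mem
        (isClosed_closure.isOpen_compl.mem_nhds fun h => ?_)
      have := (hab (((2 : ℝ) ^ j / 2 / 2 ^ j') * 2 ^ i' - 2 ^ i)
        (((2 : ℝ) ^ j / 2 / 2 ^ j') * 2 ^ j' - 2 ^ j) (by
          convert h using 1; simp only [P]; module)).2
      rw [div_mul_cancel₀ _ (by positivity)] at this
      have := zpow_pos (two_pos (α := ℝ)) j
      linarith
  obtain ⟨ε, hε, hε0⟩ := (ev.and self_mem_nhdsWithin).exists
  have hε0 : 0 < ε := hε0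
  have hPU : ∀ i j, P ε i j ∈ U := fun i j => by
    have := hU.add_mem_of_closure (hU.smul_mem ho hε0)
      (hU.closure_add (hU.closure_smul ha (r := (2 : ℝ) ^ i) (by positivity))
        (hU.closure_smul hb (r := (2 : ℝ) ^ j) (by positivity)))
    rwa [add_comm] at this
  refine ⟨P ε, hPU, fun i j i' j' h => ?_, fun i j i' j' hi hj hi' hj' μ hμ => ?_⟩
  · have le : ∀ i i' : ℤ, (i - i').natAbs ≤ 1 → 0 ≤ 2 * (2 : ℝ) ^ i - 2 ^ i' := by
      intro i i' h
      have h1 : (2 : ℝ) ^ i' ≤ 2 ^ (i + 1) := zpow_le_zpow_right₀ one_le_two (by omega)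
      rw [zpow_add_one₀ two_ne_zero] at h1
      linarith
    have := hU.closure_add (hU.closure_add (hU.closure_smul ha (le i i' (by omega)))
        (hU.closure_smul hb (le j j' (by omega)))) (subset_closure (hU.smul_mem ho hε0))
    convert this using 1
    simp only [P]
    module
  · have mem : ∀ k : ℤ, k.natAbs ≤ R → k ∈ Finset.Icc (-R : ℤ) R := fun k hk => by
      rw [Finset.mem_Icc]; omega
    have h := hε i (mem i hi) j (mem j hj) i' (mem i' hi') j' (mem j' hj')
    have lem : ∀ ν : ℝ, ν • P ε i' j' - P ε i j ∉ closure U → ν < μ := by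
      intro ν hν
      by_contra! hc
      apply hν
      convert hU.closure_add hμ (hU.closure_smul (subset_closure (hPU i' j')) (sub_nonneg.2 hc))
        using 1
      module
    have l1 := lem _ h.1
    have l2 := lem _ h.2
    rw [div_lt_iff₀ (by positivity)] at l1 l2
    refine ⟨by linarith, by linarith, ?_⟩
    have h0 : 0 ≤ ψ (μ • P ε i' j' - P ε i j) :=
      closure_minimal (t := {z | 0 ≤ ψ z}) (fun z hz => (ψo z hz).le)
        (isClosed_le (by fun_prop) (by fun_prop)) hμ
    simp only [P, map_sub, map_smul, map_add, ψa, ψb, smul_eq_mul] at h0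
    have := mul_pos hε0 (ψo o ho)
    nlinarith

end SharpCone

/-- The closure of the bent cone has no flat faces. -/
lemma Flag.no_face {hd : 1 ≤ d} (X : Flag (rootWalls hd)) (hU : SharpCone X.U) {v w : Vec d}
    (hvw : LinearIndependent ℝ ![v, w]) (hv : v ∈ closure X.U) (hw : w ∈ closure X.U) :
    v + w ∈ X.U := by
  by_contra hc
  obtain ⟨a, ha, b, hb, ψ, ψa, ψb, ψo, hab⟩ := hU.exists_face hvw hv hw hc
  obtain ⟨o, ho⟩ := hU.nonempty
  obtain ⟨A, hA, hcmp⟩ := X.exists_comparison_log hU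
  obtain ⟨B, hB, hprop⟩ := X.exists_proper_bound hU
  have hl : 0 < Real.log 2 := Real.log_pos (by norm_num)
  have hlA : 0 ≤ Real.log A := Real.log_nonneg hA
  obtain ⟨R, hR⟩ := no_flat d (2 * (Real.log A / Real.log 2) * (2 / Real.log 2))
    (1 + 2 * (Real.log A / Real.log 2)) (Real.log B) (by positivity) (Real.log_nonneg hB)
  obtain ⟨p, hpU, hadj, hexp⟩ := hU.exists_grid ha hb ho ψa ψb ψo hab R
  have hex : ∀ i j, ∃ x ∈ hyp d, ∃ s : ℝ, 0 < s ∧ p i j = s • X.F x := by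
    intro i j
    have := hpU i j
    rw [← X.image_F] at this
    obtain ⟨y, hy, hyp⟩ := this
    obtain ⟨x, hx, s, hs, rfl⟩ := exists_hyp_smul hy
    exact ⟨x, hx, s, hs, by rw [← hyp, X.F_smul hx.1 hs]⟩
  choose x hx s hs hp using hex
  refine hR x (fun i j _ _ => hx i j) (fun i j i' j' _ _ _ _ h => ?_)
    (fun i j i' j' hi hj hi' hj' => ?_)
  · refine Real.log_le_log (by linarith [one_le_ch (hx i j) (hx i' j')])
      (hprop _ (hx i j) _ (hx i' j') (s i' j' / s i j) (div_pos (hs _ _) (hs _ _)) ?_ ?_)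
    · have := hU.closure_smul (hadj i' j' i j (by omega)) (inv_nonneg.2 (hs i j).le)
      rw [hp i j, hp i' j'] at this
      convert this using 1
      rw [smul_sub, smul_smul, smul_smul, smul_smul, smul_smul, inv_mul_cancel₀ (hs i j).ne',
        one_smul]
      congr 2
      field_simp
    · have := hU.closure_smul (hadj i j i' j' h) (inv_nonneg.2 (hs i j).le)
      rw [hp i j, hp i' j'] at this
      convert this using 1
      rw [smul_sub, smul_smul, smul_smul, smul_smul]
      have := (hs i j).ne'
      congr 2
      · field_simp
      · field_simp
  · obtain ⟨N, hN, h1, h2⟩ := hcmp _ (hx i j) _ (hx i' j')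
    have s1 := hs i j
    have s2 := hs i' j'
    have h1' := hU.closure_smul h1 s1.le
    have h2' := hU.closure_smul h2 s2.le
    have e1 := hexp i j i' j' hi hj hi' hj' (s i j * A ^ N / s i' j') (by
      convert h1' using 1
      rw [hp i j, hp i' j', smul_sub, smul_smul, smul_smul]
      congr 2
      field_simp)
    have e2 := hexp i' j' i j hi' hj' hi hj (s i' j' * A ^ N / s i j) (by
      convert h2' using 1
      rw [hp i j, hp i' j', smul_sub, smul_smul, smul_smul]
      congr 2
      field_simp)
    set μ := s i j * A ^ N / s i' j' with hμ
    set ν := s i' j' * A ^ N / s i j with hν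
    have hμν : μ * ν = A ^ (2 * N) := by
      rw [hμ, hν, two_mul, pow_add]; field_simp
    have main : ∀ k k' : ℤ, (2 : ℝ) ^ k ≤ 2 * μ * 2 ^ k' → (2 : ℝ) ^ k' ≤ 2 * ν * 2 ^ k →
        ((k - k').natAbs : ℝ) ≤ 2 * (Real.log A / Real.log 2) * (2 / Real.log 2) *
          Real.log (ch (x i j) (x i' j')) + (1 + 2 * (Real.log A / Real.log 2)) := by
      intro k k' hk hk'
      have hpow : (2 : ℝ) ^ (k - k').natAbs ≤ 2 * A ^ (2 * N) := by
        rw [← hμν]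
        rcases le_total k' k with hle | hle
        · have : (2 : ℝ) ^ (k - k').natAbs = 2 ^ (k - k') := by
            rw [← zpow_natCast]; congr 1; omega
          rw [this, zpow_sub₀ two_ne_zero, div_le_iff₀ (by positivity)]
          refine hk.trans ?_
          have : μ ≤ μ * ν := le_mul_of_one_le_right (by linarith [e1.2.2]) e2.2.2
          gcongr
        · have : (2 : ℝ) ^ (k - k').natAbs = 2 ^ (k' - k) := by
            rw [← zpow_natCast]; congr 1; omega
          rw [this, zpow_sub₀ two_ne_zero, div_le_iff₀ (by positivity)]
          refine hk'.trans ?_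
          have : ν ≤ μ * ν := le_mul_of_one_le_left (by linarith [e2.2.2]) e1.2.2
          gcongr
      have hlog := Real.log_le_log (by positivity) hpow
      rw [Real.log_pow, Real.log_mul two_ne_zero (by positivity), Real.log_pow] at hlog
      push_cast at hlog
      have h3 : ((k - k').natAbs : ℝ) ≤ 1 + 2 * N * (Real.log A / Real.log 2) := by
        rw [← mul_le_mul_iff_left₀ hl]
        refine hlog.trans_eq ?_
        field_simp
      have h4 : 2 * N * (Real.log A / Real.log 2) ≤
          2 * (1 + 2 * Real.log (ch (x i j) (x i' j')) / Real.log 2) * (Real.log A / Real.log 2) := by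
        gcongr
      refine (h3.trans (add_le_add_right h4 1)).trans_eq ?_
      ring
    exact ⟨main i i' e1.1 e2.1, main j j' e1.2.1 e2.2.1⟩

end BentDomain

namespace BentDomain
open Filter Topology
variable {d : ℕ}

/-- The projectivization map. -/
noncomputable def pmk (v : {v : Vec d // v ≠ 0}) : RP d := Projectivization.mk ℝ v.1 v.2

lemma continuous_pmk : Continuous (pmk (d := d)) :=
  continuous_quotient_mk' (s := projectivizationSetoid ℝ (Vec d))

lemma pmk_eq_iff {v w : {v : Vec d // v ≠ 0}} : pmk v = pmk w ↔ ∃ a : ℝ, a ≠ 0 ∧ a • w.1 = v.1 := by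
  rw [pmk, pmk, Projectivization.mk_eq_mk_iff]
  constructor
  · rintro ⟨a, ha⟩
    exact ⟨a, a.ne_zero, ha⟩
  · rintro ⟨a, ha, h⟩
    exact ⟨Units.mk0 a ha, h⟩

lemma isOpenMap_pmk : IsOpenMap (pmk (d := d)) := by
  intro V hV
  change IsOpen (pmk ⁻¹' (pmk '' V))
  have h : pmk ⁻¹' (pmk '' V) =
      ⋃ a : ℝˣ, (fun v : {v : Vec d // v ≠ 0} =>
        (⟨(a : ℝ) • v.1, smul_ne_zero a.ne_zero v.2⟩ : {v : Vec d // v ≠ 0})) ⁻¹' V := by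
    ext v
    simp only [Set.mem_preimage, Set.mem_image, Set.mem_iUnion]
    constructor
    · rintro ⟨w, hw, h⟩
      obtain ⟨a, ha, h⟩ := pmk_eq_iff.1 h
      refine ⟨Units.mk0 a ha, ?_⟩
      convert hw using 1
      exact Subtype.ext h
    · rintro ⟨a, ha⟩
      exact ⟨_, ha, pmk_eq_iff.2 ⟨a, a.ne_zero, rfl⟩⟩
  rw [h]
  exact isOpen_iUnion fun a => hV.preimage (by fun_prop)

lemma pmk_mem_projOfCone {C : Set (Vec d)} (hC : ∀ x ∈ C, ∀ t : ℝ, 0 < t → t • x ∈ C)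
    {v : {v : Vec d // v ≠ 0}} : pmk v ∈ projOfCone C ↔ v.1 ∈ C ∨ -v.1 ∈ C := by
  constructor
  · rintro ⟨w, hw, hwC, h⟩
    obtain ⟨a, ha, h⟩ := pmk_eq_iff (w := ⟨w, hw⟩).1 h
    change a • w = v.1 at h
    rcases ha.lt_or_gt with ha | ha
    · right
      rw [← h, ← neg_smul]
      exact hC w hwC _ (by linarith)
    · left
      rw [← h]
      exact hC w hwC _ ha
  · rintro (h | h)
    · exact ⟨v.1, v.2, h, rfl⟩
    · refine ⟨-v.1, neg_ne_zero.2 v.2, h, ?_⟩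
      exact pmk_eq_iff (w := ⟨-v.1, neg_ne_zero.2 v.2⟩).2 ⟨-1, by norm_num, by simp⟩

lemma projOfCone_eq_image (S : Set (Vec d)) : projOfCone S = pmk '' (Subtype.val ⁻¹' S) := by
  ext P
  constructor
  · rintro ⟨v, hv, hS, rfl⟩
    exact ⟨⟨v, hv⟩, hS, rfl⟩
  · rintro ⟨v, hS, rfl⟩
    exact ⟨v.1, v.2, hS, rfl⟩

lemma isCompact_projOfCone {S : Set (Vec d)} (hS : IsCompact S) (h0 : (0 : Vec d) ∉ S) :
    IsCompact (projOfCone S) := by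
  rw [projOfCone_eq_image]
  refine IsCompact.image ?_ continuous_pmk
  rw [Subtype.isCompact_iff]
  convert hS using 1
  ext x
  exact ⟨by rintro ⟨y, hy, rfl⟩; exact hy, fun h => ⟨⟨x, fun hx => h0 (hx ▸ h)⟩, h, rfl⟩⟩

lemma isOpen_projOfCone {S : Set (Vec d)} (hS : IsOpen S) : IsOpen (projOfCone S) := by
  rw [projOfCone_eq_image]
  exact isOpenMap_pmk _ (hS.preimage continuous_subtype_val)

/-- Compact subsets of the projectivization of an open set lift to compact sets. -/
lemma exists_compact_lift {C : Set (Vec d)} (hC : IsOpen C) {K : Set (RP d)} (hK : IsCompact K)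
    (hKC : K ⊆ projOfCone C) : ∃ S ⊆ C, IsCompact S ∧ (0 : Vec d) ∉ S ∧ K ⊆ projOfCone S := by
  obtain ⟨S, h1, h2, h3, h4⟩ : ∃ S ⊆ C, IsCompact S ∧ (0 : Vec d) ∉ S ∧ K ∩ K ⊆ projOfCone S := by
    refine hK.induction_on (p := fun s => ∃ S ⊆ C, IsCompact S ∧ (0 : Vec d) ∉ S ∧
      s ∩ K ⊆ projOfCone S) ⟨∅, by simp, isCompact_empty, by simp, by simp⟩ ?_ ?_ ?_
    · rintro s t hst ⟨S, h1, h2, h3, h4⟩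
      exact ⟨S, h1, h2, h3, (Set.inter_subset_inter_left _ hst).trans h4⟩
    · rintro s t ⟨S, h1, h2, h3, h4⟩ ⟨T, k1, k2, k3, k4⟩
      refine ⟨S ∪ T, Set.union_subset h1 k1, h2.union k2, by simp [h3, k3], ?_⟩
      rintro P ⟨hP | hP, hPK⟩
      · obtain ⟨v, hv, hvS, rfl⟩ := h4 ⟨hP, hPK⟩
        exact ⟨v, hv, .inl hvS, rfl⟩
      · obtain ⟨v, hv, hvS, rfl⟩ := k4 ⟨hP, hPK⟩
        exact ⟨v, hv, .inr hvS, rfl⟩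
    · intro P hP
      obtain ⟨v, hv, hvC, rfl⟩ := hKC hP
      obtain ⟨ε, hε, hsub⟩ := Metric.nhds_basis_closedBall.mem_iff.1
        ((hC.inter isOpen_compl_singleton).mem_nhds (x := v) ⟨hvC, hv⟩)
      refine ⟨projOfCone (Metric.ball v ε), mem_nhdsWithin_of_mem_nhds
        ((isOpen_projOfCone Metric.isOpen_ball).mem_nhds ⟨v, hv, Metric.mem_ball_self hε, rfl⟩),
        Metric.closedBall v ε, fun x hx => (hsub hx).1, isCompact_closedBall _ _,
        fun h => (hsub h).2 rfl, ?_⟩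
      rintro _ ⟨⟨w, hw, hwB, rfl⟩, -⟩
      exact ⟨w, hw, Metric.ball_subset_closedBall hwB, rfl⟩
  exact ⟨S, h1, h2, h3, by rwa [Set.inter_self] at h4⟩

namespace SharpCone

variable {U : Set (Vec d)} (hU : SharpCone U)
include hU

lemma isProperlyConvexDomain : IsProperlyConvexDomain (projOfCone U) := by
  refine ⟨U, ⟨hU.nonempty, hU.isOpen, hU.convex, fun x hx t ht => hU.smul_mem hx ht, ?_⟩, rfl⟩
  rintro ⟨x, v, hv, h⟩
  obtain ⟨ψ, δ, hδ, hψ⟩ := hU.coercive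
  have h1 := hψ _ (h ((‖x‖ + ψ x / δ + 1) / ‖v‖))
  have h2 := hψ _ (h (-((‖x‖ + ψ x / δ + 1) / ‖v‖)))
  have hv' : 0 < ‖v‖ := norm_pos_iff.2 hv
  have hx : 0 ≤ ψ x := (by positivity : 0 ≤ δ * ‖x‖).trans (by simpa using hψ _ (h 0))
  set t := (‖x‖ + ψ x / δ + 1) / ‖v‖ with ht
  have htv : t * ‖v‖ = ‖x‖ + ψ x / δ + 1 := div_mul_cancel₀ _ hv'.ne'
  have ht0 : 0 ≤ t := by positivity
  have n1 : t * ‖v‖ - ‖x‖ ≤ ‖x + t • v‖ := by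
    have := norm_sub_le (x + t • v) x
    rw [add_sub_cancel_left, norm_smul, Real.norm_of_nonneg ht0] at this
    linarith
  have n2 : t * ‖v‖ - ‖x‖ ≤ ‖x + -t • v‖ := by
    have := norm_sub_le (x + -t • v) x
    rw [add_sub_cancel_left, norm_smul, norm_neg, Real.norm_of_nonneg ht0] at this
    linarith
  rw [htv] at n1 n2
  simp only [map_add, map_smul, smul_eq_mul] at h1 h2
  have m1 := mul_le_mul_of_nonneg_left n1 hδ.le
  have m2 := mul_le_mul_of_nonneg_left n2 hδ.le
  have e : δ * (‖x‖ + ψ x / δ + 1 - ‖x‖) = ψ x + δ := by field_simp; ring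
  rw [e] at m1 m2
  linarith

/-- A sharp cone without flat faces projects to a strictly convex domain. -/
lemma isStrictlyConvexDomain
    (h : ∀ v w : Vec d, LinearIndependent ℝ ![v, w] → v ∈ closure U → w ∈ closure U → v + w ∈ U) :
    IsStrictlyConvexDomain (projOfCone U) := by
  intro v w hvw hf
  have hne : ∀ t : ℝ, t • v + (1 - t) • w ≠ 0 := by
    intro t ht
    have := LinearIndependent.pair_iff.1 hvw _ _ ht
    linarith [this.1, this.2]
  have hcone : ∀ x ∈ U, ∀ t : ℝ, 0 < t → t • x ∈ U := fun x hx t ht => hU.smul_mem hx ht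
  have hcl : ∀ t ∈ Set.Icc (0 : ℝ) 1,
      t • v + (1 - t) • w ∈ closure U ∨ -(t • v + (1 - t) • w) ∈ closure U := by
    intro t ht
    have h1 : pmk ⟨_, hne t⟩ ∈ closure (projOfCone U) := frontier_subset_closure (hf t ht (hne t))
    have h2 : (⟨_, hne t⟩ : {v : Vec d // v ≠ 0}) ∈ closure (pmk ⁻¹' projOfCone U) := by
      rw [← isOpenMap_pmk.preimage_closure_eq_closure_preimage continuous_pmk]
      exact h1
    have h3 := map_mem_closure continuous_subtype_val (t := U ∪ Neg.neg ⁻¹' U) h2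
      fun x hx => (pmk_mem_projOfCone hcone).1 hx
    rw [closure_union] at h3
    refine h3.imp id fun h3 => ?_
    exact map_mem_closure continuous_neg h3 fun _ hx => hx
  have hmid : ∀ t ∈ Set.Icc (0 : ℝ) 1,
      t • v + (1 - t) • w ∉ U ∧ -(t • v + (1 - t) • w) ∉ U := by
    intro t ht
    have h1 : pmk ⟨_, hne t⟩ ∉ projOfCone U := fun h1 => by
      have := hf t ht (hne t)
      rw [(isOpen_projOfCone hU.isOpen).frontier_eq] at this
      exact this.2 h1
    rw [pmk_mem_projOfCone hcone] at h1
    push Not at h1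
    exact h1
  have hsign : (∀ t ∈ Set.Icc (0 : ℝ) 1, t • v + (1 - t) • w ∈ closure U) ∨
      (∀ t ∈ Set.Icc (0 : ℝ) 1, -(t • v + (1 - t) • w) ∈ closure U) := by
    by_contra! hc
    obtain ⟨⟨t, ht, h1⟩, ⟨s, hs, h2⟩⟩ := hc
    have c1 : IsClosed {t : ℝ | t • v + (1 - t) • w ∈ closure U} :=
      isClosed_closure.preimage (by fun_prop)
    have c2 : IsClosed {t : ℝ | -(t • v + (1 - t) • w) ∈ closure U} :=
      isClosed_closure.preimage (by fun_prop)
    obtain ⟨r, -, r1, r2⟩ := isPreconnected_closed_iff.1 isPreconnected_Icc _ _ c1 c2 hcl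
      ⟨s, hs, (hcl s hs).resolve_right h2⟩ ⟨t, ht, (hcl t ht).resolve_left h1⟩
    exact hne r (hU.eq_zero_of_neg_mem r1 r2)
  have half : ((1 / 2 : ℝ) • v + (1 - 1 / 2 : ℝ) • w) = (1 / 2 : ℝ) • (v + w) := by module
  have mh := hmid (1 / 2) (by constructor <;> norm_num)
  rw [half] at mh
  rcases hsign with hs | hs
  · have h1 := hs 1 (by simp)
    have h0 := hs 0 (by simp)
    have := hU.smul_mem (h v w hvw (by simpa using h1) (by simpa using h0)) (r := 1 / 2) (by norm_num)
    exact mh.1 this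
  · have h1 := hs 1 (by simp)
    have h0 := hs 0 (by simp)
    have hvw' : LinearIndependent ℝ ![-v, -w] := by
      rw [LinearIndependent.pair_iff] at hvw ⊢
      intro s t hst
      have := hvw (-s) (-t) (by rw [← hst]; module)
      simpa using this
    have := hU.smul_mem (h (-v) (-w) hvw' (by simpa using h1) (by simpa using h0)) (r := 1 / 2)
      (by norm_num)
    refine mh.2 ?_
    convert this using 1
    module

end SharpCone
end BentDomain

namespace BentDomain
open Filter Topology Matrix
variable {d : ℕ}

lemma projMap_pmk (g : GL (Fin (d + 1)) ℝ) {v : Vec d} (hv : v ≠ 0) (h : g.1 *ᵥ v ≠ 0) :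
    projMap g (pmk ⟨v, hv⟩) = pmk ⟨g.1 *ᵥ v, h⟩ := rfl

lemma mulVec_inv_mulVec (g : GL (Fin (d + 1)) ℝ) (v : Vec d) : (g⁻¹).1 *ᵥ (g.1 *ᵥ v) = v := by
  rw [mulVec_mulVec, ← Units.val_mul, inv_mul_cancel, Units.val_one, one_mulVec]

lemma mulVec_mulVec_inv (g : GL (Fin (d + 1)) ℝ) (v : Vec d) : g.1 *ᵥ ((g⁻¹).1 *ᵥ v) = v := by
  rw [mulVec_mulVec, ← Units.val_mul, mul_inv_cancel, Units.val_one, one_mulVec]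

lemma mulVec_ne_zero (g : GL (Fin (d + 1)) ℝ) {v : Vec d} (hv : v ≠ 0) : g.1 *ᵥ v ≠ 0 := by
  intro h
  apply hv
  rw [← mulVec_inv_mulVec g v, h, mulVec_zero]

lemma map_mem_fut {γ : Vec d ≃ₗ[ℝ] Vec d} (hγ : γ ∈ futGroup d) {x : Vec d} (hx : x ∈ fut d) :
    γ x ∈ fut d := (hγ.2 x).2 hx

/-- A matrix whose action on the bent cone represents `γ` up to a positive factor. -/
def Represents {hd : 1 ≤ d} (O : Flag (rootWalls hd)) (g : GL (Fin (d + 1)) ℝ)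
    (γ : Vec d ≃ₗ[ℝ] Vec d) : Prop :=
  γ ∈ futGroup d ∧ ∃ r : ℝ, 0 < r ∧ ∀ x ∈ fut d, O.F (γ x) = r • (g.1 *ᵥ O.F x)

/-- The holonomy group of the bent cone, normalized to determinant `±1`. -/
def holGroup {hd : 1 ≤ d} (O : Flag (rootWalls hd)) : Subgroup (GL (Fin (d + 1)) ℝ) where
  carrier := {g | detPM1 g ∧ ∃ γ, Represents O g γ}
  mul_mem' := by
    rintro g h ⟨dg, γ, hγ, r, hr, hg⟩ ⟨dh, η, hη, s, hs, hh⟩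
    refine ⟨?_, γ * η, mul_mem hγ hη, r * s, mul_pos hr hs, fun x hx => ?_⟩
    · rw [detPM1, Units.val_mul, det_mul]
      rcases dg with h1 | h1 <;> rcases dh with h2 | h2 <;> simp [h1, h2]
    · rw [LinearEquiv.mul_apply, hg _ (map_mem_fut hη hx), hh x hx, mulVec_smul, smul_smul,
        mulVec_mulVec, Units.val_mul]
  one_mem' := by
    refine ⟨.inl (by simp), 1, one_mem _, 1, one_pos, fun x _ => ?_⟩
    simp
  inv_mem' := by
    rintro g ⟨dg, γ, hγ, r, hr, hg⟩
    refine ⟨?_, γ⁻¹, inv_mem hγ, r⁻¹, inv_pos.2 hr, fun x hx => ?_⟩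
    · have h : g.1.det * (g⁻¹).1.det = 1 := by
        rw [← det_mul, ← Units.val_mul, mul_inv_cancel, Units.val_one, det_one]
      rcases dg with h1 | h1 <;> rw [h1] at h
      · exact .inl (by linarith)
      · exact .inr (by linarith)
    · have hy := map_mem_fut (inv_mem hγ) hx
      have e := hg _ hy
      rw [← LinearEquiv.mul_apply, mul_inv_cancel, LinearEquiv.coe_one, id] at e
      rw [e, mulVec_smul, mulVec_inv_mulVec, smul_smul, inv_mul_cancel₀ hr.ne', one_smul]

variable {hd : 1 ≤ d} {O : Flag (rootWalls hd)}

lemma ne_zero_of_mem_U {v : Vec d} (hv : v ∈ O.U) : v ≠ 0 := by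
  rintro rfl
  obtain ⟨y, hy, hy0⟩ := (O.image_F ▸ hv : (0 : Vec d) ∈ O.F '' fut d)
  have hy2 : (2 : ℝ) • y ∈ fut d := smul_mem_fut hy two_pos
  have e := O.injOn_F hy2 hy (by rw [O.F_smul hy two_pos, hy0, smul_zero])
  have e3 : (2 : ℝ) • y - y = y := by module
  rw [e, sub_self] at e3
  exact ne_zero_of_mem_fut hy e3.symm

/-- Every automorphism in the lattice is represented in the holonomy group. -/
lemma exists_represents {γ : Vec d ≃ₗ[ℝ] Vec d} (hγ : γ ∈ futGroup d) :
    ∃ g ∈ holGroup O, Represents O g γ := by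
  have hA := isAut_of_mem hd hγ
  set M := LinearMap.toMatrix' (Flag.hol hA O : Vec d →ₗ[ℝ] Vec d) with hM
  have hM0 : M.det ≠ 0 := by
    rw [hM, LinearMap.det_toMatrix']
    exact (LinearEquiv.isUnit_det' _).ne_zero
  set c : ℝ := |M.det| ^ (-((d + 1 : ℕ) : ℝ)⁻¹) with hc
  have hc0 : 0 < c := Real.rpow_pos_of_pos (abs_pos.2 hM0) _
  have hcd : c ^ (d + 1) = |M.det|⁻¹ := by
    rw [hc, ← Real.rpow_natCast, ← Real.rpow_mul (abs_nonneg _), neg_mul,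
      inv_mul_cancel₀ (by positivity), Real.rpow_neg_one]
  have hdet : (c • M).det = |M.det|⁻¹ * M.det := by
    rw [det_smul, Fintype.card_fin, hcd]
  have hdet' : (c • M).det = 1 ∨ (c • M).det = -1 := by
    rw [hdet]
    rcases abs_choice M.det with h | h <;> rw [h]
    · exact .inl (inv_mul_cancel₀ hM0)
    · right
      field_simp
  set g : GL (Fin (d + 1)) ℝ := GeneralLinearGroup.mkOfDetNeZero (c • M)
    (by rcases hdet' with h | h <;> rw [h] <;> norm_num) with hg
  have hr : Represents O g γ := by
    refine ⟨hγ, c⁻¹, inv_pos.2 hc0, fun x hx => ?_⟩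
    change _ = c⁻¹ • ((c • M) *ᵥ O.F x)
    rw [smul_mulVec, smul_smul, inv_mul_cancel₀ hc0.ne', one_smul, Flag.F_map hA O hx, hM,
      LinearMap.toMatrix'_mulVec]
    rfl
  have hdg : detPM1 g := hdet'
  exact ⟨g, ⟨hdg, γ, hr⟩, hr⟩

lemma mulVec_mem_U {g : GL (Fin (d + 1)) ℝ} (hg : g ∈ holGroup O) {z : Vec d} (hz : z ∈ O.U) :
    g.1 *ᵥ z ∈ O.U := by
  obtain ⟨-, γ, hγ, r, hr, h⟩ := hg
  rw [← O.image_F] at hz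
  obtain ⟨x, hx, rfl⟩ := hz
  have := O.smul_mem_U (O.F_mem_U (map_mem_fut hγ hx)) (inv_pos.2 hr)
  rwa [h x hx, smul_smul, inv_mul_cancel₀ hr.ne', one_smul] at this

lemma preservesDomain : PreservesDomain (holGroup O) (projOfCone O.U) := by
  have sub : ∀ g ∈ holGroup O, ∀ P ∈ projOfCone O.U, projMap g P ∈ projOfCone O.U := by
    rintro g hg _ ⟨v, hv, hvU, rfl⟩
    exact ⟨_, mulVec_ne_zero g hv, mulVec_mem_U hg hvU, rfl⟩
  intro g hg
  refine Set.Subset.antisymm (by rintro _ ⟨P, hP, rfl⟩; exact sub g hg P hP) ?_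
  rintro _ ⟨v, hv, hvU, rfl⟩
  refine ⟨_, ⟨_, mulVec_ne_zero g⁻¹ hv, mulVec_mem_U (inv_mem hg) hvU, rfl⟩, ?_⟩
  refine (projMap_pmk g (mulVec_ne_zero g⁻¹ hv)
    (mulVec_ne_zero g (mulVec_ne_zero g⁻¹ hv))).trans ?_
  exact congrArg pmk (Subtype.ext (mulVec_mulVec_inv g v) :
    (⟨_, mulVec_ne_zero g (mulVec_ne_zero g⁻¹ hv)⟩ : {v : Vec d // v ≠ 0}) = ⟨v, hv⟩)

/-- Radial projection to the hyperboloid. -/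
noncomputable def nrm (y : Vec d) : Vec d := (√(-lor y y))⁻¹ • y

lemma nrm_pos {y : Vec d} (hy : y ∈ fut d) : 0 < (√(-lor y y))⁻¹ := by
  have := lor_neg_of_mem_fut hy hy
  exact inv_pos.2 (Real.sqrt_pos.2 (by linarith))

lemma nrm_mem {y : Vec d} (hy : y ∈ fut d) : nrm y ∈ fut d := smul_mem_fut hy (nrm_pos hy)

lemma nrm_smul {y : Vec d} {r : ℝ} (hr : 0 < r) : nrm (r • y) = nrm y := by
  have : -lor (r • y) (r • y) = r ^ 2 * -lor y y := by
    rw [lor_smul_left, lor_smul_right]; ring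
  rw [nrm, nrm, this, Real.sqrt_mul (by positivity), Real.sqrt_sq hr.le, smul_smul, mul_inv,
    mul_right_comm, inv_mul_cancel₀ hr.ne', one_mul]

lemma map_nrm {γ : Vec d ≃ₗ[ℝ] Vec d} (hγ : IsAut (rootWalls hd) γ) (y : Vec d) :
    γ (nrm y) = nrm (γ y) := by
  rw [nrm, nrm, map_smul, hγ.lor]

lemma continuousOn_nrm : ContinuousOn (nrm (d := d)) (fut d) := by
  have hc : Continuous fun y : Vec d => √(-lor y y) := by fun_prop
  unfold nrm
  refine ContinuousOn.smul (ContinuousOn.inv₀ hc.continuousOn fun y hy => ?_) continuousOn_id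
  exact (inv_pos.1 (nrm_pos hy)).ne'

/-- The matrix is determined by the automorphism which it represents. -/
lemma Represents.unique {g h : GL (Fin (d + 1)) ℝ} (dg : detPM1 g) (dh : detPM1 h)
    {γ : Vec d ≃ₗ[ℝ] Vec d} (hg : Represents O g γ) (hh : Represents O h γ) : g = h := by
  obtain ⟨hγ, r, hr, hg⟩ := hg
  obtain ⟨-, s, hs, hh⟩ := hh
  have hU : ∀ z ∈ O.U, (r • g.1) *ᵥ z = (s • h.1) *ᵥ z := by
    intro z hz
    rw [← O.image_F] at hz
    obtain ⟨x, hx, rfl⟩ := hz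
    rw [smul_mulVec, smul_mulVec, ← hg x hx, ← hh x hx]
  have hspan : ∀ v : Vec d, (r • g.1) *ᵥ v = (s • h.1) *ᵥ v := by
    intro v
    have ho : O.F O.pt ∈ O.U := O.F_mem_U O.mem
    have hev : ∀ᶠ t : ℝ in 𝓝 0, O.F O.pt + t • v ∈ O.U := by
      have hc : Continuous fun t : ℝ => O.F O.pt + t • v := by fun_prop
      exact hc.continuousAt.eventually (by simpa using O.isOpen_U.mem_nhds ho)
    obtain ⟨t, ht, ht0⟩ := ((hev.filter_mono nhdsWithin_le_nhds).and
      (self_mem_nhdsWithin (s := Set.Ioi (0 : ℝ)))).exists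
    have e := hU _ ht
    rw [mulVec_add, mulVec_add, hU _ ho, add_right_inj, mulVec_smul, mulVec_smul] at e
    exact smul_right_injective _ (ne_of_gt ht0) e
  have hm : r • g.1 = s • h.1 := by
    apply Matrix.toLin'.injective
    refine LinearMap.ext fun v => ?_
    rw [Matrix.toLin'_apply, Matrix.toLin'_apply, hspan]
  have hrs : r = s := by
    have e := congrArg (fun M => |det M|) hm
    have ag : |det g.1| = 1 := by rcases dg with h | h <;> rw [h] <;> simp
    have ah : |det h.1| = 1 := by rcases dh with h | h <;> rw [h] <;> simp
    simp only [det_smul, abs_mul, ag, ah, abs_pow, abs_of_pos hr, abs_of_pos hs, mul_one] at e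
    exact (pow_left_inj₀ hr.le hs.le (by simp)).1 e
  subst hrs
  exact Units.ext (smul_right_injective _ hr.ne' hm)

/-- Only finitely many holonomies identify points of a compact set, projectively. -/
lemma finite_holGroup (hU : SharpCone O.U) {S : Set (Vec d)} (hS : IsCompact S) (hSU : S ⊆ O.U) :
    {g | g ∈ holGroup O ∧ ∃ v ∈ S, ∃ w ∈ S, ∃ a : ℝ, a ≠ 0 ∧ a • w = g.1 *ᵥ v}.Finite := by
  set T := nrm '' {y | y ∈ fut d ∧ O.F y ∈ S} with hT
  have hTc : IsCompact T := (O.isCompact_preimage_F hS hSU).image_of_continuousOn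
    (continuousOn_nrm.mono fun y hy => hy.1)
  have hTf : T ⊆ fut d := by
    rintro _ ⟨y, hy, rfl⟩
    exact nrm_mem hy.1
  have hch : ∀ g : GL (Fin (d + 1)) ℝ, ∃ γ, g ∈ holGroup O → Represents O g γ := by
    intro g
    by_cases hg : g ∈ holGroup O
    · exact ⟨hg.2.choose, fun _ => hg.2.choose_spec⟩
    · exact ⟨1, fun h => absurd h hg⟩
  choose f hf using hch
  refine Set.Finite.of_injOn (f := f) (t := {γ | γ ∈ futGroup d ∧ ∃ x ∈ T, γ x ∈ T}) ?_ ?_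
    (finite_futGroup hTc hTf)
  · rintro g ⟨hg, v, hv, w, hw, a, ha, h⟩
    obtain ⟨hγ, r, hr, hrep⟩ := hf g hg
    have hvU := hSU hv
    have hwU := hSU hw
    have haw : a • w ∈ O.U := h ▸ mulVec_mem_U hg hvU
    have ha' : 0 < a := by
      refine ha.lt_or_gt.resolve_left fun hn => ?_
      have h1 := hU.smul_mem hwU (neg_pos.2 hn)
      rw [neg_smul] at h1
      have h3 := hU.eq_zero_of_neg_mem (subset_closure haw) (subset_closure h1)
      exact smul_ne_zero ha (ne_zero_of_mem_U hwU) h3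
    obtain ⟨y, hy, rfl⟩ := (O.image_F ▸ hvU : v ∈ O.F '' fut d)
    obtain ⟨z, hz, rfl⟩ := (O.image_F ▸ hwU : w ∈ O.F '' fut d)
    have e := hrep y hy
    rw [← h, smul_smul, ← O.F_smul hz (mul_pos hr ha')] at e
    have e' := O.injOn_F (map_mem_fut hγ hy) (smul_mem_fut hz (mul_pos hr ha')) e
    refine ⟨hγ, nrm y, ⟨y, ⟨hy, hv⟩, rfl⟩, z, ⟨hz, hw⟩, ?_⟩
    rw [map_nrm (isAut_of_mem hd hγ), e', nrm_smul (mul_pos hr ha')]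
  · rintro g ⟨hg, -⟩ h ⟨hh, -⟩ e
    exact (hf g hg).unique hg.1 hh.1 (e ▸ hf h hh)

lemma properlyDiscontinuousOn (hU : SharpCone O.U) :
    ProperlyDiscontinuousOn (holGroup O) (projOfCone O.U) := by
  intro K hKU hK
  obtain ⟨S, hSU, hS, h0, hKS⟩ := exists_compact_lift O.isOpen_U hK hKU
  refine Set.Finite.of_injOn (f := Subtype.val) ?_ Subtype.val_injective.injOn
    (finite_holGroup hU hS hSU)
  rintro ⟨g, hg⟩ ⟨Q, ⟨P, hP, rfl⟩, hQ⟩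
  obtain ⟨v, hv, hvS, rfl⟩ := hKS hP
  obtain ⟨w, hw, hwS, h⟩ := hKS hQ
  obtain ⟨a, ha, h⟩ := (pmk_eq_iff (v := ⟨_, mulVec_ne_zero g hv⟩) (w := ⟨w, hw⟩)).1 h
  exact ⟨hg, v, hvS, w, hwS, a, ha, h⟩

lemma discreteTopology_holGroup (hU : SharpCone O.U) : DiscreteTopology (holGroup O) := by
  have ho : O.F O.pt ∈ O.U := O.F_mem_U O.mem
  obtain ⟨ε, hε, hsub⟩ := Metric.nhds_basis_closedBall.mem_iff.1 (O.isOpen_U.mem_nhds ho)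
  set V : Set (holGroup O) := {g | g.1.1 *ᵥ O.F O.pt ∈ Metric.ball (O.F O.pt) ε} with hV
  have hVo : IsOpen V := by
    refine Metric.isOpen_ball.preimage ?_
    have : Continuous fun g : holGroup O => (g.1.1 : Matrix (Fin (d + 1)) (Fin (d + 1)) ℝ) :=
      Units.continuous_val.comp continuous_subtype_val
    exact this.matrix_mulVec continuous_const
  have hVf : V.Finite := by
    refine Set.Finite.of_injOn (f := Subtype.val) ?_ Subtype.val_injective.injOn
      (finite_holGroup hU (isCompact_closedBall (O.F O.pt) ε) hsub)
    rintro ⟨g, hg⟩ h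
    exact ⟨hg, _, Metric.mem_closedBall_self hε.le, _, Metric.ball_subset_closedBall h, 1,
      one_ne_zero, one_smul _ _⟩
  have h1 : (1 : holGroup O) ∈ V := by simp [hV, hε]
  apply discreteTopology_of_isOpen_singleton_one
  have : ({1} : Set (holGroup O)) = V \ (V \ {1}) := by simp [h1]
  rw [this]
  exact hVo.sdiff (hVf.subset Set.sdiff_subset).isClosed

lemma cocompactOn : CocompactOn (holGroup O) (projOfCone O.U) := by
  obtain ⟨K, hKf, hK, -, hcov⟩ := exists_compact_futGroup d
  have h0 : ∀ x ∈ fut d, O.F x ≠ 0 := fun x hx => ne_zero_of_mem_U (O.F_mem_U hx)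
  refine ⟨projOfCone (O.F '' K), isCompact_projOfCone
    (hK.image_of_continuousOn (O.continuousOn_F.mono hKf)) ?_, ?_, ?_⟩
  · rintro ⟨x, hx, h⟩
    exact h0 x (hKf hx) h
  · rintro _ ⟨_, hv, ⟨x, hx, rfl⟩, rfl⟩
    exact ⟨_, hv, O.F_mem_U (hKf hx), rfl⟩
  · apply Set.Subset.antisymm
    · refine Set.iUnion₂_subset fun g hg => ?_
      rw [← preservesDomain g hg]
      refine Set.image_mono ?_
      rintro _ ⟨_, hv, ⟨x, hx, rfl⟩, rfl⟩
      exact ⟨_, hv, O.F_mem_U (hKf hx), rfl⟩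
    · rintro _ ⟨v, hv, hvU, rfl⟩
      rw [← O.image_F] at hvU
      obtain ⟨y, hy, rfl⟩ := hvU
      obtain ⟨x, hx, s, hs, rfl⟩ := exists_hyp_smul hy
      obtain ⟨γ, hγ, hγK⟩ := hcov x hx.1 hx.2
      obtain ⟨g, hg, -, r, hr, hrep⟩ := exists_represents (O := O) hγ
      simp only [Set.mem_iUnion]
      refine ⟨g⁻¹, inv_mem hg, _, ⟨_, h0 _ (hKf hγK), ⟨_, hγK, rfl⟩, rfl⟩, ?_⟩
      refine (pmk_eq_iff (v := ⟨_, mulVec_ne_zero g⁻¹ (h0 _ (hKf hγK))⟩) (w := ⟨_, hv⟩)).2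
        ⟨r * s⁻¹, (mul_pos hr (inv_pos.2 hs)).ne', ?_⟩
      change (r * s⁻¹) • O.F (s • x) = (g⁻¹).1 *ᵥ O.F (γ x)
      rw [hrep x hx.1, mulVec_smul, mulVec_inv_mulVec, O.F_smul hx.1 hs, smul_smul,
        inv_mul_cancel_right₀ hs.ne']

lemma divides (hU : SharpCone O.U) : Divides (holGroup O) (projOfCone O.U) :=
  ⟨fun _ hg => hg.1, discreteTopology_holGroup hU, preservesDomain, properlyDiscontinuousOn hU,
    cocompactOn⟩

end BentDomain

namespace BentDomain
open Matrix
variable {d : ℕ} {hd : 1 ≤ d} {O : Flag (rootWalls hd)}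

/-- The bent cone seen from a point with walls on both sides is sharp. -/
lemma sharpCone_U (hO : O.pt = basePt d) : SharpCone O.U := by
  obtain ⟨n, hn, n₁, hn₁, n₂, hn₂, y₁, hy₁, y₂, hy₂, h0, h1, h2, hp₁, hp₂⟩ := exists_walls hd
  refine ⟨O.isOpen_U, ⟨_, O.F_mem_U O.mem⟩, fun hx hy => O.add_mem_U hx hy,
    fun hx hr => O.smul_mem_U hx hr, ?_⟩
  have hc : O.Cyl n := Flag.cyl_of_wall hn (by rw [hO, h0])
  obtain ⟨n', hne, hc'⟩ : ∃ n', n' ≠ n ∧ O.Cyl n' := by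
    rcases Int.units_eq_one_or (O.side n) with hs | hs
    · exact Flag.exists_cyl_ne (X := O) (n := n) hn₁ hy₁ h1 (by simpa [hs] using hp₁)
    · exact Flag.exists_cyl_ne (X := O) (n := n) hn₂ hy₂ h2 (by simpa [hs] using hp₂)
  obtain ⟨ψ, δ, hδ, h⟩ := Flag.exists_functional hc hc' hne.symm
  exact ⟨LinearMap.toContinuousLinearMap ψ, δ, hδ, h⟩

/-- The standard Minkowski form. -/
noncomputable def mink : Vec d →ₗ[ℝ] Vec d →ₗ[ℝ] ℝ :=
  LinearMap.mk₂ ℝ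
    (fun x y => ∑ i : Fin d, x i.castSucc * y i.castSucc - x (Fin.last d) * y (Fin.last d))
    (by intro x y z; simp [add_mul, Finset.sum_add_distrib]; ring)
    (by intro c x y; simp [mul_sub, Finset.mul_sum, mul_assoc])
    (by intro x y z; simp [mul_add, Finset.sum_add_distrib]; ring)
    (by intro c x y; simp [mul_sub, Finset.mul_sum, mul_left_comm])

lemma mink_apply (x y : Vec d) : mink x y =
    ∑ i : Fin d, x i.castSucc * y i.castSucc - x (Fin.last d) * y (Fin.last d) := rfl

lemma mem_roundCone {v : Vec d} : v ∈ roundCone d ↔ mink v v < 0 ∧ 0 < v (Fin.last d) := by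
  have h0 : 0 ≤ ∑ i : Fin d, v i.castSucc ^ 2 := Finset.sum_nonneg fun i _ => sq_nonneg _
  have e : mink v v = ∑ i : Fin d, v i.castSucc ^ 2 - v (Fin.last d) ^ 2 := by
    rw [mink_apply]
    simp only [sq]
  rw [e, sub_neg]
  constructor
  · intro h
    have h1 : 0 < v (Fin.last d) := (Real.sqrt_nonneg _).trans_lt h
    exact ⟨(Real.sqrt_lt' h1).1 h, h1⟩
  · rintro ⟨h, h1⟩
    exact (Real.sqrt_lt' h1).2 h

lemma smul_mem_roundCone {v : Vec d} (hv : v ∈ roundCone d) {t : ℝ} (ht : 0 < t) :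
    t • v ∈ roundCone d := by
  rw [mem_roundCone] at hv ⊢
  refine ⟨?_, by simpa using mul_pos ht hv.2⟩
  simp only [map_smul, LinearMap.smul_apply, smul_eq_mul]
  exact mul_neg_of_pos_of_neg ht (mul_neg_of_pos_of_neg ht hv.1)

lemma mem_roundCone_or_neg_mem {v : Vec d} (hv : mink v v < 0) :
    v ∈ roundCone d ∨ -v ∈ roundCone d := by
  have hm : mink (-v) (-v) < 0 := by simpa using hv
  rw [mem_roundCone, mem_roundCone]
  rcases lt_trichotomy (v (Fin.last d)) 0 with h | h | h
  · exact .inr ⟨hm, by simpa using h⟩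
  · rw [mink_apply, h, mul_zero, sub_zero] at hv
    exact absurd hv (Finset.sum_nonneg fun i _ => mul_self_nonneg _).not_gt
  · exact .inl ⟨hv, h⟩

/-- The pull-back of the Minkowski form along a matrix. -/
noncomputable def pullForm (g : GL (Fin (d + 1)) ℝ) : Vec d →ₗ[ℝ] Vec d →ₗ[ℝ] ℝ :=
  mink.compl₁₂ g.1.mulVecLin g.1.mulVecLin

lemma mink_comm (x y : Vec d) : mink x y = mink y x := by
  simp [mink_apply, mul_comm]

lemma roundFor_pullForm (hU : SharpCone O.U) {g : GL (Fin (d + 1)) ℝ}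
    (hg : projMap g '' projOfCone O.U = projOfCone (roundCone d)) : RoundFor O.U (pullForm g) := by
  have hc : ∀ x ∈ O.U, ∀ t : ℝ, 0 < t → t • x ∈ O.U := fun x hx t ht => hU.smul_mem hx ht
  have hcf : ∀ x ∈ roundCone d, ∀ t : ℝ, 0 < t → t • x ∈ roundCone d :=
    fun x hx t ht => smul_mem_roundCone hx ht
  refine ⟨fun x y => mink_comm _ _, fun x hx => ?_, fun x hx => ?_⟩
  · change mink (g.1 *ᵥ x) (g.1 *ᵥ x) < 0
    have h0 := ne_zero_of_mem_U hx
    have h : pmk ⟨_, mulVec_ne_zero g h0⟩ ∈ projOfCone (roundCone d) := by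
      rw [← hg]
      exact ⟨_, ⟨x, h0, hx, rfl⟩, rfl⟩
    rcases (pmk_mem_projOfCone hcf).1 h with h | h
    · exact (mem_roundCone.1 h).1
    · simpa using (mem_roundCone.1 h).1
  · change mink (g.1 *ᵥ x) (g.1 *ᵥ x) < 0 at hx
    have hgx : g.1 *ᵥ x ≠ 0 := by
      intro h
      simp [h] at hx
    have hx0 : x ≠ 0 := by
      rintro rfl
      simp at hgx
    have h : projMap g (pmk ⟨x, hx0⟩) ∈ projMap g '' projOfCone O.U := by
      rw [hg, projMap_pmk g hx0 hgx, pmk_mem_projOfCone hcf]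
      exact mem_roundCone_or_neg_mem hx
    obtain ⟨_, ⟨v, hv, hvU, rfl⟩, h⟩ := h
    obtain ⟨a, ha, h⟩ := (pmk_eq_iff (v := ⟨_, mulVec_ne_zero g hv⟩) (w := ⟨_, hgx⟩)).1 h
    have e : a • x = v := by
      rw [← mulVec_inv_mulVec g v]
      change _ = (g⁻¹).1 *ᵥ Subtype.val (⟨g.1 *ᵥ v, mulVec_ne_zero g hv⟩ : {v : Vec d // v ≠ 0})
      rw [← h, mulVec_smul, mulVec_inv_mulVec]
    refine (pmk_mem_projOfCone (v := ⟨x, hx0⟩) hc).1 ⟨v, hv, hvU, ?_⟩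
    exact (pmk_eq_iff (v := ⟨x, hx0⟩) (w := ⟨v, hv⟩)).2 ⟨a⁻¹, inv_ne_zero ha, by
      change a⁻¹ • v = x
      rw [← e, smul_smul, inv_mul_cancel₀ ha, one_smul]⟩

/-- The bent cones divide and are not round. -/
theorem exists_divisible_not_ellipsoid (d : ℕ) (hd : 2 ≤ d) :
    ∃ Ω : Set (RP d), IsProperlyConvexDomain Ω ∧ IsStrictlyConvexDomain Ω ∧
      (∃ Γ : Subgroup (GL (Fin (d + 1)) ℝ), Divides Γ Ω) ∧
      ¬ ∃ g : GL (Fin (d + 1)) ℝ, detPM1 g ∧ projMap g '' Ω = projOfCone (roundCone d) := by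
  have hd1 : 1 ≤ d := by omega
  let O := Flag.std (rootWalls hd1) (basePt d) basePt_mem
  have hU : SharpCone O.U := sharpCone_U rfl
  refine ⟨projOfCone O.U, hU.isProperlyConvexDomain, hU.isStrictlyConvexDomain
    fun v w hvw hv hw => O.no_face hU hvw hv hw, ⟨_, divides hU⟩, ?_⟩
  rintro ⟨g, -, hg⟩
  obtain ⟨n, hn, n₁, hn₁, n₂, hn₂, y₁, hy₁, y₂, hy₂, h0, h1, h2, hp₁, hp₂⟩ := exists_walls hd1
  exact Flag.not_round hd rfl hn h0 hn₁ hn₂ hy₁ hy₂ h1 h2 hp₁ hp₂ (roundFor_pullForm hU hg)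

end BentDomain

/-- For every `d ≥ 2` there is a divisible strictly convex properly convex domain of
`ℝP^d` which is not projectively equivalent to an ellipsoid. -/
theorem exists_nonsymmetric_divisible_strictly_convex (d : ℕ) (hd : 2 ≤ d) :
    ∃ Ω : Set (RP d), IsProperlyConvexDomain Ω ∧ IsStrictlyConvexDomain Ω ∧
      (∃ Γ : Subgroup (GL (Fin (d + 1)) ℝ), Divides Γ Ω) ∧
      ¬ ∃ g : GL (Fin (d + 1)) ℝ, detPM1 g ∧ projMap g '' Ω = projOfCone (roundCone d) :=
  BentDomain.exists_divisible_not_ellipsoid d hd
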